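/- Let n, k ∈ ℕ, p ∈ [1,∞), q ∈ (0,∞) satisfy n(1/p − 1/q) < k, and let γ ∈ Γ_{p,q}. Then there exist constants 0 < c ≤ C < ∞, independent of f, such that for every locally integrable f : ℝ^n → ℝ having weak derivatives of order k with |∇^k f| ∈ L^p(ℝ^n), one has c‖|∇^k f|‖_{L^p} ≤ sup_{λ∈(0,∞)} λ (∫_{ℝ^n}[∫_{ℝ^n} 1_{E_{λ,γ/q,k}[f]}(x,h) |h|^{γ−n} dh]^{p/q} dx)^{1/p} ≤ C‖|∇^k f|‖_{L^p}. -/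

import Mathlib

open MeasureTheory Filter Set
open scoped ENNReal NNReal BigOperators Topology Classical

noncomputable section

/-- `ℝ^n`. -/
abbrev En (n : ℕ) := EuclideanSpace ℝ (Fin n)

variable {n : ℕ}

/-- The `k`-th order difference `Δ_h^k f (x) = ∑_{j=0}^k (-1)^{k-j} C(k,j) f (x + j h)`. -/
def kDiff (k : ℕ) (f : En n → ℝ) (h x : En n) : ℝ :=
  ∑ j ∈ Finset.range (k + 1), (-1 : ℝ) ^ (k - j) * (k.choose j : ℝ) * f (x + (j : ℝ) • h)

/-- Membership of `(x,h)` in `E_{λ,b,k,ℓ}[f]`. -/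
def memE (k ℓ : ℕ) (lam b : ℝ) (f : En n → ℝ) (x h : En n) : Prop :=
  h ≠ 0 ∧ lam * ‖h‖ ^ ((ℓ : ℝ) + b) < |kDiff k f h x|

/-- `∫_{ℝ^n} 1_{E_{λ,b,k,ℓ}[f]}(x,h) |h|^{γ-n} dh`. -/
def innerInt (k ℓ : ℕ) (lam b γ : ℝ) (f : En n → ℝ) (x : En n) : ℝ≥0∞ :=
  ∫⁻ h, if memE k ℓ lam b f x h then ENNReal.ofReal (‖h‖ ^ (γ - (n : ℝ))) else 0

/-- `λ (∫_{ℝ^n} (∫_{ℝ^n} 1_E |h|^{γ-n} dh)^{p/q} dx)^{1/p}`. -/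
def bsvy (k ℓ : ℕ) (p q b γ : ℝ) (f : En n → ℝ) (lam : ℝ) : ℝ≥0∞ :=
  ENNReal.ofReal lam * (∫⁻ x, (innerInt k ℓ lam b γ f x) ^ (p / q)) ^ (1 / p)

/-- First-order partial derivative in the `i`-th coordinate direction. -/
def pd (i : Fin n) (ψ : En n → ℝ) : En n → ℝ :=
  fun x => fderiv ℝ ψ x (EuclideanSpace.single i (1 : ℝ))

/-- Higher-order partial derivative `∂^α` associated with a multi-index `α`. -/
def mpd (α : Fin n → ℕ) (φ : En n → ℝ) : En n → ℝ :=
  (List.finRange n).foldr (fun i ψ => (pd i)^[α i] ψ) φ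

/-- `g` is the family of `m`-th order weak partial derivatives of `f`. -/
def HasWeakDerivs (m : ℕ) (f : En n → ℝ) (g : (Fin n → ℕ) → En n → ℝ) : Prop :=
  (∀ α : Fin n → ℕ, (∑ i, α i) = m → LocallyIntegrable (g α) volume) ∧
  ∀ α : Fin n → ℕ, (∑ i, α i) = m →
    ∀ φ : En n → ℝ, ContDiff ℝ (⊤ : ℕ∞) φ → HasCompactSupport φ →
      ∫ x, f x * mpd α φ x = (-1 : ℝ) ^ m * ∫ x, g α x * φ x

/-- `|∇^m f| = (∑_{|α| = m} |∂^α f|^2)^{1/2}`, given the family `g` of weak derivatives. -/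
def gradLen (m : ℕ) (g : (Fin n → ℕ) → En n → ℝ) (x : En n) : ℝ :=
  Real.sqrt (∑' α : Fin n → ℕ, if (∑ i, α i) = m then (g α x) ^ 2 else 0)

/-- The parameter range `Γ_{p,q}`. -/
def Gam (p q : ℝ) : Set ℝ := if p = 1 then Iio (-q) ∪ Ioi 0 else {(0 : ℝ)}ᶜ

/-- `‖ |∇^m f| ‖_{L^p}` as an `ℝ≥0∞`-valued quantity. -/
def gradLp (p : ℝ) (m : ℕ) (g : (Fin n → ℕ) → En n → ℝ) : ℝ≥0∞ :=
  (∫⁻ x, ENNReal.ofReal (gradLen m g x ^ p)) ^ (1 / p)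

end

section Differences

variable {n : ℕ}

lemma kDiff_succ (k : ℕ) (f : En n → ℝ) (h x : En n) :
    kDiff (k + 1) f h x = kDiff k f h (x + h) - kDiff k f h x := by
  have key : ∀ (m : ℕ) (y : En n), kDiff m f h y = (fwdDiff h)^[m] f y := by
    intro m y
    rw [fwdDiff_iter_eq_sum_shift]
    refine Finset.sum_congr rfl fun j _ => ?_
    simp [zsmul_eq_mul, Nat.cast_smul_eq_nsmul]
  simp only [key, Function.iterate_succ', Function.comp_apply, fwdDiff]

lemma kDiff_zero_right {k : ℕ} (hk : 0 < k) (f : En n → ℝ) (x : En n) : kDiff k f 0 x = 0 := by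
  obtain ⟨m, rfl⟩ := Nat.exists_eq_succ_of_ne_zero hk.ne'
  simp [kDiff_succ]

lemma kDiff_comm_step (k : ℕ) (f : En n → ℝ) (h w x : En n) :
    ∑ m ∈ Finset.range (k + 1), (-1 : ℝ) ^ (k - m) * (k.choose m : ℝ) * kDiff k f (h + (m : ℝ) • w) x
      = ∑ j ∈ Finset.range (k + 1), (-1 : ℝ) ^ (k - j) * (k.choose j : ℝ) *
          kDiff k f ((j : ℝ) • w) (x + (j : ℝ) • h) := by
  simp only [kDiff, Finset.mul_sum]
  rw [Finset.sum_comm]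
  refine Finset.sum_congr rfl fun j _ => Finset.sum_congr rfl fun m _ => ?_
  rw [show x + (j : ℝ) • (h + (m : ℝ) • w) = x + (j : ℝ) • h + (m : ℝ) • (j : ℝ) • w by
    rw [smul_add, smul_comm, add_assoc]]
  ring

lemma kDiff_comm_base (k : ℕ) (f : En n → ℝ) (w z y : En n) :
    ∑ m ∈ Finset.range (k + 1), (-1 : ℝ) ^ (k - m) * (k.choose m : ℝ) * kDiff k f w (y + (m : ℝ) • z)
      = ∑ j ∈ Finset.range (k + 1), (-1 : ℝ) ^ (k - j) * (k.choose j : ℝ) *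
          kDiff k f z (y + (j : ℝ) • w) := by
  simp only [kDiff, Finset.mul_sum]
  rw [Finset.sum_comm]
  refine Finset.sum_congr rfl fun j _ => Finset.sum_congr rfl fun m _ => ?_
  rw [add_right_comm]
  ring

/-- If a signed binomial sum of `A` equals one of `B`, then `|A 0|` exceeds `|B 0|` by at most
`2^k` times the sum of the remaining terms. -/
lemma abs_sub_le_of_binomial_sum_eq (k : ℕ) (A B : ℕ → ℝ)
    (hAB : ∑ m ∈ Finset.range (k + 1), (-1 : ℝ) ^ (k - m) * (k.choose m : ℝ) * A m
      = ∑ m ∈ Finset.range (k + 1), (-1 : ℝ) ^ (k - m) * (k.choose m : ℝ) * B m) :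
    |A 0| - |B 0| ≤ 2 ^ k * ∑ m ∈ Finset.Icc 1 k, (|A m| + |B m|) := by
  have hsplit : ∀ u : ℕ → ℝ, ∑ m ∈ Finset.range (k + 1), u m = u 0 + ∑ m ∈ Finset.Icc 1 k, u m := by
    intro u
    rw [Finset.range_eq_Ico, Finset.sum_eq_sum_Ico_succ_bot (Nat.succ_pos k)]
    congr 1
  rw [hsplit, hsplit] at hAB
  have hbound : ∀ u : ℕ → ℝ,
      |∑ m ∈ Finset.Icc 1 k, (-1 : ℝ) ^ (k - m) * (k.choose m : ℝ) * u m|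
        ≤ 2 ^ k * ∑ m ∈ Finset.Icc 1 k, |u m| := by
    intro u
    rw [Finset.mul_sum]
    refine (Finset.abs_sum_le_sum_abs _ _).trans (Finset.sum_le_sum fun m _ => ?_)
    rw [abs_mul, abs_mul, abs_pow, abs_neg, abs_one, one_pow, one_mul, Nat.abs_cast]
    refine mul_le_mul_of_nonneg_right ?_ (abs_nonneg _)
    exact_mod_cast Nat.choose_le_two_pow k m
  have hA := hbound A
  have hB := hbound B
  rw [Finset.sum_add_distrib, mul_add]
  set SA := ∑ m ∈ Finset.Icc 1 k, (-1 : ℝ) ^ (k - m) * (k.choose m : ℝ) * A m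
  set SB := ∑ m ∈ Finset.Icc 1 k, (-1 : ℝ) ^ (k - m) * (k.choose m : ℝ) * B m
  simp only [Nat.sub_zero, Nat.choose_zero_right, Nat.cast_one, mul_one] at hAB
  have h1 : (-1 : ℝ) ^ k * A 0 = (-1 : ℝ) ^ k * B 0 + SB - SA := by linarith
  have h2 : |A 0| = |(-1 : ℝ) ^ k * B 0 + SB - SA| := by
    rw [← h1, abs_mul, abs_pow, abs_neg, abs_one, one_pow, one_mul]
  have h3 : |(-1 : ℝ) ^ k * B 0| = |B 0| := by
    rw [abs_mul, abs_pow, abs_neg, abs_one, one_pow, one_mul]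
  have h4 := abs_sub ((-1 : ℝ) ^ k * B 0 + SB) SA
  have h5 := abs_add_le ((-1 : ℝ) ^ k * B 0) SB
  linarith

lemma exists_large_of_binomial_sum_eq {k : ℕ} (hk : 0 < k) {T : ℝ} (A B : ℕ → ℝ)
    (hAB : ∑ m ∈ Finset.range (k + 1), (-1 : ℝ) ^ (k - m) * (k.choose m : ℝ) * A m
      = ∑ m ∈ Finset.range (k + 1), (-1 : ℝ) ^ (k - m) * (k.choose m : ℝ) * B m)
    (hT : T < |A 0| - |B 0|) :
    ∃ m ∈ Finset.Icc 1 k, T / (2 * k * 2 ^ k) < |A m| ∨ T / (2 * k * 2 ^ k) < |B m| := by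
  by_contra! hcon
  have h := abs_sub_le_of_binomial_sum_eq k A B hAB
  have h2 : ∑ m ∈ Finset.Icc 1 k, (|A m| + |B m|) ≤ ∑ m ∈ Finset.Icc 1 k, 2 * (T / (2 * k * 2 ^ k)) :=
    Finset.sum_le_sum fun m hm => by linarith [(hcon m hm).1, (hcon m hm).2]
  rw [Finset.sum_const, Nat.card_Icc, nsmul_eq_mul, Nat.add_sub_cancel] at h2
  have hk' : (0 : ℝ) < k := by exact_mod_cast hk
  have h3 : 2 ^ k * ((k : ℝ) * (2 * (T / (2 * k * 2 ^ k)))) = T := by field_simp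
  have h4 := mul_le_mul_of_nonneg_left h2 (by positivity : (0 : ℝ) ≤ 2 ^ k)
  linarith

end Differences

section DirectionalDerivatives

variable {n : ℕ}

/-- The derivative of `φ` in the fixed direction `h`. -/
noncomputable def dirDeriv (h : En n) (φ : En n → ℝ) : En n → ℝ := fun x => fderiv ℝ φ x h

lemma contDiff_dirDeriv (h : En n) {φ : En n → ℝ} (hφ : ContDiff ℝ (⊤ : ℕ∞) φ) :
    ContDiff ℝ (⊤ : ℕ∞) (dirDeriv h φ) :=
  (hφ.fderiv_right (by norm_cast)).clm_apply contDiff_const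

lemma contDiff_iterate_dirDeriv (h : En n) {φ : En n → ℝ} (hφ : ContDiff ℝ (⊤ : ℕ∞) φ) (k : ℕ) :
    ContDiff ℝ (⊤ : ℕ∞) ((dirDeriv h)^[k] φ) := by
  induction k with
  | zero => exact hφ
  | succ k ih => rw [Function.iterate_succ_apply']; exact contDiff_dirDeriv h ih

lemma HasCompactSupport.dirDeriv {φ : En n → ℝ} (hφ : HasCompactSupport φ) (h : En n) :
    HasCompactSupport (dirDeriv h φ) :=
  (hφ.fderiv ℝ).comp_left (g := fun L : En n →L[ℝ] ℝ => L h) rfl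

lemma HasCompactSupport.iterate_dirDeriv {φ : En n → ℝ} (hφ : HasCompactSupport φ) (h : En n)
    (k : ℕ) : HasCompactSupport ((_root_.dirDeriv h)^[k] φ) := by
  induction k with
  | zero => exact hφ
  | succ k ih => rw [Function.iterate_succ_apply']; exact HasCompactSupport.dirDeriv ih h

/-- The space of smooth functions on `ℝ^n`. -/
def smoothFun (n : ℕ) : Submodule ℝ (En n → ℝ) where
  carrier := {φ | ContDiff ℝ (⊤ : ℕ∞) φ}
  add_mem' {φ _} ha hb := (show ContDiff ℝ (⊤ : ℕ∞) φ from ha).add hb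
  zero_mem' := (contDiff_const : ContDiff ℝ (⊤ : ℕ∞) fun _ : En n => (0 : ℝ))
  smul_mem' c φ ha := (show ContDiff ℝ (⊤ : ℕ∞) φ from ha).const_smul c

lemma differentiable_of_smooth {φ : En n → ℝ} (hφ : ContDiff ℝ (⊤ : ℕ∞) φ) : Differentiable ℝ φ :=
  hφ.differentiable (by simp)

/-- The directional derivative as an endomorphism of the space of smooth functions. -/
noncomputable def dirEnd (h : En n) : Module.End ℝ (smoothFun n) where
  toFun φ := ⟨dirDeriv h φ.1, contDiff_dirDeriv h φ.2⟩
  map_add' φ ψ := by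
    ext x
    have h1 := differentiable_of_smooth φ.2 x
    have h2 := differentiable_of_smooth ψ.2 x
    simp [dirDeriv, fderiv_add h1 h2]
  map_smul' c φ := by
    ext x
    have h1 := differentiable_of_smooth φ.2 x
    simp [dirDeriv, fderiv_const_smul h1 c]

lemma dirEnd_commute (h h' : En n) : Commute (dirEnd h) (dirEnd h') := by
  refine LinearMap.ext fun φ => Subtype.ext (funext fun x => ?_)
  have hφ : ContDiff ℝ (⊤ : ℕ∞) φ.1 := φ.2
  have hd : DifferentiableAt ℝ (fderiv ℝ φ.1) x :=
    (hφ.fderiv_right (m := (⊤ : ℕ∞)) (by norm_cast)).differentiable (by simp) x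
  have hcalc : ∀ a b : En n, (dirEnd a (dirEnd b φ)).1 x = fderiv ℝ (fderiv ℝ φ.1) x a b := by
    intro a b
    change fderiv ℝ (fun y => fderiv ℝ φ.1 y b) x a = _
    rw [fderiv_clm_apply hd (differentiableAt_const b)]
    simp
  change (dirEnd h (dirEnd h' φ)).1 x = (dirEnd h' (dirEnd h φ)).1 x
  rw [hcalc, hcalc]
  have hs : IsSymmSndFDerivAt ℝ φ.1 x :=
    hφ.contDiffAt.isSymmSndFDerivAt (by
      rw [minSmoothness_of_isRCLikeNormedField]
      exact WithTop.coe_le_coe.2 (le_top : (2 : ℕ∞) ≤ ⊤))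
  exact hs h h'

lemma dirEnd_eq_sum (h : En n) :
    dirEnd h = ∑ i : Fin n, (h i) • dirEnd (EuclideanSpace.single i (1 : ℝ)) := by
  refine LinearMap.ext fun φ => Subtype.ext (funext fun x => ?_)
  have hh : h = ∑ i : Fin n, (h i) • EuclideanSpace.single i (1 : ℝ) := by
    ext j
    simp [Finset.sum_apply, Pi.single_apply]
  have : (dirEnd h φ).1 x = ∑ i : Fin n, h i * fderiv ℝ φ.1 x (EuclideanSpace.single i (1 : ℝ)) := by
    change fderiv ℝ φ.1 x h = _
    conv_lhs => rw [hh]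
    simp [map_sum]
  rw [this]
  simp [LinearMap.sum_apply, Finset.sum_apply, dirEnd, dirDeriv]

lemma dirEnd_pow_apply (h : En n) (k : ℕ) (φ : smoothFun n) :
    ((dirEnd h ^ k) φ).1 = (dirDeriv h)^[k] φ.1 := by
  induction k with
  | zero => rfl
  | succ k ih => rw [pow_succ', Function.iterate_succ_apply', ← ih]; rfl

lemma list_prod_dirEnd_apply (l : List (Fin n)) (α : Fin n → ℕ) (φ : smoothFun n) :
    ((l.map fun i => dirEnd (EuclideanSpace.single i (1 : ℝ)) ^ α i).prod φ).1
      = l.foldr (fun i ψ => (pd i)^[α i] ψ) φ.1 := by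
  induction l with
  | nil => rfl
  | cons i l ih =>
    rw [List.map_cons, List.prod_cons, List.foldr_cons, ← ih, Module.End.mul_apply,
      dirEnd_pow_apply]
    rfl

/-- The coefficient of `∂^α` in the `|α|`-th power of the derivative in the direction `h`. -/
noncomputable def dirCoeff (α : Fin n → ℕ) (h : En n) : ℝ :=
  (Nat.multinomial Finset.univ α : ℝ) * ∏ i, h i ^ α i

/-- Multinomial expansion of the iterated directional derivative. -/
lemma iterate_dirDeriv_eq_sum (h : En n) (k : ℕ) {φ : En n → ℝ} (hφ : ContDiff ℝ (⊤ : ℕ∞) φ)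
    (x : En n) :
    (dirDeriv h)^[k] φ x
      = ∑ α ∈ Finset.piAntidiag (Finset.univ : Finset (Fin n)) k, dirCoeff α h * mpd α φ x := by
  have h1 := dirEnd_pow_apply h k ⟨φ, hφ⟩
  have h2 := congrFun h1 x
  rw [← h2, dirEnd_eq_sum, Finset.sum_pow_eq_sum_piAntidiag_of_commute]
  swap
  · intro i _ j _ _
    exact ((dirEnd_commute _ _).smul_left _).smul_right _
  rw [LinearMap.sum_apply]
  have h3 : ∀ (s : Finset (Fin n → ℕ)) (F : (Fin n → ℕ) → smoothFun n),
      (∑ a ∈ s, F a).1 x = ∑ a ∈ s, (F a).1 x := by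
    intro s F
    rw [Submodule.coe_sum, Finset.sum_apply]
  rw [h3]
  refine Finset.sum_congr rfl fun α _ => ?_
  have huniv : (Finset.univ : Finset (Fin n)) = (List.finRange n).toFinset := by simp
  have h4 : ∀ (hc : ((Finset.univ : Finset (Fin n)) : Set (Fin n)).Pairwise
      (Function.onFun Commute fun i => (h i • dirEnd (EuclideanSpace.single i (1 : ℝ))) ^ α i)),
      (Finset.univ : Finset (Fin n)).noncommProd
        (fun i => (h i • dirEnd (EuclideanSpace.single i (1 : ℝ))) ^ α i) hc
      = (∏ i, h i ^ α i) •
        ((List.finRange n).map fun i => dirEnd (EuclideanSpace.single i (1 : ℝ)) ^ α i).prod := by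
    intro hc
    have h5 : (Finset.univ : Finset (Fin n)).noncommProd
        (fun i => (h i • dirEnd (EuclideanSpace.single i (1 : ℝ))) ^ α i) hc
        = ((List.finRange n).map fun i => (h i • dirEnd (EuclideanSpace.single i (1 : ℝ))) ^ α i).prod := by
      rw [← Finset.noncommProd_toFinset (List.finRange n) _ (by rw [← huniv]; exact hc)
        (List.nodup_finRange n)]
      congr 1
    rw [h5, ← List.prod_ofFn, List.ofFn_eq_map]
    generalize List.finRange n = l
    induction l with
    | nil => simp
    | cons i l ih =>
      rw [List.map_cons, List.prod_cons, List.map_cons, List.prod_cons, List.map_cons,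
        List.prod_cons, ih, smul_pow, smul_mul_smul_comm]
  rw [h4, dirCoeff]
  have h6 := congrFun (list_prod_dirEnd_apply (List.finRange n) α ⟨φ, hφ⟩) x
  rw [← nsmul_eq_mul, LinearMap.smul_apply, LinearMap.smul_apply, Submodule.coe_smul_of_tower,
    Submodule.coe_smul, Pi.smul_apply, Pi.smul_apply, h6, nsmul_eq_mul, smul_eq_mul, mul_assoc]
  rfl

/-- The `k`-homogeneous polynomial in `h` whose coefficients are the multi-indexed vector `v`. -/
noncomputable def dirPoly (k : ℕ) (v : (Fin n → ℕ) → ℝ) (h : En n) : ℝ :=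
  ∑ α ∈ Finset.piAntidiag (Finset.univ : Finset (Fin n)) k, dirCoeff α h * v α

lemma continuous_dirCoeff (α : Fin n → ℕ) : Continuous (dirCoeff α) := by
  unfold dirCoeff
  fun_prop

lemma dirCoeff_smul (α : Fin n → ℕ) (t : ℝ) (h : En n) :
    dirCoeff α (t • h) = t ^ (∑ i, α i) * dirCoeff α h := by
  simp only [dirCoeff, PiLp.smul_apply, smul_eq_mul, mul_pow, Finset.prod_mul_distrib,
    Finset.prod_pow_eq_pow_sum]
  ring

lemma dirPoly_smul (k : ℕ) (v : (Fin n → ℕ) → ℝ) (t : ℝ) (h : En n) :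
    dirPoly k v (t • h) = t ^ k * dirPoly k v h := by
  simp only [dirPoly, Finset.mul_sum]
  refine Finset.sum_congr rfl fun α hα => ?_
  rw [dirCoeff_smul, (Finset.mem_piAntidiag.1 hα).1]
  ring

lemma abs_dirCoeff_le (k : ℕ) {α : Fin n → ℕ} (hα : ∑ i, α i = k) (h : En n) :
    |dirCoeff α h| ≤ Nat.multinomial Finset.univ α * ‖h‖ ^ k := by
  rw [dirCoeff, abs_mul, Nat.abs_cast, Finset.abs_prod, ← hα, ← Finset.prod_pow_eq_pow_sum]
  refine mul_le_mul_of_nonneg_left (Finset.prod_le_prod (fun _ _ => abs_nonneg _) fun i _ => ?_)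
    (Nat.cast_nonneg _)
  rw [abs_pow]
  exact pow_le_pow_left₀ (abs_nonneg _) (by simpa using PiLp.norm_apply_le h i) _

lemma gradLen_eq (k : ℕ) (g : (Fin n → ℕ) → En n → ℝ) (x : En n) :
    gradLen k g x
      = √(∑ α ∈ Finset.piAntidiag (Finset.univ : Finset (Fin n)) k, g α x ^ 2) := by
  rw [gradLen, tsum_eq_sum (s := Finset.piAntidiag (Finset.univ : Finset (Fin n)) k)]
  · congr 1
    exact Finset.sum_congr rfl fun α hα => if_pos (Finset.mem_piAntidiag.1 hα).1
  · intro α hα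
    refine if_neg fun h => hα (Finset.mem_piAntidiag.2 ⟨h, by simp⟩)

lemma abs_le_gradLen (k : ℕ) (g : (Fin n → ℕ) → En n → ℝ) (x : En n) {α : Fin n → ℕ}
    (hα : α ∈ Finset.piAntidiag (Finset.univ : Finset (Fin n)) k) : |g α x| ≤ gradLen k g x := by
  rw [gradLen_eq]
  refine Real.abs_le_sqrt ?_
  exact Finset.single_le_sum (f := fun α => g α x ^ 2) (fun _ _ => sq_nonneg _) hα

/-- The sum of the multinomial coefficients of order `k`. -/
noncomputable def multiSum (n k : ℕ) : ℝ :=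
  ∑ α ∈ Finset.piAntidiag (Finset.univ : Finset (Fin n)) k, (Nat.multinomial Finset.univ α : ℝ)

lemma multiSum_nonneg (n k : ℕ) : 0 ≤ multiSum n k :=
  Finset.sum_nonneg fun _ _ => Nat.cast_nonneg _

lemma abs_dirPoly_le (k : ℕ) (v : (Fin n → ℕ) → ℝ) (h : En n) {M : ℝ}
    (hv : ∀ α ∈ Finset.piAntidiag (Finset.univ : Finset (Fin n)) k, |v α| ≤ M) :
    |dirPoly k v h| ≤ multiSum n k * ‖h‖ ^ k * M := by
  rw [dirPoly, multiSum, Finset.sum_mul, Finset.sum_mul]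
  refine (Finset.abs_sum_le_sum_abs _ _).trans (Finset.sum_le_sum fun α hα => ?_)
  rw [abs_mul]
  exact mul_le_mul (abs_dirCoeff_le k (Finset.mem_piAntidiag.1 hα).1 h) (hv α hα) (abs_nonneg _)
    (by positivity)

end DirectionalDerivatives

section StepMeasure

/-- The `k`-fold convolution power of the uniform measure on `[0, 1]`. -/
noncomputable def stepMeas : ℕ → Measure ℝ
  | 0 => Measure.dirac 0
  | k + 1 => (stepMeas k) ∗ (volume.restrict (Icc (0 : ℝ) 1))

instance isProbabilityMeasure_restrict_unit :
    IsProbabilityMeasure (volume.restrict (Icc (0 : ℝ) 1)) := ⟨by simp⟩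

instance isProbabilityMeasure_stepMeas (k : ℕ) : IsProbabilityMeasure (stepMeas k) := by
  induction k with
  | zero => rw [stepMeas]; infer_instance
  | succ k ih => rw [stepMeas]; infer_instance

lemma stepMeas_compl_Icc (k : ℕ) : stepMeas k (Icc (0 : ℝ) k)ᶜ = 0 := by
  induction k with
  | zero => simp [stepMeas]
  | succ k ih =>
    have hm : MeasurableSet (Icc (0 : ℝ) (k + 1 : ℕ))ᶜ := measurableSet_Icc.compl
    rw [← lintegral_indicator_one hm, stepMeas, Measure.lintegral_conv (measurable_one.indicator hm)]
    have h1 : ∀ᵐ s ∂(stepMeas k), s ∈ Icc (0 : ℝ) k := by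
      rw [ae_iff]; exact ih
    rw [lintegral_eq_zero_of_ae_eq_zero]
    filter_upwards [h1] with s hs
    refine setLIntegral_eq_zero measurableSet_Icc fun t ht => ?_
    simp only [Pi.zero_apply]
    rw [indicator_of_notMem]
    simp only [mem_compl_iff, not_not, mem_Icc] at hs ht ⊢
    push_cast
    constructor <;> linarith [hs.1, hs.2, ht.1, ht.2]

lemma ae_mem_stepMeas (k : ℕ) : ∀ᵐ s ∂(stepMeas k), s ∈ Icc (0 : ℝ) k := by
  rw [ae_iff]; exact stepMeas_compl_Icc k

lemma lintegral_stepMeas_le {k : ℕ} (hk : 0 < k) {f : ℝ → ℝ≥0∞} (hf : Measurable f) :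
    ∫⁻ s, f s ∂(stepMeas k) ≤ ∫⁻ s in Icc (0 : ℝ) k, f s := by
  obtain ⟨m, rfl⟩ := Nat.exists_eq_succ_of_ne_zero hk.ne'
  rw [stepMeas, Measure.lintegral_conv hf]
  have h1 : ∀ᵐ s ∂(stepMeas m), ∫⁻ t in Icc (0 : ℝ) 1, f (s + t)
      ≤ ∫⁻ s in Icc (0 : ℝ) (m + 1 : ℕ), f s := by
    filter_upwards [ae_mem_stepMeas m] with s hs
    rw [← lintegral_indicator measurableSet_Icc, ← lintegral_indicator measurableSet_Icc,
      ← lintegral_add_left_eq_self ((Icc (0 : ℝ) (m + 1 : ℕ)).indicator f) s]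
    refine lintegral_mono fun t => ?_
    by_cases ht : t ∈ Icc (0 : ℝ) 1
    · rw [indicator_of_mem ht, indicator_of_mem]
      push_cast
      constructor <;> linarith [hs.1, hs.2, ht.1, ht.2]
    · rw [indicator_of_notMem ht]; exact zero_le
  refine (lintegral_mono_ae h1).trans ?_
  simp

lemma integral_stepMeas_succ (k : ℕ) {f : ℝ → ℝ} (hf : Continuous f) {M : ℝ} (hM : ∀ s, |f s| ≤ M) :
    ∫ s, f s ∂(stepMeas (k + 1)) = ∫ t in (0 : ℝ)..1, ∫ s, f (s + t) ∂(stepMeas k) := by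
  rw [stepMeas, integral_conv, intervalIntegral.integral_of_le zero_le_one,
    ← integral_Icc_eq_integral_Ioc]
  · rw [integral_integral_swap]
    exact Integrable.of_bound (C := M) (by
      exact (hf.comp (continuous_fst.add continuous_snd)).aestronglyMeasurable) (ae_of_all _ fun z => hM _)
  · exact Integrable.of_bound (C := M) hf.aestronglyMeasurable (ae_of_all _ fun z => hM _)

variable {n : ℕ}

lemma continuous_kDiff {f : En n → ℝ} (hf : Continuous f) (k : ℕ) (h : En n) :
    Continuous (kDiff k f h) := by
  unfold kDiff
  fun_prop

lemma hasDerivAt_kDiff (k : ℕ) {φ : En n → ℝ} (hφ : ContDiff ℝ (⊤ : ℕ∞) φ) (h x : En n) (t : ℝ) :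
    HasDerivAt (fun t : ℝ => kDiff k φ h (x + t • h)) (kDiff k (dirDeriv h φ) h (x + t • h)) t := by
  unfold kDiff
  refine HasDerivAt.fun_sum fun j _ => HasDerivAt.const_mul _ ?_
  have h1 : HasDerivAt (fun t : ℝ => x + t • h + (j : ℝ) • h) h t := by
    simpa using (((hasDerivAt_id t).smul_const h).const_add x).add_const ((j : ℝ) • h)
  exact ((differentiable_of_smooth hφ _).hasFDerivAt.comp_hasDerivAt t h1)

/-- The difference operator is an average of the iterated directional derivative. -/
lemma kDiff_eq_integral (k : ℕ) (h x : En n) {φ : En n → ℝ} (hφ : ContDiff ℝ (⊤ : ℕ∞) φ)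
    (hc : HasCompactSupport φ) :
    kDiff k φ h x = ∫ s, (dirDeriv h)^[k] φ (x + s • h) ∂(stepMeas k) := by
  induction k generalizing φ x with
  | zero => simp [kDiff, stepMeas]
  | succ k ih =>
    have hcont := (contDiff_iterate_dirDeriv h hφ (k + 1)).continuous
    obtain ⟨M, hM⟩ := hcont.bounded_above_of_compact_support (HasCompactSupport.iterate_dirDeriv hc h (k + 1))
    rw [integral_stepMeas_succ k (f := fun s => (dirDeriv h)^[k + 1] φ (x + s • h)) (by fun_prop)
      (M := M) (fun s => hM _)]
    have h1 : ∀ t : ℝ, ∫ s, (dirDeriv h)^[k + 1] φ (x + (s + t) • h) ∂(stepMeas k)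
        = kDiff k (dirDeriv h φ) h (x + t • h) := by
      intro t
      rw [ih _ (contDiff_dirDeriv h hφ) (HasCompactSupport.dirDeriv hc h)]
      simp only [Function.iterate_succ_apply, add_smul, add_assoc, add_comm (t • h)]
    simp only [h1]
    rw [intervalIntegral.integral_eq_sub_of_hasDerivAt (fun t _ => hasDerivAt_kDiff k hφ h x t)]
    · rw [kDiff_succ]; simp
    · refine Continuous.intervalIntegrable ?_ _ _
      exact (continuous_kDiff (contDiff_dirDeriv h hφ).continuous k h).comp (by fun_prop)

end StepMeasure

section Representation

variable {n : ℕ}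

lemma integrable_mul_comp_sub (k : ℕ) (h : En n) {f ψ : En n → ℝ} (hf : LocallyIntegrable f volume)
    (hψ : Continuous ψ) (hc : HasCompactSupport ψ) :
    Integrable (fun z : En n × ℝ => f z.1 * ψ (z.1 - z.2 • h)) (volume.prod (stepMeas k)) := by
  obtain ⟨M, hM⟩ := hψ.bounded_above_of_compact_support hc
  set K' : Set (En n) := (fun w : En n × ℝ => w.1 + w.2 • h) '' (tsupport ψ ×ˢ Icc (0 : ℝ) k) with hK'
  have hK : IsCompact K' := (IsCompact.prod hc isCompact_Icc).image (by fun_prop)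
  have h1 : Integrable (K'.indicator f) volume :=
    (hf.integrableOn_isCompact hK).integrable_indicator hK.measurableSet
  have h2 : Integrable (fun z : En n × ℝ => K'.indicator f z.1) (volume.prod (stepMeas k)) :=
    h1.comp_fst _
  have h3 : Integrable (fun z : En n × ℝ => K'.indicator f z.1 * ψ (z.1 - z.2 • h))
      (volume.prod (stepMeas k)) := by
    refine h2.mul_bdd (c := M) ?_ (ae_of_all _ fun z => hM _)
    exact (hψ.comp (by fun_prop : Continuous fun z : En n × ℝ => z.1 - z.2 • h)).aestronglyMeasurable
  refine h3.congr ?_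
  have h4 : ∀ᵐ z : En n × ℝ ∂(volume.prod (stepMeas k)), z.2 ∈ Icc (0 : ℝ) k :=
    Measure.quasiMeasurePreserving_snd.ae (ae_mem_stepMeas k)
  filter_upwards [h4] with z hz
  by_cases hz1 : z.1 ∈ K'
  · rw [indicator_of_mem hz1]
  · have : ψ (z.1 - z.2 • h) = 0 := by
      by_contra hne
      refine hz1 ⟨(z.1 - z.2 • h, z.2), ⟨subset_tsupport _ hne, hz⟩, by simp⟩
    rw [this, mul_zero, mul_zero]

lemma integrable_comp_add_mul (k : ℕ) (h : En n) {f ψ : En n → ℝ} (hf : LocallyIntegrable f volume)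
    (hψ : Continuous ψ) (hc : HasCompactSupport ψ) :
    Integrable (fun z : En n × ℝ => f (z.1 + z.2 • h) * ψ z.1) (volume.prod (stepMeas k)) := by
  have hmp : MeasurePreserving (fun z : En n × ℝ => (z.1 + z.2 • h, z.2))
      (volume.prod (stepMeas k)) (volume.prod (stepMeas k)) := by
    have h1 : MeasurePreserving (fun z : ℝ × En n => (z.1, z.2 + z.1 • h))
        ((stepMeas k).prod volume) ((stepMeas k).prod volume) := by
      refine (MeasurePreserving.id (stepMeas k)).skew_product (g := fun s x => x + s • h) (by fun_prop) ?_
      exact ae_of_all _ fun s => (measurePreserving_add_right volume (s • h)).map_eq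
    exact (Measure.measurePreserving_swap.comp h1).comp Measure.measurePreserving_swap
  have := hmp.integrable_comp_of_integrable (integrable_mul_comp_sub k h hf hψ hc)
  simpa [Function.comp_def] using this

lemma integral_step_swap (k : ℕ) (h : En n) {f ψ : En n → ℝ} (hf : LocallyIntegrable f volume)
    (hψ : Continuous ψ) (hc : HasCompactSupport ψ) :
    ∫ x, f x * ∫ s, ψ (x - s • h) ∂(stepMeas k)
      = ∫ x, ψ x * ∫ s, f (x + s • h) ∂(stepMeas k) := by
  have e1 : ∀ x, f x * ∫ s, ψ (x - s • h) ∂(stepMeas k)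
      = ∫ s, f x * ψ (x - s • h) ∂(stepMeas k) := fun x => (integral_const_mul _ _).symm
  have e2 : ∀ x, ψ x * ∫ s, f (x + s • h) ∂(stepMeas k)
      = ∫ s, f (x + s • h) * ψ x ∂(stepMeas k) := fun x => by
    rw [integral_mul_const, mul_comm]
  simp only [e1, e2]
  rw [integral_integral_swap (integrable_mul_comp_sub k h hf hψ hc)]
  refine Eq.trans ?_ (integral_integral_swap (integrable_comp_add_mul k h hf hψ hc)).symm
  refine integral_congr_ae (ae_of_all _ fun s => ?_)
  change ∫ x, f x * ψ (x - s • h) = ∫ x, f (x + s • h) * ψ x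
  rw [← integral_add_right_eq_self _ (s • h)]
  simp

lemma locallyIntegrable_step (k : ℕ) (h : En n) {f : En n → ℝ} (hf : LocallyIntegrable f volume) :
    LocallyIntegrable (fun x => ∫ s, f (x + s • h) ∂(stepMeas k)) volume := by
  rw [locallyIntegrable_iff]
  intro K hK
  obtain ⟨ψ, h1, hcs, -⟩ :=
    exists_continuousMap_one_of_isCompact_subset_isOpen hK isOpen_univ (subset_univ K)
  have h2 := (integrable_comp_add_mul k h hf ψ.continuous hcs).integral_prod_left
  refine (h2.integrableOn (s := K)).congr_fun (fun x hx => ?_) hK.measurableSet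
  simp [h1 hx]

lemma locallyIntegrable_comp_add {f : En n → ℝ} (hf : LocallyIntegrable f volume) (a : En n) :
    LocallyIntegrable (fun x => f (x + a)) volume := by
  rw [locallyIntegrable_iff]
  intro K hK
  have h1 := hf.integrableOn_isCompact (hK.image (f := fun x => x + a) (by fun_prop))
  exact (MeasurePreserving.integrableOn_image (measurePreserving_add_right volume a)
    (measurableEmbedding_addRight a)).1 h1

lemma locallyIntegrable_kDiff (k : ℕ) (h : En n) {f : En n → ℝ} (hf : LocallyIntegrable f volume) :
    LocallyIntegrable (kDiff k f h) volume := by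
  unfold kDiff
  refine locallyIntegrable_finsetSum _ fun j _ => ?_
  exact (locallyIntegrable_comp_add hf _).smul ((-1 : ℝ) ^ (k - j) * (k.choose j : ℝ))

lemma integrable_mul_test {f φ : En n → ℝ} (hf : LocallyIntegrable f volume)
    (hφ : Continuous φ) (hc : HasCompactSupport φ) : Integrable (fun x => f x * φ x) volume := by
  simpa [mul_comm] using hf.integrable_smul_left_of_hasCompactSupport hφ hc

lemma integral_kDiff_mul (k : ℕ) (h : En n) {f φ : En n → ℝ} (hf : LocallyIntegrable f volume)
    (hφ : Continuous φ) (hc : HasCompactSupport φ) :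
    ∫ x, kDiff k f h x * φ x = ∫ x, f x * kDiff k φ (-h) x := by
  have hc' : ∀ a : En n, HasCompactSupport fun x => φ (x + a) := fun a =>
    hc.comp_homeomorph (Homeomorph.addRight a)
  simp only [kDiff, Finset.sum_mul, Finset.mul_sum]
  rw [integral_finsetSum, integral_finsetSum]
  · refine Finset.sum_congr rfl fun j _ => ?_
    rw [← integral_add_right_eq_self (fun x => f x * _) ((j : ℝ) • h)]
    refine integral_congr_ae (ae_of_all _ fun x => ?_)
    simp
    ring
  · intro j _
    have := (integrable_mul_test hf ((hφ.comp (continuous_add_const ((j : ℝ) • -h))))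
      (hc' _)).const_mul ((-1 : ℝ) ^ (k - j) * (k.choose j : ℝ))
    refine this.congr (ae_of_all _ fun x => ?_)
    simp; ring
  · intro j _
    have := (integrable_mul_test (locallyIntegrable_comp_add hf ((j : ℝ) • h)) hφ hc).const_mul
      ((-1 : ℝ) ^ (k - j) * (k.choose j : ℝ))
    refine this.congr (ae_of_all _ fun x => ?_)
    simp; ring

lemma locallyIntegrable_dirPoly {k : ℕ} {g : (Fin n → ℕ) → En n → ℝ}
    (hg : ∀ α : Fin n → ℕ, (∑ i, α i) = k → LocallyIntegrable (g α) volume) (h : En n) :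
    LocallyIntegrable (fun x => dirPoly k (fun α => g α x) h) volume := by
  unfold dirPoly
  refine locallyIntegrable_finsetSum _ fun α hα => ?_
  exact (hg α (Finset.mem_piAntidiag.1 hα).1).smul (dirCoeff α h)

lemma iterate_dirDeriv_neg (h : En n) (k : ℕ) (φ : En n → ℝ) (hφ : ContDiff ℝ (⊤ : ℕ∞) φ) (x : En n) :
    (dirDeriv (-h))^[k] φ x = (-1) ^ k * (dirDeriv h)^[k] φ x := by
  rw [iterate_dirDeriv_eq_sum _ _ hφ, iterate_dirDeriv_eq_sum _ _ hφ, Finset.mul_sum]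
  refine Finset.sum_congr rfl fun α hα => ?_
  rw [← neg_one_smul ℝ h, dirCoeff_smul, (Finset.mem_piAntidiag.1 hα).1]
  ring

lemma contDiff_mpd (α : Fin n → ℕ) {φ : En n → ℝ} (hφ : ContDiff ℝ (⊤ : ℕ∞) φ) :
    ContDiff ℝ (⊤ : ℕ∞) (mpd α φ) := by
  unfold mpd
  generalize List.finRange n = l
  induction l with
  | nil => exact hφ
  | cons i l ih => exact contDiff_iterate_dirDeriv (EuclideanSpace.single i (1 : ℝ)) ih (α i)

lemma hasCompactSupport_mpd (α : Fin n → ℕ) {φ : En n → ℝ} (hφ : HasCompactSupport φ) :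
    HasCompactSupport (mpd α φ) := by
  unfold mpd
  generalize List.finRange n = l
  induction l with
  | nil => exact hφ
  | cons i l ih => exact HasCompactSupport.iterate_dirDeriv ih (EuclideanSpace.single i (1 : ℝ)) (α i)

lemma integral_mul_iterate_dirDeriv {k : ℕ} {f : En n → ℝ} {g : (Fin n → ℕ) → En n → ℝ}
    (hf : LocallyIntegrable f volume) (hg : HasWeakDerivs k f g) (h : En n)
    {φ : En n → ℝ} (hφ : ContDiff ℝ (⊤ : ℕ∞) φ) (hc : HasCompactSupport φ) :
    ∫ x, f x * (dirDeriv (-h))^[k] φ x = ∫ x, dirPoly k (fun α => g α x) h * φ x := by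
  simp only [iterate_dirDeriv_neg h k φ hφ, iterate_dirDeriv_eq_sum h k hφ, dirPoly, Finset.mul_sum,
    Finset.sum_mul]
  rw [integral_finsetSum, integral_finsetSum]
  · refine Finset.sum_congr rfl fun α hα => ?_
    have h1 := hg.2 α (Finset.mem_piAntidiag.1 hα).1 φ hφ hc
    have h2 : ∀ x, f x * ((-1) ^ k * (dirCoeff α h * mpd α φ x))
        = ((-1) ^ k * dirCoeff α h) * (f x * mpd α φ x) := fun x => by ring
    have h3 : ∀ x, dirCoeff α h * g α x * φ x = dirCoeff α h * (g α x * φ x) := fun x => by ring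
    simp only [h2, h3]
    rw [integral_const_mul, integral_const_mul, h1]
    linear_combination (dirCoeff α h * ∫ x, g α x * φ x) *
      (Even.neg_one_pow (α := ℝ) ⟨k, rfl⟩ : (-1 : ℝ) ^ (k + k) = 1)
  · intro α hα
    have := (integrable_mul_test (hg.1 α (Finset.mem_piAntidiag.1 hα).1) hφ.continuous hc).const_mul
      (dirCoeff α h)
    exact this.congr (ae_of_all _ fun x => by ring)
  · intro α hα
    have := (integrable_mul_test hf (contDiff_mpd α hφ).continuous (hasCompactSupport_mpd α hc)).const_mul
      ((-1) ^ k * dirCoeff α h)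
    exact this.congr (ae_of_all _ fun x => by ring)

/-- A function with weak derivatives of order `k` has its `k`-th order differences represented, for
each step `h` and almost every base point, as averages of the derivative along the segment. -/
theorem ae_kDiff_eq_integral {k : ℕ} {f : En n → ℝ} {g : (Fin n → ℕ) → En n → ℝ}
    (hf : LocallyIntegrable f volume) (hg : HasWeakDerivs k f g) (h : En n) :
    ∀ᵐ x, kDiff k f h x = ∫ s, dirPoly k (fun α => g α (x + s • h)) h ∂(stepMeas k) := by
  have hu := locallyIntegrable_dirPoly hg.1 h
  refine ae_eq_of_integral_contDiff_smul_eq (locallyIntegrable_kDiff k h hf)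
    (locallyIntegrable_step k h hu) fun φ hφ hc => ?_
  have hφ' : ContDiff ℝ (⊤ : ℕ∞) φ := hφ
  simp only [smul_eq_mul]
  have h1 : ∫ x, φ x * kDiff k f h x = ∫ x, f x * kDiff k φ (-h) x := by
    rw [← integral_kDiff_mul k h hf hφ'.continuous hc]; simp only [mul_comm]
  rw [h1, ← integral_step_swap k h hu hφ'.continuous hc]
  simp only [kDiff_eq_integral k (-h) _ hφ' hc]
  have hd := contDiff_iterate_dirDeriv (-h) hφ' k
  have hdc := HasCompactSupport.iterate_dirDeriv hc (-h) k
  have e1 : ∀ x, f x * ∫ s, (dirDeriv (-h))^[k] φ (x + s • -h) ∂(stepMeas k)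
      = ∫ s, f x * (dirDeriv (-h))^[k] φ (x - s • h) ∂(stepMeas k) := fun x => by
    rw [← integral_const_mul]
    simp [sub_eq_add_neg]
  have e2 : ∀ x, dirPoly k (fun α => g α x) h * ∫ s, φ (x - s • h) ∂(stepMeas k)
      = ∫ s, dirPoly k (fun α => g α x) h * φ (x - s • h) ∂(stepMeas k) := fun x =>
    (integral_const_mul _ _).symm
  simp only [e1, e2]
  rw [integral_integral_swap (integrable_mul_comp_sub k h hf hd.continuous hdc)]
  refine Eq.trans ?_ (integral_integral_swap (integrable_mul_comp_sub k h hu hφ'.continuous hc)).symm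
  refine integral_congr_ae (ae_of_all _ fun s => ?_)
  change ∫ x, f x * (dirDeriv (-h))^[k] φ (x - s • h)
    = ∫ x, dirPoly k (fun α => g α x) h * φ (x - s • h)
  have hφs : ContDiff ℝ (⊤ : ℕ∞) fun x => φ (x - s • h) := hφ'.comp (contDiff_id.sub contDiff_const)
  have hcs : HasCompactSupport fun x => φ (x - s • h) :=
    hc.comp_homeomorph (Homeomorph.subRight (s • h))
  rw [← integral_mul_iterate_dirDeriv hf hg h hφs hcs]
  have hshift : ∀ m : ℕ, (dirDeriv (-h))^[m] (fun x => φ (x - s • h))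
      = fun x => (dirDeriv (-h))^[m] φ (x - s • h) := by
    intro m
    induction m with
    | zero => rfl
    | succ m ih =>
      rw [Function.iterate_succ_apply', Function.iterate_succ_apply', ih]
      funext x
      simp [dirDeriv, sub_eq_add_neg, fderiv_comp_add_right]
  rw [hshift]

end Representation

section Differentiation

variable {n : ℕ}

lemma lintegral_comp_smul_of_pos {r : ℝ} (hr : 0 < r) (G : En n → ℝ≥0∞) :
    ∫⁻ h, G (r • h) = ENNReal.ofReal ((r ^ n)⁻¹) * ∫⁻ h, G h := by
  have h1 := Measure.map_addHaar_smul (volume : Measure (En n)) hr.ne'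
  have h2 := lintegral_map_equiv (μ := (volume : Measure (En n))) G
    (Homeomorph.smulOfNeZero r hr.ne' : En n ≃ₜ En n).toMeasurableEquiv
  simp only [Homeomorph.toMeasurableEquiv_coe, Homeomorph.smulOfNeZero_apply] at h2
  rw [← h2]
  change ∫⁻ a, G a ∂(Measure.map (r • ·) volume) = _
  rw [h1, lintegral_smul_measure]
  rw [abs_of_pos (by positivity), finrank_euclideanSpace_fin, smul_eq_mul]

lemma lintegral_ball_comp_smul {r ρ : ℝ} (hr : 0 < r) (G : En n → ℝ≥0∞) :
    ∫⁻ h in Metric.ball (0 : En n) ρ, G (r • h)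
      = ENNReal.ofReal ((r ^ n)⁻¹) * ∫⁻ h in Metric.ball (0 : En n) (r * ρ), G h := by
  rw [← lintegral_indicator Metric.isOpen_ball.measurableSet,
    ← lintegral_indicator Metric.isOpen_ball.measurableSet, ← lintegral_comp_smul_of_pos hr]
  congr 1
  funext h
  simp only [indicator, Metric.mem_ball, dist_zero_right, norm_smul, Real.norm_eq_abs,
    abs_of_pos hr]
  simp only [mul_lt_mul_iff_right₀ hr]

lemma lintegral_ball_comp_add_smul {r ρ : ℝ} (hr : 0 < r) (x : En n) (G : En n → ℝ≥0∞) :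
    ∫⁻ h in Metric.ball (0 : En n) ρ, G (x + r • h)
      = ENNReal.ofReal ((r ^ n)⁻¹) * ∫⁻ y in Metric.ball x (r * ρ), G y := by
  rw [lintegral_ball_comp_smul hr (fun y => G (x + y)), ← lintegral_indicator Metric.isOpen_ball.measurableSet,
    ← lintegral_indicator Metric.isOpen_ball.measurableSet,
    ← lintegral_add_left_eq_self ((Metric.ball x (r * ρ)).indicator G) x]
  congr 2
  funext h
  simp only [indicator, Metric.mem_ball, dist_zero_right, dist_self_add_left]

lemma volume_ball_eq (x : En n) {r : ℝ} (hr : 0 < r) :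
    volume (Metric.ball x r) = ENNReal.ofReal (r ^ n) * volume (Metric.ball (0 : En n) 1) := by
  rw [Measure.addHaar_ball_of_pos _ _ hr, finrank_euclideanSpace_fin]

lemma ae_tendsto_rescaled {u : En n → ℝ} (hu : LocallyIntegrable u volume) :
    ∀ᵐ x, Tendsto (fun r : ℝ => ∫⁻ h in Metric.ball (0 : En n) 1, ‖u (x + r • h) - u x‖ₑ)
      (𝓝[>] 0) (𝓝 0) := by
  filter_upwards [(Besicovitch.vitaliFamily (volume : Measure (En n))).ae_tendsto_lintegral_enorm_sub_div hu]
    with x hx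
  have h1 := hx.comp (Besicovitch.tendsto_filterAt volume x)
  have hW : volume (Metric.ball (0 : En n) 1) ≠ ⊤ := measure_ball_lt_top.ne
  have h2 := ENNReal.Tendsto.const_mul h1 (Or.inr hW)
  rw [mul_zero] at h2
  refine tendsto_of_tendsto_of_tendsto_of_le_of_le' tendsto_const_nhds h2 (Eventually.of_forall fun _ => zero_le) ?_
  filter_upwards [self_mem_nhdsWithin] with r hr
  have hr : 0 < r := hr
  rw [lintegral_ball_comp_add_smul hr x (fun y => ‖u y - u x‖ₑ), mul_one, Function.comp_apply,
    Measure.addHaar_closedBall _ _ hr.le, finrank_euclideanSpace_fin, ENNReal.div_eq_inv_mul, ← mul_assoc,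
    ENNReal.mul_inv (Or.inr hW) (by simp), mul_left_comm, ENNReal.mul_inv_cancel ?_ hW, mul_one,
    ENNReal.ofReal_inv_of_pos (by positivity)]
  · gcongr
    exact Metric.ball_subset_closedBall
  · exact (Metric.measure_ball_pos _ _ one_pos).ne'

lemma enorm_integral_sub_le {α : Type*} [MeasurableSpace α] (μ : Measure α) [IsProbabilityMeasure μ]
    {u : α → ℝ} (hu : AEStronglyMeasurable u μ) (c : ℝ) :
    ‖∫ s, u s ∂μ - c‖ₑ ≤ ∫⁻ s, ‖u s - c‖ₑ ∂μ := by
  by_cases h : Integrable (fun s => u s - c) μ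
  · have h1 : Integrable u μ := (h.add (integrable_const c)).congr (ae_of_all _ fun s => by simp)
    have h2 : ∫ s, u s ∂μ - c = ∫ s, (u s - c) ∂μ := by
      rw [integral_sub h1 (integrable_const c)]; simp
    rw [h2]
    exact enorm_integral_le_lintegral_enorm _
  · have h3 : ∫⁻ s, ‖u s - c‖ₑ ∂μ = ⊤ := by
      by_contra hne
      exact h ⟨hu.sub aestronglyMeasurable_const, lt_top_iff_ne_top.2 hne⟩
    rw [h3]; exact le_top

lemma dirPoly_sub (k : ℕ) (v w : (Fin n → ℕ) → ℝ) (h : En n) :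
    dirPoly k v h - dirPoly k w h = dirPoly k (fun α => v α - w α) h := by
  simp only [dirPoly, ← Finset.sum_sub_distrib, mul_sub]

lemma enorm_dirPoly_le (k : ℕ) (v : (Fin n → ℕ) → ℝ) (h : En n) (hh : ‖h‖ ≤ 1) :
    ‖dirPoly k v h‖ₑ ≤ ∑ α ∈ Finset.piAntidiag (Finset.univ : Finset (Fin n)) k,
      (Nat.multinomial Finset.univ α : ℝ≥0∞) * ‖v α‖ₑ := by
  refine (enorm_sum_le _ _).trans (Finset.sum_le_sum fun α hα => ?_)
  rw [enorm_mul]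
  gcongr
  rw [← ofReal_norm, ← ENNReal.ofReal_natCast]
  refine ENNReal.ofReal_le_ofReal ((abs_dirCoeff_le k (Finset.mem_piAntidiag.1 hα).1 h).trans ?_)
  exact mul_le_of_le_one_right (Nat.cast_nonneg _) (pow_le_one₀ (norm_nonneg _) hh)

lemma measurable_kDiff {f : En n → ℝ} (hf : Measurable f) (k : ℕ) :
    Measurable fun z : En n × En n => kDiff k f z.2 z.1 := by
  unfold kDiff
  fun_prop

lemma measurable_dirPoly {β : Type*} [MeasurableSpace β] (k : ℕ) {v : β → (Fin n → ℕ) → ℝ}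
    (hv : ∀ α, Measurable fun b => v b α) {a : β → En n} (ha : Measurable a) :
    Measurable fun b => dirPoly k (v b) (a b) := by
  unfold dirPoly
  refine Finset.measurable_fun_sum _ fun α _ => ((continuous_dirCoeff α).measurable.comp ha).mul (hv α)

lemma ae_ae_kDiff_eq_integral {k : ℕ} {f : En n → ℝ} {g : (Fin n → ℕ) → En n → ℝ}
    (hf : LocallyIntegrable f volume) (hg : HasWeakDerivs k f g) (hfm : Measurable f)
    (hgm : ∀ α, Measurable (g α)) :
    ∀ᵐ x, ∀ᵐ h, kDiff k f h x = ∫ s, dirPoly k (fun α => g α (x + s • h)) h ∂(stepMeas k) := by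
  have hm : MeasurableSet {z : En n × En n |
      kDiff k f z.1 z.2 = ∫ s, dirPoly k (fun α => g α (z.2 + s • z.1)) z.1 ∂(stepMeas k)} := by
    refine measurableSet_eq_fun ((measurable_kDiff hfm k).comp measurable_swap) ?_
    have h1 : Measurable fun w : (En n × En n) × ℝ =>
        dirPoly k (fun α => g α (w.1.2 + w.2 • w.1.1)) w.1.1 :=
      measurable_dirPoly k (v := fun w : (En n × En n) × ℝ => fun α => g α (w.1.2 + w.2 • w.1.1))
        (fun α => (hgm α).comp (by fun_prop)) (by fun_prop)
    exact (h1.stronglyMeasurable.integral_prod_right (ν := stepMeas k)).measurable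
  have h1 : ∀ᵐ z : En n × En n ∂((volume : Measure (En n)).prod volume),
      kDiff k f z.1 z.2 = ∫ s, dirPoly k (fun α => g α (z.2 + s • z.1)) z.1 ∂(stepMeas k) :=
    (Measure.ae_prod_iff_ae_ae hm).2 (ae_of_all _ fun h => ae_kDiff_eq_integral hf hg h)
  have h2 := (Measure.measurePreserving_swap (μ := (volume : Measure (En n)))
    (ν := (volume : Measure (En n)))).quasiMeasurePreserving.ae h1
  exact Measure.ae_ae_of_ae_prod h2

lemma ae_comp_smul {p : En n → Prop} (hp : ∀ᵐ h, p h) {r : ℝ} (hr : 0 < r) : ∀ᵐ h : En n, p (r • h) := by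
  have h1 : Measure.QuasiMeasurePreserving (fun h : En n => r • h) volume volume := by
    refine ⟨by fun_prop, ?_⟩
    rw [Measure.map_addHaar_smul _ hr.ne']
    exact Measure.smul_absolutelyContinuous
  exact h1.ae hp

end Differentiation

section BlowUp

variable {n : ℕ}

lemma tendsto_lintegral_stepMeas (k : ℕ) {Φ : ℝ → ℝ≥0∞} (h0 : Φ 0 = 0)
    (hΦ : Tendsto Φ (𝓝[>] 0) (𝓝 0)) :
    Tendsto (fun δ : ℝ => ∫⁻ s, Φ (δ * s) ∂(stepMeas k)) (𝓝[>] 0) (𝓝 0) := by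
  rw [ENNReal.tendsto_nhds_zero] at hΦ ⊢
  intro ε hε
  obtain ⟨u, hu, hsub⟩ := mem_nhdsGT_iff_exists_Ioo_subset.1 (hΦ ε hε)
  have hu : 0 < u := hu
  have hk : (0 : ℝ) < k + 1 := by positivity
  filter_upwards [Ioo_mem_nhdsGT (show (0 : ℝ) < u / (k + 1) by positivity)] with δ hδ
  have h1 : ∀ᵐ s ∂(stepMeas k), Φ (δ * s) ≤ ε := by
    filter_upwards [ae_mem_stepMeas k] with s hs
    rcases hs.1.eq_or_lt with hs0 | hs0
    · rw [← hs0, mul_zero, h0]; exact zero_le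
    · refine hsub ⟨mul_pos hδ.1 hs0, ?_⟩
      have h2 := (lt_div_iff₀ hk).1 hδ.2
      have := hs.2
      nlinarith [hδ.1]
  refine (lintegral_mono_ae h1).trans ?_
  simp

/-- Blow-up: the rescaled differences converge to the homogeneous polynomial given by the weak
derivatives, in `L^1` of the unit ball, at almost every point. -/
theorem ae_tendsto_rescaled_kDiff {k : ℕ} {f : En n → ℝ} {g : (Fin n → ℕ) → En n → ℝ}
    (hf : LocallyIntegrable f volume) (hg : HasWeakDerivs k f g) (hfm : Measurable f)
    (hgm : ∀ α, Measurable (g α)) :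
    ∀ᵐ x, Tendsto (fun δ : ℝ => ∫⁻ h in Metric.ball (0 : En n) 1,
      ‖kDiff k f (δ • h) x / δ ^ k - dirPoly k (fun α => g α x) h‖ₑ) (𝓝[>] 0) (𝓝 0) := by
  set I := Finset.piAntidiag (Finset.univ : Finset (Fin n)) k with hI
  have hL : ∀ᵐ x, ∀ α ∈ I, Tendsto (fun r : ℝ => ∫⁻ h in Metric.ball (0 : En n) 1,
      ‖g α (x + r • h) - g α x‖ₑ) (𝓝[>] 0) (𝓝 0) :=
    (Finset.eventually_all I).2 fun α hα =>
      ae_tendsto_rescaled (hg.1 α (Finset.mem_piAntidiag.1 hα).1)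
  filter_upwards [hL, ae_ae_kDiff_eq_integral hf hg hfm hgm] with x hx hrep
  set Φ : (Fin n → ℕ) → ℝ → ℝ≥0∞ := fun α r => ∫⁻ h in Metric.ball (0 : En n) 1,
      ‖g α (x + r • h) - g α x‖ₑ with hΦ
  have hT : Tendsto (fun δ : ℝ => ∑ α ∈ I, (Nat.multinomial Finset.univ α : ℝ≥0∞) *
      ∫⁻ s, Φ α (δ * s) ∂(stepMeas k)) (𝓝[>] 0) (𝓝 0) := by
    have : Tendsto (fun δ : ℝ => ∑ α ∈ I, (Nat.multinomial Finset.univ α : ℝ≥0∞) *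
      ∫⁻ s, Φ α (δ * s) ∂(stepMeas k)) (𝓝[>] 0)
        (𝓝 (∑ α ∈ I, (Nat.multinomial Finset.univ α : ℝ≥0∞) * 0)) := by
      refine tendsto_finsetSum _ fun α hα => ?_
      refine ENNReal.Tendsto.const_mul (tendsto_lintegral_stepMeas k ?_ (hx α hα))
        (Or.inr (ENNReal.natCast_ne_top _))
      simp [hΦ]
    simpa using this
  refine tendsto_of_tendsto_of_tendsto_of_le_of_le' tendsto_const_nhds hT
    (Eventually.of_forall fun _ => zero_le) ?_
  filter_upwards [self_mem_nhdsWithin] with δ hδ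
  have hδ : 0 < δ := hδ
  have hmeas : ∀ α, Measurable fun w : En n × ℝ => ‖g α (x + (δ * w.2) • w.1) - g α x‖ₑ :=
    fun α => (((hgm α).comp (by fun_prop)).sub_const _).enorm
  have h1 : ∀ᵐ h ∂(volume.restrict (Metric.ball (0 : En n) 1)),
      ‖kDiff k f (δ • h) x / δ ^ k - dirPoly k (fun α => g α x) h‖ₑ
        ≤ ∑ α ∈ I, (Nat.multinomial Finset.univ α : ℝ≥0∞) *
          ∫⁻ s, ‖g α (x + (δ * s) • h) - g α x‖ₑ ∂(stepMeas k) := by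
    filter_upwards [ae_restrict_of_ae (ae_comp_smul hrep hδ),
      ae_restrict_mem Metric.isOpen_ball.measurableSet] with h hh hmem
    have hh1 : ‖h‖ ≤ 1 := by simpa using (Metric.mem_ball.1 hmem).le
    have e1 : kDiff k f (δ • h) x / δ ^ k
        = ∫ s, dirPoly k (fun α => g α (x + (δ * s) • h)) h ∂(stepMeas k) := by
      rw [hh]
      simp only [dirPoly_smul, integral_const_mul, smul_smul, mul_comm _ δ]
      field_simp
    rw [e1]
    have hms : Measurable fun s : ℝ => dirPoly k (fun α => g α (x + (δ * s) • h)) h :=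
      measurable_dirPoly k (v := fun s : ℝ => fun α => g α (x + (δ * s) • h))
        (fun α => (hgm α).comp (by fun_prop)) measurable_const
    refine (enorm_integral_sub_le _ hms.aestronglyMeasurable _).trans ?_
    simp only [dirPoly_sub]
    refine (lintegral_mono fun s => enorm_dirPoly_le k _ h hh1).trans ?_
    have hm1 : ∀ α, Measurable fun s : ℝ => ‖g α (x + (δ * s) • h) - g α x‖ₑ :=
      fun α => (((hgm α).comp (by fun_prop)).sub_const _).enorm
    rw [lintegral_finsetSum _ fun α _ => (hm1 α).const_mul _]
    refine Finset.sum_le_sum fun α _ => ?_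
    rw [lintegral_const_mul _ (hm1 α)]
  refine (lintegral_mono_ae h1).trans ?_
  have hm2 : ∀ α, Measurable fun h : En n => ∫⁻ s, ‖g α (x + (δ * s) • h) - g α x‖ₑ ∂(stepMeas k) :=
    fun α => (hmeas α).lintegral_prod_right'
  rw [lintegral_finsetSum _ fun α _ => (hm2 α).const_mul _]
  refine Finset.sum_le_sum fun α _ => ?_
  rw [lintegral_const_mul _ (hm2 α), lintegral_lintegral_swap (hmeas α).aemeasurable]

lemma lintegral_dirPoly_ball_lt_top (k : ℕ) (v : (Fin n → ℕ) → ℝ) :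
    ∫⁻ h in Metric.ball (0 : En n) 1, ‖dirPoly k v h‖ₑ < ⊤ := by
  have h1 : ∀ᵐ h ∂(volume.restrict (Metric.ball (0 : En n) 1)), ‖dirPoly k v h‖ₑ
      ≤ ∑ α ∈ Finset.piAntidiag (Finset.univ : Finset (Fin n)) k,
        (Nat.multinomial Finset.univ α : ℝ≥0∞) * ‖v α‖ₑ := by
    filter_upwards [ae_restrict_mem Metric.isOpen_ball.measurableSet] with h hmem
    exact enorm_dirPoly_le k v h (by simpa using (Metric.mem_ball.1 hmem).le)
  refine (lintegral_mono_ae h1).trans_lt ?_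
  rw [lintegral_const, Measure.restrict_apply_univ]
  refine ENNReal.mul_lt_top (ENNReal.sum_lt_top.2 fun α _ => ?_) measure_ball_lt_top
  exact ENNReal.mul_lt_top (ENNReal.natCast_lt_top _) enorm_lt_top

/-- At almost every point the differences are `O(r^k)` in the mean over small balls. -/
lemma ae_lintegral_kDiff_le {k : ℕ} {f : En n → ℝ} {g : (Fin n → ℕ) → En n → ℝ}
    (hf : LocallyIntegrable f volume) (hg : HasWeakDerivs k f g) (hfm : Measurable f)
    (hgm : ∀ α, Measurable (g α)) :
    ∀ᵐ x, ∃ M : ℝ≥0∞, M < ⊤ ∧ ∀ᶠ r in 𝓝[>] (0 : ℝ),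
      ∫⁻ h in Metric.ball (0 : En n) r, ‖kDiff k f h x‖ₑ ≤ M * ENNReal.ofReal (r ^ (k + n)) := by
  filter_upwards [ae_tendsto_rescaled_kDiff hf hg hfm hgm] with x hx
  refine ⟨1 + ∫⁻ h in Metric.ball (0 : En n) 1, ‖dirPoly k (fun α => g α x) h‖ₑ,
    ENNReal.add_lt_top.2 ⟨ENNReal.one_lt_top, lintegral_dirPoly_ball_lt_top k _⟩, ?_⟩
  filter_upwards [self_mem_nhdsWithin, (ENNReal.tendsto_nhds_zero.1 hx) 1 one_pos] with r hr h1
  have hr : 0 < r := hr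
  have hpm : Measurable fun h : En n => ‖dirPoly k (fun α => g α x) h‖ₑ :=
    (measurable_dirPoly k (v := fun _ : En n => fun α => g α x) (fun α => measurable_const) measurable_id).enorm
  have h2 : ∫⁻ h in Metric.ball (0 : En n) 1, ‖kDiff k f (r • h) x / r ^ k‖ₑ
      ≤ 1 + ∫⁻ h in Metric.ball (0 : En n) 1, ‖dirPoly k (fun α => g α x) h‖ₑ := by
    refine le_trans ?_ (add_le_add_left h1 _)
    rw [← lintegral_add_right _ hpm]
    refine lintegral_mono fun h => ?_
    simpa using enorm_add_le (kDiff k f (r • h) x / r ^ k - dirPoly k (fun α => g α x) h)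
      (dirPoly k (fun α => g α x) h)
  have h3 := lintegral_ball_comp_smul (ρ := 1) hr (fun h : En n => ‖kDiff k f h x / r ^ k‖ₑ)
  rw [h3, mul_one] at h2
  have h4 : ∀ h, ‖kDiff k f h x‖ₑ = ENNReal.ofReal (r ^ k) * ‖kDiff k f h x / r ^ k‖ₑ := by
    intro h
    rw [← Real.enorm_of_nonneg (by positivity : 0 ≤ r ^ k), ← enorm_mul]
    congr 1
    field_simp
  simp only [h4]
  rw [lintegral_const_mul' _ _ ENNReal.ofReal_ne_top]
  have h5 : ENNReal.ofReal (r ^ n) * ENNReal.ofReal ((r ^ n)⁻¹) = 1 := by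
    rw [← ENNReal.ofReal_mul (by positivity), mul_inv_cancel₀ (by positivity), ENNReal.ofReal_one]
  refine (mul_le_mul_right ((mul_le_mul_right h2 (ENNReal.ofReal (r ^ n)))) (ENNReal.ofReal (r ^ k))).trans' ?_ |>.trans ?_
  · rw [← mul_assoc (ENNReal.ofReal (r ^ n)), h5, one_mul]
  · rw [pow_add, ENNReal.ofReal_mul (by positivity), ← mul_assoc, mul_comm]

end BlowUp

section Dyadic

lemma two_rpow_ne_zero (t : ℝ) : (2 : ℝ≥0∞) ^ t ≠ 0 := by simp [ENNReal.rpow_eq_zero_iff]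

lemma two_rpow_ne_top (t : ℝ) : (2 : ℝ≥0∞) ^ t ≠ ⊤ := by simp [ENNReal.rpow_eq_top_iff]

lemma two_rpow_add (s t : ℝ) : (2 : ℝ≥0∞) ^ (s + t) = 2 ^ s * 2 ^ t :=
  ENNReal.rpow_add s t (by simp) (by simp)

lemma ofReal_two_rpow (t : ℝ) : ENNReal.ofReal ((2 : ℝ) ^ t) = (2 : ℝ≥0∞) ^ t := by
  rw [← ENNReal.ofReal_rpow_of_pos two_pos]; simp

lemma exists_two_rpow_eq {a : ℝ≥0∞} (ha : a ≠ 0) (ha' : a ≠ ⊤) : ∃ x : ℝ, a = 2 ^ x := by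
  refine ⟨Real.logb 2 a.toReal, ?_⟩
  rw [← ofReal_two_rpow, Real.rpow_logb two_pos (by norm_num) (ENNReal.toReal_pos ha ha'),
    ENNReal.ofReal_toReal ha']

lemma tsum_two_rpow_neg_abs_lt_top {c : ℝ} (hc : 0 < c) :
    ∑' j : ℤ, (2 : ℝ≥0∞) ^ (-c * |(j : ℝ)|) < ⊤ := by
  have hs : Summable fun j : ℤ => (2 : ℝ) ^ (-c * |(j : ℝ)|) := by
    have h0 : Summable fun m : ℕ => ((2 : ℝ) ^ (-c)) ^ m :=
      summable_geometric_of_lt_one (by positivity)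
        (Real.rpow_lt_one_of_one_lt_of_neg one_lt_two (by linarith))
    have h1 : ∀ m : ℕ, (2 : ℝ) ^ (-c * |((m : ℤ) : ℝ)|) = ((2 : ℝ) ^ (-c)) ^ m := fun m => by
      rw [← Real.rpow_natCast, ← Real.rpow_mul two_pos.le]; simp
    refine Summable.of_nat_of_neg ?_ ?_
    · simpa only [h1] using h0
    · have h2 : ∀ m : ℕ, (2 : ℝ) ^ (-c * |((-(m : ℤ) : ℤ) : ℝ)|) = ((2 : ℝ) ^ (-c)) ^ m := fun m => by
        rw [← h1]; simp
      simpa only [h2] using h0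
  simp only [← ofReal_two_rpow]
  exact lt_top_iff_ne_top.2 hs.tsum_ofReal_ne_top

lemma tsum_min_two_rpow_le {b s t : ℝ} (hb : b ≠ 0) (hs : 0 < s) (ht : 0 < t) :
    ∃ C : ℝ≥0∞, C ≠ 0 ∧ C < ⊤ ∧ ∀ a : ℝ≥0∞, a ≠ 0 → a ≠ ⊤ →
      ∑' j : ℤ, min (((2 : ℝ≥0∞) ^ ((j : ℝ) * b) / a) ^ s) (((2 : ℝ≥0∞) ^ ((j : ℝ) * b) / a) ^ (-t))
        ≤ C := by
  set c := |b| * min s t with hcdef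
  have hc : 0 < c := mul_pos (abs_pos.2 hb) (lt_min hs ht)
  refine ⟨2 ^ c * ∑' j : ℤ, (2 : ℝ≥0∞) ^ (-c * |(j : ℝ)|), ?_, ?_, ?_⟩
  · refine mul_ne_zero (two_rpow_ne_zero _) fun h => ?_
    exact two_rpow_ne_zero _ (ENNReal.tsum_eq_zero.1 h 0)
  · exact ENNReal.mul_lt_top (lt_top_iff_ne_top.2 (two_rpow_ne_top _)) (tsum_two_rpow_neg_abs_lt_top hc)
  · intro a ha ha'
    obtain ⟨y, rfl⟩ := exists_two_rpow_eq ha ha'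
    set J : ℤ := ⌊y / b⌋ with hJ
    have hterm : ∀ j : ℤ, min (((2 : ℝ≥0∞) ^ ((j : ℝ) * b) / 2 ^ y) ^ s)
        (((2 : ℝ≥0∞) ^ ((j : ℝ) * b) / 2 ^ y) ^ (-t)) ≤ 2 ^ c * 2 ^ (-c * |((j - J : ℤ) : ℝ)|) := by
      intro j
      have e1 : (2 : ℝ≥0∞) ^ ((j : ℝ) * b) / 2 ^ y = 2 ^ (b * (j - y / b)) := by
        rw [← ENNReal.rpow_sub _ _ (by simp) (by simp)]
        congr 1
        field_simp
      rw [e1, ← ENNReal.rpow_mul, ← ENNReal.rpow_mul, ← two_rpow_add]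
      have h1 : |((j - J : ℤ) : ℝ)| ≤ |(j : ℝ) - y / b| + 1 := by
        have h2 : |y / b - J| ≤ 1 := by
          rw [abs_le]
          constructor <;> linarith [Int.floor_le (y / b), Int.lt_floor_add_one (y / b)]
        have h3 := abs_add_le ((j : ℝ) - y / b) (y / b - J)
        push_cast
        calc |(j : ℝ) - J| = |(j : ℝ) - y / b + (y / b - J)| := by ring_nf
          _ ≤ _ := by linarith
      have h4 : -c * |(j : ℝ) - y / b| ≤ c + -c * |((j - J : ℤ) : ℝ)| := by nlinarith
      have h5 : c * |(j : ℝ) - y / b| = min s t * |b * (j - y / b)| := by rw [abs_mul, hcdef]; ring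
      set w := b * (j - y / b)
      rcases le_total 0 w with hw | hw
      · refine (min_le_right _ _).trans (ENNReal.rpow_le_rpow_of_exponent_le (by norm_num) ?_)
        rw [abs_of_nonneg hw] at h5
        nlinarith [min_le_right s t]
      · refine (min_le_left _ _).trans (ENNReal.rpow_le_rpow_of_exponent_le (by norm_num) ?_)
        rw [abs_of_nonpos hw] at h5
        nlinarith [min_le_left s t]
    refine (ENNReal.tsum_le_tsum hterm).trans ?_
    rw [ENNReal.tsum_mul_left]
    refine mul_le_mul_right (le_of_eq ?_) _
    exact (Equiv.subRight J).tsum_eq (fun j : ℤ => (2 : ℝ≥0∞) ^ (-c * |(j : ℝ)|))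

lemma tsum_ite_two_rpow_le {b s : ℝ} (hb : b ≠ 0) (hs : 0 < s) :
    ∃ C : ℝ≥0∞, C ≠ 0 ∧ C < ⊤ ∧ ∀ a : ℝ≥0∞,
      (∑' j : ℤ, if (2 : ℝ≥0∞) ^ ((j : ℝ) * b) < a then (2 : ℝ≥0∞) ^ ((j : ℝ) * (b * s)) else 0)
        ≤ C * a ^ s := by
  obtain ⟨C, hC0, hC, h⟩ := tsum_min_two_rpow_le hb hs one_pos
  refine ⟨C, hC0, hC, fun a => ?_⟩
  rcases eq_or_ne a 0 with rfl | ha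
  · simp
  rcases eq_or_ne a ⊤ with rfl | ha'
  · rw [ENNReal.top_rpow_of_pos hs, ENNReal.mul_top hC0]; exact le_top
  refine le_trans ?_ (mul_le_mul_left (h a ha ha') (a ^ s))
  rw [← ENNReal.tsum_mul_right]
  refine ENNReal.tsum_le_tsum fun j => ?_
  split_ifs with hj
  · have hq : (2 : ℝ≥0∞) ^ ((j : ℝ) * b) / a ≤ 1 := ENNReal.div_le_of_le_mul (by simpa using hj.le)
    have hmin : ((2 : ℝ≥0∞) ^ ((j : ℝ) * b) / a) ^ s
        ≤ ((2 : ℝ≥0∞) ^ ((j : ℝ) * b) / a) ^ (-(1 : ℝ)) :=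
      ENNReal.rpow_le_rpow_of_exponent_ge hq (by linarith)
    rw [min_eq_left hmin, ← ENNReal.mul_rpow_of_nonneg _ _ hs.le, ENNReal.div_mul_cancel ha ha',
      ← ENNReal.rpow_mul, mul_assoc]
  · exact zero_le

lemma tsum_le_of_antitone_potential {P b : ℤ → ℝ≥0∞} {I : ℝ≥0∞} (hP : ∀ j, P j ≤ I)
    (h : ∀ j, P (j + 1) + b j ≤ P j) : ∑' j, b j ≤ I := by
  have h1 : ∀ (a : ℤ) (N : ℕ), P (a + N) + ∑ m ∈ Finset.range N, b (a + m) ≤ P a := by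
    intro a N
    induction N with
    | zero => simp
    | succ N ih =>
      rw [Finset.sum_range_succ, add_comm (∑ m ∈ _, _), ← add_assoc]
      refine le_trans (add_le_add_left ?_ _) ih
      have := h (a + N)
      push_cast
      rwa [← add_assoc]
  refine ENNReal.summable.tsum_le_of_sum_le fun s => ?_
  obtain ⟨L, hL⟩ := s.bddBelow
  obtain ⟨U, hU⟩ := s.bddAbove
  have hsub : s ⊆ (Finset.range (U - L + 1).toNat).image fun m : ℕ => L + (m : ℤ) := by
    intro j hj
    have h2 := hL hj
    have h3 := hU hj
    refine Finset.mem_image.2 ⟨(j - L).toNat, Finset.mem_range.2 ?_, ?_⟩ <;> omega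
  refine (Finset.sum_le_sum_of_subset hsub).trans ?_
  rw [Finset.sum_image fun x _ y _ hxy => by simpa using hxy]
  exact (le_add_self.trans (h1 L _)).trans (hP L)

lemma tsum_le_of_monotone_potential {P b : ℤ → ℝ≥0∞} {I : ℝ≥0∞} (hP : ∀ j, P j ≤ I)
    (h : ∀ j, P (j - 1) + b j ≤ P j) : ∑' j, b j ≤ I := by
  rw [← (Equiv.neg ℤ).tsum_eq]
  refine tsum_le_of_antitone_potential (P := fun j => P (-j)) (fun j => hP _) fun j => ?_
  have := h (-j)
  simpa [sub_eq_add_neg, add_comm] using this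

end Dyadic

section LevelSums

variable {n : ℕ}

lemma half_mul_two_div {T : ℝ≥0∞} (hT : T ≠ 0) (hT' : T ≠ ⊤) : T / 2 * (2 / T) = 1 := by
  rw [div_eq_mul_inv, div_eq_mul_inv]
  calc T * 2⁻¹ * (2 * T⁻¹) = (T * T⁻¹) * (2⁻¹ * 2) := by ring
    _ = 1 := by rw [ENNReal.mul_inv_cancel hT hT', ENNReal.inv_mul_cancel (by simp) (by simp), one_mul]

/-- The average of `F` along the segment from `x` in the direction `z`, at scale `t`. -/
noncomputable def lineAvg (k : ℕ) (F : En n → ℝ≥0∞) (z : En n) (t : ℝ) (x : En n) : ℝ≥0∞ :=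
  ∫⁻ s, F (x + (t * s) • z) ∂(stepMeas k)

lemma measurable_lineAvg (k : ℕ) {F : En n → ℝ≥0∞} (hF : Measurable F) (z : En n) (t : ℝ) :
    Measurable (lineAvg k F z t) := by
  have : Measurable fun w : En n × ℝ => F (w.1 + (t * w.2) • z) := hF.comp (by fun_prop)
  exact this.lintegral_prod_right'

lemma lintegral_lineAvg (k : ℕ) {F : En n → ℝ≥0∞} (hF : Measurable F) (z : En n) (t : ℝ) :
    ∫⁻ x, lineAvg k F z t x = ∫⁻ x, F x := by
  unfold lineAvg
  have : Measurable fun w : En n × ℝ => F (w.1 + (t * w.2) • z) := hF.comp (by fun_prop)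
  rw [lintegral_lintegral_swap this.aemeasurable]
  simp [lintegral_add_right_eq_self F]

lemma volume_lineAvg_gt_le (k : ℕ) {F : En n → ℝ≥0∞} (hF : Measurable F) (z : En n) (t : ℝ)
    {T : ℝ≥0∞} (hT : T ≠ 0) (hT' : T ≠ ⊤) :
    volume {x | T < lineAvg k F z t x} ≤ (2 / T) * ∫⁻ x, if T / 2 < F x then F x else 0 := by
  set G : En n → ℝ≥0∞ := fun x => if T / 2 < F x then F x else 0 with hG
  have hGm : Measurable G := Measurable.ite (measurableSet_lt measurable_const hF) hF measurable_const
  have h1 : ∀ x, F x ≤ T / 2 + G x := by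
    intro x
    simp only [hG]
    split_ifs with h
    · exact le_add_self
    · simpa using h
  have hT2 : T / 2 ≠ ⊤ := ENNReal.div_ne_top hT' (by simp)
  have h2 : ∀ x, lineAvg k F z t x ≤ T / 2 + lineAvg k G z t x := by
    intro x
    refine (lintegral_mono fun s => h1 _).trans ?_
    rw [lintegral_add_left measurable_const]
    simp [lineAvg]
  have hsub : {x | T < lineAvg k F z t x} ⊆ {x | T / 2 ≤ lineAvg k G z t x} := by
    intro x hx
    have h3 : T / 2 + T / 2 < T / 2 + lineAvg k G z t x := by
      rw [ENNReal.add_halves]; exact lt_of_lt_of_le hx (h2 x)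
    exact ((ENNReal.add_lt_add_iff_left hT2).1 h3).le
  refine (measure_mono hsub).trans ?_
  have h4 := mul_meas_ge_le_lintegral (μ := volume) (measurable_lineAvg k hGm z t) (T / 2)
  rw [lintegral_lineAvg k hGm] at h4
  calc volume {x | T / 2 ≤ lineAvg k G z t x}
      = (2 / T) * (T / 2 * volume {x | T / 2 ≤ lineAvg k G z t x}) := by
        rw [← mul_assoc, mul_comm (2 / T), half_mul_two_div hT hT', one_mul]
    _ ≤ _ := by gcongr

lemma sum_level_le_of_one_lt (k : ℕ) {p β : ℝ} (hp : 1 < p) (hβ : β ≠ 0) :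
    ∃ C : ℝ≥0∞, C < ⊤ ∧ ∀ (z : En n) (F : En n → ℝ≥0∞) (l : ℝ≥0∞), Measurable F → l ≠ 0 → l ≠ ⊤ →
      ∑' j : ℤ, (2 : ℝ≥0∞) ^ ((j : ℝ) * (β * p)) *
          volume {x | l * 2 ^ ((j : ℝ) * β) < lineAvg k F z ((2 : ℝ) ^ (j : ℝ)) x}
        ≤ C * l ^ (-p) * ∫⁻ x, F x ^ p := by
  obtain ⟨C, -, hC, hgeo⟩ := tsum_ite_two_rpow_le hβ (sub_pos.2 hp)
  refine ⟨C * 2 ^ p, ENNReal.mul_lt_top hC (lt_top_iff_ne_top.2 (two_rpow_ne_top _)), ?_⟩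
  intro z F l hF hl hl'
  have hq : (2 / l : ℝ≥0∞) ≠ ⊤ := ENNReal.div_ne_top (by simp) hl
  have hcancel : l / 2 * (2 / l) = 1 := half_mul_two_div hl hl'
  have hterm : ∀ j : ℤ, (2 : ℝ≥0∞) ^ ((j : ℝ) * (β * p)) *
          volume {x | l * 2 ^ ((j : ℝ) * β) < lineAvg k F z ((2 : ℝ) ^ (j : ℝ)) x}
      ≤ ∫⁻ x, (2 / l) * (F x * if (2 : ℝ≥0∞) ^ ((j : ℝ) * β) < 2 / l * F x then
          (2 : ℝ≥0∞) ^ ((j : ℝ) * (β * (p - 1))) else 0) := by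
    intro j
    have hT : l * (2 : ℝ≥0∞) ^ ((j : ℝ) * β) ≠ 0 := mul_ne_zero hl (two_rpow_ne_zero _)
    have hT' : l * (2 : ℝ≥0∞) ^ ((j : ℝ) * β) ≠ ⊤ := ENNReal.mul_ne_top hl' (two_rpow_ne_top _)
    refine (mul_le_mul_right (volume_lineAvg_gt_le k hF z _ hT hT') _).trans ?_
    have hm : Measurable fun x => if l * (2 : ℝ≥0∞) ^ ((j : ℝ) * β) / 2 < F x then F x else 0 :=
      Measurable.ite (measurableSet_lt measurable_const hF) hF measurable_const
    rw [← mul_assoc, ← lintegral_const_mul _ hm]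
    refine lintegral_mono fun x => ?_
    have e1 : (2 : ℝ≥0∞) ^ ((j : ℝ) * (β * p)) * (2 / (l * 2 ^ ((j : ℝ) * β)))
        = 2 / l * 2 ^ ((j : ℝ) * (β * (p - 1))) := by
      rw [show (j : ℝ) * (β * p) = (j : ℝ) * (β * (p - 1)) + (j : ℝ) * β by ring, two_rpow_add,
        ENNReal.div_eq_inv_mul, ENNReal.mul_inv (Or.inl hl) (Or.inl hl'), ENNReal.div_eq_inv_mul]
      calc _ = (2 : ℝ≥0∞) ^ ((j : ℝ) * (β * (p - 1))) * ((2 : ℝ≥0∞) ^ ((j : ℝ) * β) *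
            ((2 : ℝ≥0∞) ^ ((j : ℝ) * β))⁻¹) * (l⁻¹ * 2) := by ring
        _ = _ := by
          rw [ENNReal.mul_inv_cancel (two_rpow_ne_zero _) (two_rpow_ne_top _), mul_one, mul_comm]
    simp only [e1]
    by_cases h : l * (2 : ℝ≥0∞) ^ ((j : ℝ) * β) / 2 < F x
    · have h' : (2 : ℝ≥0∞) ^ ((j : ℝ) * β) < 2 / l * F x := by
        by_contra hcon
        refine absurd h (not_lt.2 ?_)
        have := mul_le_mul_right (not_lt.1 hcon) (l / 2)
        rw [← mul_assoc, hcancel, one_mul] at this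
        rwa [mul_comm l, mul_div_assoc, mul_comm]
      rw [if_pos h, if_pos h', mul_assoc, mul_comm (F x)]
    · rw [if_neg h, mul_zero]; exact zero_le
  refine (ENNReal.tsum_le_tsum hterm).trans ?_
  rw [← lintegral_tsum]
  swap
  · intro j
    refine ((hF.mul (Measurable.ite ?_ measurable_const measurable_const)).const_mul _).aemeasurable
    exact measurableSet_lt measurable_const (hF.const_mul _)
  have hc : C * 2 ^ p * l ^ (-p) * ∫⁻ x, F x ^ p = ∫⁻ x, C * 2 ^ p * l ^ (-p) * F x ^ p := by
    rw [lintegral_const_mul _ (hF.pow_const p)]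
  rw [hc]
  refine lintegral_mono fun x => ?_
  rw [ENNReal.tsum_mul_left, ENNReal.tsum_mul_left]
  refine (mul_le_mul_right (mul_le_mul_right (hgeo _) _) _).trans (le_of_eq ?_)
  have hpow : ∀ a : ℝ≥0∞, a * a ^ (p - 1) = a ^ p := fun a => by
    conv_lhs => rw [← ENNReal.rpow_one a]
    rw [← ENNReal.rpow_mul, ← ENNReal.rpow_add_of_nonneg _ _ zero_le_one (by linarith)]
    congr 1; ring
  calc 2 / l * (F x * (C * (2 / l * F x) ^ (p - 1)))
      = C * ((2 / l * F x) * (2 / l * F x) ^ (p - 1)) := by ring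
    _ = C * 2 ^ p * l ^ (-p) * F x ^ p := by
      rw [hpow, ENNReal.mul_rpow_of_nonneg _ _ (by linarith), ENNReal.div_rpow_of_nonneg _ _ (by linarith),
        ENNReal.rpow_neg, div_eq_mul_inv]
      ring

end LevelSums

section LevelSumsOne

variable {n : ℕ}

/-- The integral of `F` along the segment `{x + σ z : 0 < σ ≤ t}`. -/
noncomputable def segInt (F : En n → ℝ≥0∞) (z : En n) (t : ℝ) (x : En n) : ℝ≥0∞ :=
  ∫⁻ s in Ioc 0 t, F (x + s • z)

lemma measurable_segInt {F : En n → ℝ≥0∞} (hF : Measurable F) (z : En n) (t : ℝ) :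
    Measurable (segInt F z t) := by
  have : Measurable fun w : En n × ℝ => F (w.1 + w.2 • z) := hF.comp (by fun_prop)
  exact this.lintegral_prod_right'

lemma lintegral_segInt {F : En n → ℝ≥0∞} (hF : Measurable F) (z : En n) (t : ℝ) :
    ∫⁻ x, segInt F z t x = ENNReal.ofReal t * ∫⁻ x, F x := by
  unfold segInt
  have : Measurable fun w : En n × ℝ => F (w.1 + w.2 • z) := hF.comp (by fun_prop)
  rw [lintegral_lintegral_swap this.aemeasurable]
  simp [lintegral_add_right_eq_self F, mul_comm]

lemma segInt_add (F : En n → ℝ≥0∞) (z : En n) {s t : ℝ} (hs : 0 ≤ s) (ht : 0 ≤ t) (x : En n) :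
    segInt F z (s + t) x = segInt F z s x + segInt F z t (x + s • z) := by
  unfold segInt
  rw [← Ioc_union_Ioc_eq_Ioc hs (by linarith : s ≤ s + t),
    lintegral_union measurableSet_Ioc (Ioc_disjoint_Ioc_of_le le_rfl)]
  congr 1
  rw [← lintegral_indicator measurableSet_Ioc, ← lintegral_indicator measurableSet_Ioc,
    ← lintegral_add_right_eq_self _ s]
  refine lintegral_congr fun u => ?_
  have : u + s ∈ Ioc s (s + t) ↔ u ∈ Ioc 0 t := by
    simp only [mem_Ioc]; constructor <;> rintro ⟨h1, h2⟩ <;> constructor <;> linarith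
  by_cases hu : u ∈ Ioc 0 t
  · rw [indicator_of_mem hu, indicator_of_mem (this.2 hu)]
    congr 1; module
  · rw [indicator_of_notMem hu, indicator_of_notMem (fun h => hu (this.1 h))]

lemma lineAvg_le_segInt {k : ℕ} (hk : 0 < k) {F : En n → ℝ≥0∞} (hF : Measurable F) (z : En n)
    {t u : ℝ} (ht : 0 < t) (hu : t * k ≤ u) (x : En n) :
    lineAvg k F z t x ≤ ENNReal.ofReal t⁻¹ * segInt F z u x := by
  have hm : Measurable fun s : ℝ => F (x + (t * s) • z) := hF.comp (by fun_prop)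
  refine (lintegral_stepMeas_le hk hm).trans ?_
  have hm' : Measurable fun s : ℝ => F (x + s • z) := hF.comp (by fun_prop)
  have hmi : Measurable ((Icc (0 : ℝ) (t * k)).indicator fun s : ℝ => F (x + s • z)) :=
    hm'.indicator measurableSet_Icc
  have e1 : ∫⁻ s in Icc (0 : ℝ) k, F (x + (t * s) • z)
      = ∫⁻ s, (Icc (0 : ℝ) (t * k)).indicator (fun s : ℝ => F (x + s • z)) (t * s) := by
    rw [← lintegral_indicator measurableSet_Icc]
    refine lintegral_congr fun s => ?_
    have : t * s ∈ Icc 0 (t * k) ↔ s ∈ Icc (0 : ℝ) k := by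
      simp only [mem_Icc]
      rw [mul_le_mul_iff_right₀ ht, mul_nonneg_iff_of_pos_left ht]
    by_cases hs : s ∈ Icc (0 : ℝ) k
    · rw [indicator_of_mem hs, indicator_of_mem (this.2 hs)]
    · rw [indicator_of_notMem hs, indicator_of_notMem (fun h => hs (this.1 h))]
  rw [e1, ← lintegral_map hmi (measurable_const_mul t), Real.map_volume_mul_left ht.ne',
    lintegral_smul_measure, lintegral_indicator measurableSet_Icc, smul_eq_mul, abs_of_pos (inv_pos.2 ht)]
  refine mul_le_mul_right ?_ _
  unfold segInt
  rw [setLIntegral_congr Ioc_ae_eq_Icc.symm]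
  exact lintegral_mono_set (Ioc_subset_Ioc_right hu)

lemma min_rpow_le {r V c : ℝ≥0∞} (hr : r ≤ 1) :
    min V (r * c) + (1 - r) * (if c < V then c else 0) ≤ min V c := by
  split_ifs with h
  · rw [min_eq_right h.le]
    refine (add_le_add_left (min_le_right _ _) _).trans ?_
    rw [← add_mul, add_tsub_cancel_of_le hr, one_mul]
  · rw [mul_zero, add_zero]
    exact min_le_min le_rfl (by simpa using mul_le_mul_left hr c)

lemma min_add_le {V W c : ℝ≥0∞} : min (V + W) c ≤ min V c + min W c := by
  rcases le_total V c with hV | hV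
  · rcases le_total W c with hW | hW
    · rw [min_eq_left hV, min_eq_left hW]; exact min_le_left _ _
    · rw [min_eq_right hW]; exact (min_le_right _ _).trans le_add_self
  · rw [min_eq_right hV]; exact (min_le_right _ _).trans le_self_add

lemma sum_segInt_le {β : ℝ} (hβ : β < -1 ∨ 0 < β) :
    ∃ C : ℝ≥0∞, C < ⊤ ∧ ∀ (z : En n) (F : En n → ℝ≥0∞) (l : ℝ≥0∞), Measurable F → l ≠ 0 → l ≠ ⊤ →
      ∑' j : ℤ, (2 : ℝ≥0∞) ^ ((j : ℝ) * β) *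
          volume {x | l * 2 ^ ((j : ℝ) * (1 + β)) < segInt F z ((2 : ℝ) ^ (j : ℝ)) x}
        ≤ C * l⁻¹ * ∫⁻ x, F x := by
  set r : ℝ≥0∞ := 2 ^ (1 + β) with hr
  set κ : ℝ≥0∞ := if β < -1 then 1 - r else 1 - 2 / r with hκ
  have hr0 : r ≠ 0 := two_rpow_ne_zero _
  have hrt : r ≠ ⊤ := two_rpow_ne_top _
  have hr2 : 0 < β → 2 < r := fun h => by
    calc (2 : ℝ≥0∞) = 2 ^ (1 : ℝ) := by simp
      _ < r := ENNReal.rpow_lt_rpow_of_exponent_lt (by norm_num) (by simp) (by linarith)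
  have hκ0 : κ ≠ 0 := by
    rw [hκ]
    split_ifs with h
    · exact (tsub_pos_of_lt (ENNReal.rpow_lt_one_of_one_lt_of_neg (by norm_num) (by linarith))).ne'
    · refine (tsub_pos_of_lt ?_).ne'
      rw [ENNReal.div_lt_iff (Or.inl hr0) (Or.inl hrt), one_mul]
      exact hr2 (hβ.resolve_left h)
  have hκt : κ ≠ ⊤ := by rw [hκ]; split_ifs <;> exact ENNReal.sub_ne_top (by simp)
  refine ⟨κ⁻¹, (ENNReal.inv_lt_top.2 (pos_iff_ne_zero.2 hκ0)), fun z F l hF hl hl' => ?_⟩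
  set W : ℤ → En n → ℝ≥0∞ := fun j => segInt F z ((2 : ℝ) ^ (j : ℝ)) with hW
  have hWm : ∀ j, Measurable (W j) := fun j => measurable_segInt hF z _
  have hWs : ∀ j x, W (j + 1) x = W j x + W j (x + ((2 : ℝ) ^ (j : ℝ)) • z) := fun j x => by
    have : (2 : ℝ) ^ ((j + 1 : ℤ) : ℝ) = 2 ^ (j : ℝ) + 2 ^ (j : ℝ) := by
      push_cast; rw [Real.rpow_add two_pos, Real.rpow_one]; ring
    simp only [hW]
    rw [this, segInt_add F z (by positivity) (by positivity)]
  set cap : ℤ → ℝ≥0∞ := fun j => l * 2 ^ ((j : ℝ) * (1 + β)) with hcap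
  have hcaps : ∀ j, cap (j + 1) = r * cap j := fun j => by
    simp only [hcap, hr]
    push_cast
    rw [show ((j : ℝ) + 1) * (1 + β) = (1 + β) + j * (1 + β) by ring, two_rpow_add]
    ring
  set Q : ℤ → ℝ≥0∞ := fun j => ∫⁻ x, min (W j x) (cap j) with hQ
  set P : ℤ → ℝ≥0∞ := fun j => 2 ^ (-(j : ℝ)) * Q j with hP
  set B : ℤ → Set (En n) := fun j => {x | cap j < W j x} with hB
  have hBm : ∀ j, MeasurableSet (B j) := fun j => measurableSet_lt measurable_const (hWm j)
  have hcapB : ∀ j, cap j * volume (B j) = ∫⁻ x, if cap j < W j x then cap j else 0 := fun j => by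
    have : (fun x => if cap j < W j x then cap j else 0) = (B j).indicator fun _ => cap j := by
      ext x; simp [indicator, hB]
    rw [this, lintegral_indicator (hBm j), setLIntegral_const]
  have hmin : ∀ j c, Measurable fun x => min (W j x) c := fun j c => (hWm j).min measurable_const
  have htr : ∀ j c, ∫⁻ x, min (W j (x + ((2 : ℝ) ^ (j : ℝ)) • z)) c = ∫⁻ x, min (W j x) c :=
    fun j c => lintegral_add_right_eq_self (fun x => min (W j x) c) _
  have hPI : ∀ j, P j ≤ ∫⁻ x, F x := fun j => by
    simp only [hP, hQ]
    refine (mul_le_mul_right (lintegral_mono fun x => min_le_left (W j x) (cap j)) _).trans ?_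
    simp only [hW]
    rw [lintegral_segInt hF, ofReal_two_rpow, ← mul_assoc, ← two_rpow_add]
    simp
  have hhalf : ∀ j : ℤ, (2 : ℝ≥0∞) ^ (-((j + 1 : ℤ) : ℝ)) * 2 = 2 ^ (-(j : ℝ)) := fun j => by
    have h2 : (2 : ℝ≥0∞) = 2 ^ (1 : ℝ) := by simp
    calc (2 : ℝ≥0∞) ^ (-((j + 1 : ℤ) : ℝ)) * 2 = (2 : ℝ≥0∞) ^ (-((j + 1 : ℤ) : ℝ)) * 2 ^ (1 : ℝ) := by simp
      _ = _ := by rw [← two_rpow_add]; push_cast; congr 1; ring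
  have hcap2 : ∀ j : ℤ, (2 : ℝ≥0∞) ^ (-(j : ℝ)) * cap j = l * 2 ^ ((j : ℝ) * β) := fun j => by
    simp only [hcap]
    rw [mul_left_comm, ← two_rpow_add]; congr 2; ring
  have key : ∑' j : ℤ, κ * (l * 2 ^ ((j : ℝ) * β) * volume (B j)) ≤ ∫⁻ x, F x := by
    by_cases hneg : β < -1
    · have hκe : κ = 1 - r := if_pos hneg
      have hr1 : r ≤ 1 := (ENNReal.rpow_lt_one_of_one_lt_of_neg (by norm_num) (by linarith)).le
      refine tsum_le_of_antitone_potential (P := P) hPI fun j => ?_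
      have h1 : Q (j + 1) ≤ 2 * ∫⁻ x, min (W j x) (r * cap j) := by
        simp only [hQ]
        rw [two_mul, hcaps]
        calc ∫⁻ x, min (W (j + 1) x) (r * cap j)
            ≤ ∫⁻ x, (min (W j x) (r * cap j) + min (W j (x + ((2 : ℝ) ^ (j : ℝ)) • z)) (r * cap j)) := by
              refine lintegral_mono fun x => ?_
              simp only [hWs]; exact min_add_le
          _ = _ := by rw [lintegral_add_left (hmin j _), htr]
      have h2 : (∫⁻ x, min (W j x) (r * cap j)) + κ * (cap j * volume (B j)) ≤ Q j := by
        rw [hcapB, hκe, ← lintegral_const_mul' _ _ (ENNReal.sub_ne_top (by simp)),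
          ← lintegral_add_left (hmin j _)]
        exact lintegral_mono fun x => min_rpow_le hr1
      calc P (j + 1) + κ * (l * 2 ^ ((j : ℝ) * β) * volume (B j))
          ≤ 2 ^ (-((j + 1 : ℤ) : ℝ)) * (2 * ∫⁻ x, min (W j x) (r * cap j))
            + κ * (2 ^ (-(j : ℝ)) * cap j * volume (B j)) := by
              rw [hcap2]; exact add_le_add_left (mul_le_mul_right h1 _) _
        _ = 2 ^ (-(j : ℝ)) * ((∫⁻ x, min (W j x) (r * cap j)) + κ * (cap j * volume (B j))) := by
            rw [← mul_assoc, hhalf]; ring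
        _ ≤ P j := mul_le_mul_right h2 _
    · have hpos : 0 < β := hβ.resolve_left hneg
      have hκe : κ = 1 - 2 / r := if_neg hneg
      have h2r := (hr2 hpos).le
      refine tsum_le_of_monotone_potential (P := P) hPI fun j => ?_
      obtain ⟨i, rfl⟩ : ∃ i, j = i + 1 := ⟨j - 1, by ring⟩
      have hκc : κ * cap (i + 1) = (r - 2) * cap i := by
        rw [hcaps, ← mul_assoc, hκe, ENNReal.sub_mul (fun _ _ => hrt), one_mul,
          ENNReal.div_mul_cancel hr0 hrt]
      have hpt : ∀ x, (min (W i x) (cap i) + min (W i (x + ((2 : ℝ) ^ (i : ℝ)) • z)) (cap i))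
          + κ * (if cap (i + 1) < W (i + 1) x then cap (i + 1) else 0)
          ≤ min (W (i + 1) x) (cap (i + 1)) := fun x => by
        split_ifs with h
        · rw [min_eq_right h.le, hκc, hcaps]
          calc _ ≤ (cap i + cap i) + (r - 2) * cap i := by gcongr <;> exact min_le_right _ _
            _ = (2 + (r - 2)) * cap i := by ring
            _ = _ := by rw [add_tsub_cancel_of_le h2r]
        · rw [mul_zero, add_zero, min_eq_left (not_lt.1 h), hWs]
          gcongr <;> exact min_le_left _ _
      have h2 : 2 * Q i + κ * (cap (i + 1) * volume (B (i + 1))) ≤ Q (i + 1) := by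
        rw [hcapB, ← lintegral_const_mul' _ _ hκt]
        simp only [hQ]
        calc _ = (∫⁻ x, (min (W i x) (cap i) + min (W i (x + ((2 : ℝ) ^ (i : ℝ)) • z)) (cap i)))
            + ∫⁻ x, κ * (if cap (i + 1) < W (i + 1) x then cap (i + 1) else 0) := by
              rw [lintegral_add_left (hmin i _), htr, two_mul]
          _ ≤ _ := by
              rw [← lintegral_add_left]
              · exact lintegral_mono hpt
              · exact (hmin i _).add ((hmin i _).comp (measurable_id.add_const _))
      calc P (i + 1 - 1) + κ * (l * 2 ^ (((i + 1 : ℤ) : ℝ) * β) * volume (B (i + 1)))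
          = 2 ^ (-((i + 1 : ℤ) : ℝ)) * (2 * Q i + κ * (cap (i + 1) * volume (B (i + 1)))) := by
            rw [← hcap2, add_sub_cancel_right]
            simp only [hP]
            rw [← hhalf i]; ring
        _ ≤ P (i + 1) := mul_le_mul_right h2 _
  rw [ENNReal.tsum_mul_left] at key
  simp only [mul_assoc] at key
  rw [ENNReal.tsum_mul_left] at key
  calc _ = κ⁻¹ * l⁻¹ * (κ * (l * ∑' j : ℤ, (2 : ℝ≥0∞) ^ ((j : ℝ) * β) * volume (B j))) := by
        rw [show ∀ S : ℝ≥0∞, κ⁻¹ * l⁻¹ * (κ * (l * S)) = (κ * κ⁻¹) * (l * l⁻¹) * S by intro S; ring,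
          ENNReal.mul_inv_cancel hκ0 hκt, ENNReal.mul_inv_cancel hl hl', one_mul, one_mul]
    _ ≤ _ := mul_le_mul_right key _

lemma sum_level_le_one {k : ℕ} (hk : 0 < k) {β : ℝ} (hβ : β < -1 ∨ 0 < β) :
    ∃ C : ℝ≥0∞, C < ⊤ ∧ ∀ (z : En n) (F : En n → ℝ≥0∞) (l : ℝ≥0∞), Measurable F → l ≠ 0 → l ≠ ⊤ →
      ∑' j : ℤ, (2 : ℝ≥0∞) ^ ((j : ℝ) * β) *
          volume {x | l * 2 ^ ((j : ℝ) * β) < lineAvg k F z ((2 : ℝ) ^ (j : ℝ)) x}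
        ≤ C * l⁻¹ * ∫⁻ x, F x := by
  obtain ⟨C, hC, h⟩ := sum_segInt_le (n := n) hβ
  refine ⟨2 ^ (-((k : ℤ) : ℝ) * β) * C * 2 ^ ((k : ℝ) * (1 + β)), ?_, fun z F l hF hl hl' => ?_⟩
  · exact ENNReal.mul_lt_top (ENNReal.mul_lt_top (two_rpow_ne_top _).lt_top hC) (two_rpow_ne_top _).lt_top
  set l' := l * 2 ^ (-((k : ℝ) * (1 + β))) with hl'def
  have h1 := h z F l' hF (mul_ne_zero hl (two_rpow_ne_zero _)) (ENNReal.mul_ne_top hl' (two_rpow_ne_top _))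
  have hterm : ∀ j : ℤ, (2 : ℝ≥0∞) ^ ((j : ℝ) * β) *
          volume {x | l * 2 ^ ((j : ℝ) * β) < lineAvg k F z ((2 : ℝ) ^ (j : ℝ)) x}
      ≤ 2 ^ (-((k : ℤ) : ℝ) * β) * ((2 : ℝ≥0∞) ^ (((j + k : ℤ) : ℝ) * β) *
          volume {x | l' * 2 ^ (((j + k : ℤ) : ℝ) * (1 + β)) < segInt F z ((2 : ℝ) ^ ((j + k : ℤ) : ℝ)) x}) := by
    intro j
    rw [← mul_assoc, ← two_rpow_add]
    refine mul_le_mul' (le_of_eq ?_) (measure_mono fun x hx => ?_)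
    · congr 1; push_cast; ring
    · have hk2 : (k : ℝ) ≤ 2 ^ (k : ℝ) := by
        rw [Real.rpow_natCast]; exact_mod_cast Nat.lt_two_pow_self.le
      have hu : (2 : ℝ) ^ (j : ℝ) * k ≤ 2 ^ ((j + k : ℤ) : ℝ) := by
        push_cast
        rw [Real.rpow_add two_pos]; gcongr
      have h2 := lt_of_lt_of_le hx.out (lineAvg_le_segInt hk hF z (by positivity) hu x)
      rw [← Real.rpow_neg two_pos.le, ofReal_two_rpow] at h2
      show l' * 2 ^ (((j + k : ℤ) : ℝ) * (1 + β)) < _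
      have h3 : l' * 2 ^ (((j + k : ℤ) : ℝ) * (1 + β)) = 2 ^ (j : ℝ) * (l * 2 ^ ((j : ℝ) * β)) := by
        rw [hl'def, mul_assoc, ← two_rpow_add, mul_left_comm, ← two_rpow_add]
        push_cast; congr 2; ring
      rw [h3]
      have h4 := (ENNReal.mul_lt_mul_iff_right (two_rpow_ne_zero (j : ℝ)) (two_rpow_ne_top (j : ℝ))).2 h2
      rwa [← mul_assoc (2 ^ (j : ℝ) : ℝ≥0∞) (2 ^ (-(j : ℝ))), ← two_rpow_add, add_neg_cancel, ENNReal.rpow_zero,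
        one_mul] at h4
  refine (ENNReal.tsum_le_tsum hterm).trans ?_
  rw [ENNReal.tsum_mul_left]
  have h5 := (Equiv.addRight (k : ℤ)).tsum_eq (fun j : ℤ => (2 : ℝ≥0∞) ^ ((j : ℝ) * β) *
          volume {x | l' * 2 ^ ((j : ℝ) * (1 + β)) < segInt F z ((2 : ℝ) ^ (j : ℝ)) x})
  simp only [Equiv.coe_addRight] at h5
  rw [h5]
  refine (mul_le_mul_right h1 _).trans (le_of_eq ?_)
  rw [hl'def, ENNReal.mul_inv (Or.inl hl) (Or.inl hl'), ← ENNReal.rpow_neg, neg_neg]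
  ring

/-- The parameter range `Γ_{p,q}` is what makes the dyadic sums of level sets summable. -/
lemma sum_level_le {k : ℕ} (hk : 0 < k) {p q γ : ℝ} (hp : 1 ≤ p) (hq : 0 < q) (hγ : γ ∈ Gam p q) :
    ∃ C : ℝ≥0∞, C < ⊤ ∧ ∀ (z : En n) (F : En n → ℝ≥0∞) (l : ℝ≥0∞), Measurable F → l ≠ 0 → l ≠ ⊤ →
      ∑' j : ℤ, (2 : ℝ≥0∞) ^ ((j : ℝ) * (γ / q * p)) *
          volume {x | l * 2 ^ ((j : ℝ) * (γ / q)) < lineAvg k F z ((2 : ℝ) ^ (j : ℝ)) x}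
        ≤ C * l ^ (-p) * ∫⁻ x, F x ^ p := by
  rcases eq_or_lt_of_le hp with rfl | hp
  · simp only [mul_one, ENNReal.rpow_one, ENNReal.rpow_neg_one]
    refine sum_level_le_one hk ?_
    rw [Gam, if_pos rfl] at hγ
    rcases hγ with h | h
    · left; rw [div_lt_iff₀ hq]; simpa using h.out
    · right; exact div_pos h hq
  · refine sum_level_le_of_one_lt k hp (div_ne_zero ?_ hq.ne')
    rw [Gam, if_neg hp.ne'] at hγ
    exact hγ

end LevelSumsOne

section LevelVolume

variable {n : ℕ}

/-- The volume of the steps `h` of length `< R` with `|Δ_h^k f(x)| > T`. -/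
noncomputable def levelVol (k : ℕ) (f : En n → ℝ) (R T : ℝ) (x : En n) : ℝ≥0∞ :=
  volume {h : En n | ‖h‖ < R ∧ T < |kDiff k f h x|}

lemma measurableSet_level {k : ℕ} {f : En n → ℝ} (hfm : Measurable f) (R T : ℝ) :
    MeasurableSet {z : En n × En n | ‖z.2‖ < R ∧ T < |kDiff k f z.2 z.1|} := by
  have h1 : MeasurableSet {z : En n × En n | ‖z.2‖ < R} :=
    measurableSet_lt (by fun_prop) measurable_const
  have h2 : MeasurableSet {z : En n × En n | T < |kDiff k f z.2 z.1|} :=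
    measurableSet_lt measurable_const (measurable_kDiff hfm k).abs
  exact h1.inter h2

lemma measurable_levelVol {k : ℕ} {f : En n → ℝ} (hfm : Measurable f) (R T : ℝ) :
    Measurable (levelVol k f R T) :=
  measurable_measure_prodMk_left (measurableSet_level hfm R T)

lemma measurable_gradLen (k : ℕ) {g : (Fin n → ℕ) → En n → ℝ} (hgm : ∀ α, Measurable (g α)) :
    Measurable (gradLen k g) := by
  have : gradLen k g = fun x =>
      √(∑ α ∈ Finset.piAntidiag (Finset.univ : Finset (Fin n)) k, g α x ^ 2) :=
    funext fun x => gradLen_eq k g x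
  rw [this]
  exact (Finset.measurable_sum _ fun α _ => (hgm α).pow_const 2).sqrt

lemma lintegral_levelVol {k : ℕ} {f : En n → ℝ} (hfm : Measurable f) (R T : ℝ) :
    ∫⁻ x, levelVol k f R T x
      = ∫⁻ h in Metric.ball (0 : En n) R, volume {x : En n | T < |kDiff k f h x|} := by
  have hS := measurableSet_level (k := k) hfm R T
  have h1 := Measure.prod_apply (μ := (volume : Measure (En n))) (ν := (volume : Measure (En n))) hS
  have h2 := Measure.prod_apply_symm (μ := (volume : Measure (En n))) (ν := (volume : Measure (En n))) hS
  rw [h1] at h2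
  refine h2.trans ?_
  rw [← lintegral_indicator Metric.isOpen_ball.measurableSet]
  refine lintegral_congr fun h => ?_
  by_cases hh : ‖h‖ < R
  · rw [indicator_of_mem (by simpa using hh)]
    congr 1; ext x; simp [hh]
  · rw [indicator_of_notMem (by simpa using hh)]
    simp [hh]

lemma volume_kDiff_gt_le {k : ℕ} {f : En n → ℝ} {g : (Fin n → ℕ) → En n → ℝ}
    (hf : LocallyIntegrable f volume) (hg : HasWeakDerivs k f g)
    {z : En n} (hz : ‖z‖ ≤ 1) {t : ℝ} (ht : 0 < t) {T : ℝ} (hT : 0 < T) :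
    volume {x : En n | T < |kDiff k f (t • z) x|}
      ≤ volume {x : En n | ENNReal.ofReal (T / ((multiSum n k + 1) * t ^ k))
          < lineAvg k (fun x => ENNReal.ofReal (gradLen k g x)) z t x} := by
  have hM : 0 < multiSum n k + 1 := by linarith [multiSum_nonneg n k]
  refine measure_mono_ae ?_
  filter_upwards [ae_kDiff_eq_integral hf hg (t • z)] with x hx hTx
  have h1 : ‖kDiff k f (t • z) x‖ₑ
      ≤ ENNReal.ofReal ((multiSum n k + 1) * t ^ k) *
        lineAvg k (fun x => ENNReal.ofReal (gradLen k g x)) z t x := by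
    rw [hx, lineAvg, ← lintegral_const_mul' _ _ ENNReal.ofReal_ne_top]
    refine (enorm_integral_le_lintegral_enorm _).trans (lintegral_mono fun s => ?_)
    rw [← ENNReal.ofReal_mul (by positivity), ← ofReal_norm, Real.norm_eq_abs]
    refine ENNReal.ofReal_le_ofReal ?_
    have h2 := abs_dirPoly_le k (fun α => g α (x + s • t • z)) (t • z)
      (M := gradLen k g (x + s • t • z)) (fun α hα => abs_le_gradLen k g _ hα)
    rw [smul_smul, mul_comm s t] at h2
    rw [smul_smul, mul_comm s t]
    refine h2.trans ?_
    have h3 : ‖t • z‖ ^ k ≤ t ^ k := by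
      refine pow_le_pow_left₀ (norm_nonneg _) ?_ _
      rw [norm_smul, Real.norm_eq_abs, abs_of_pos ht]
      exact mul_le_of_le_one_right ht.le hz
    have h4 : 0 ≤ gradLen k g (x + (t * s) • z) := Real.sqrt_nonneg _
    have h5 := multiSum_nonneg n k
    gcongr
    linarith
  have h2 : ENNReal.ofReal T < ENNReal.ofReal ((multiSum n k + 1) * t ^ k) *
        lineAvg k (fun x => ENNReal.ofReal (gradLen k g x)) z t x := by
    refine lt_of_lt_of_le ?_ h1
    rw [← ofReal_norm, Real.norm_eq_abs]
    exact (ENNReal.ofReal_lt_ofReal_iff (hT.trans hTx)).2 hTx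
  have hpos : 0 < (multiSum n k + 1) * t ^ k := by positivity
  show ENNReal.ofReal _ < _
  rw [ENNReal.ofReal_div_of_pos hpos]
  refine (ENNReal.div_lt_iff (Or.inl (by simpa using hpos)) (Or.inl ENNReal.ofReal_ne_top)).2 ?_
  rwa [mul_comm]

lemma sum_lintegral_levelVol_le {k : ℕ} (hk : 0 < k) {p q γ : ℝ} (hp : 1 ≤ p) (hq : 0 < q)
    (hγ : γ ∈ Gam p q) :
    ∃ C : ℝ≥0∞, C < ⊤ ∧ ∀ (f : En n → ℝ) (g : (Fin n → ℕ) → En n → ℝ) (lam : ℝ),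
      LocallyIntegrable f volume → HasWeakDerivs k f g → Measurable f → (∀ α, Measurable (g α)) →
      0 < lam →
      ∑' j : ℤ, (2 : ℝ≥0∞) ^ ((j : ℝ) * (γ / q * p - n)) *
          ∫⁻ x, levelVol k f ((2 : ℝ) ^ (j : ℝ)) (lam * (2 : ℝ) ^ ((j : ℝ) * (k + γ / q))) x
        ≤ C * ENNReal.ofReal lam ^ (-p) * ∫⁻ x, ENNReal.ofReal (gradLen k g x) ^ p := by
  obtain ⟨C, hC, h⟩ := sum_level_le (n := n) hk hp hq hγ
  have hM : 0 < multiSum n k + 1 := by linarith [multiSum_nonneg n k]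
  set ω := volume (Metric.ball (0 : En n) 1)
  refine ⟨C * ENNReal.ofReal (multiSum n k + 1) ^ p * ω, ?_, ?_⟩
  · refine ENNReal.mul_lt_top (ENNReal.mul_lt_top hC ?_) measure_ball_lt_top
    exact ENNReal.rpow_lt_top_of_nonneg (by linarith) ENNReal.ofReal_ne_top
  intro f g lam hf hg hfm hgm hlam
  set F : En n → ℝ≥0∞ := fun x => ENNReal.ofReal (gradLen k g x) with hF
  have hFm : Measurable F := (measurable_gradLen k hgm).ennreal_ofReal
  set l := ENNReal.ofReal (lam / (multiSum n k + 1)) with hl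
  have hl0 : l ≠ 0 := by rw [hl]; simpa using div_pos hlam hM
  have hlt : l ≠ ⊤ := ENNReal.ofReal_ne_top
  have hVm : ∀ (j : ℤ), Measurable fun z : En n =>
      volume {x : En n | l * 2 ^ ((j : ℝ) * (γ / q)) < lineAvg k F z ((2 : ℝ) ^ (j : ℝ)) x} := by
    intro j
    have h1 : Measurable fun w : (En n × En n) × ℝ => F (w.1.2 + ((2 : ℝ) ^ (j : ℝ) * w.2) • w.1.1) :=
      hFm.comp (by fun_prop)
    have h2 : Measurable fun w : En n × En n => lineAvg k F w.1 ((2 : ℝ) ^ (j : ℝ)) w.2 :=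
      h1.lintegral_prod_right'
    exact measurable_measure_prodMk_left (measurableSet_lt measurable_const h2)
  have hterm : ∀ j : ℤ, (2 : ℝ≥0∞) ^ ((j : ℝ) * (γ / q * p - n)) *
          ∫⁻ x, levelVol k f ((2 : ℝ) ^ (j : ℝ)) (lam * (2 : ℝ) ^ ((j : ℝ) * (k + γ / q))) x
      ≤ ∫⁻ z in Metric.ball (0 : En n) 1, (2 : ℝ≥0∞) ^ ((j : ℝ) * (γ / q * p)) *
          volume {x : En n | l * 2 ^ ((j : ℝ) * (γ / q)) < lineAvg k F z ((2 : ℝ) ^ (j : ℝ)) x} := by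
    intro j
    have ht : (0 : ℝ) < 2 ^ (j : ℝ) := by positivity
    rw [lintegral_levelVol hfm, lintegral_const_mul _ (hVm j)]
    set T := lam * (2 : ℝ) ^ ((j : ℝ) * (k + γ / q)) with hT
    have hT0 : 0 < T := by positivity
    have h1 := lintegral_ball_comp_smul (ρ := 1) ht
      (fun h : En n => volume {x : En n | T < |kDiff k f h x|})
    rw [mul_one] at h1
    have h2 : ∫⁻ h in Metric.ball (0 : En n) (2 ^ (j : ℝ)), volume {x : En n | T < |kDiff k f h x|}
        = (2 : ℝ≥0∞) ^ ((j : ℝ) * n) * ∫⁻ z in Metric.ball (0 : En n) 1,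
          volume {x : En n | T < |kDiff k f (((2 : ℝ) ^ (j : ℝ)) • z) x|} := by
      rw [h1, ← mul_assoc, ← Real.rpow_natCast, ← Real.rpow_mul two_pos.le, ← Real.rpow_neg two_pos.le,
        ofReal_two_rpow, ← two_rpow_add, add_neg_cancel, ENNReal.rpow_zero, one_mul]
    rw [h2, ← mul_assoc, ← two_rpow_add, show (j : ℝ) * (γ / q * p - n) + j * n = j * (γ / q * p) by ring]
    refine mul_le_mul_right ?_ _
    refine setLIntegral_mono (hVm j) fun z hz => ?_
    refine (volume_kDiff_gt_le hf hg (z := z) (by simpa using (mem_ball_zero_iff.1 hz).le) ht hT0).trans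
      (le_of_eq ?_)
    congr 3
    ext x
    have e1 : T / ((multiSum n k + 1) * ((2 : ℝ) ^ (j : ℝ)) ^ k)
        = lam / (multiSum n k + 1) * 2 ^ ((j : ℝ) * (γ / q)) := by
      rw [hT, mul_add, Real.rpow_add two_pos, Real.rpow_mul_natCast two_pos.le]
      field_simp
    rw [e1, ENNReal.ofReal_mul (by positivity), ofReal_two_rpow]
  refine (ENNReal.tsum_le_tsum hterm).trans ?_
  rw [← lintegral_tsum fun j => ((hVm j).const_mul _).aemeasurable]
  refine (lintegral_mono fun z => h z F l hFm hl0 hlt).trans (le_of_eq ?_)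
  rw [setLIntegral_const, hl, ENNReal.ofReal_div_of_pos hM, ENNReal.rpow_neg, ENNReal.rpow_neg,
    ENNReal.div_rpow_of_nonneg _ _ (by linarith), ENNReal.inv_div
      (Or.inl (ENNReal.rpow_ne_top_of_nonneg (by linarith) ENNReal.ofReal_ne_top)),
    div_eq_mul_inv]
  · ring
  · left
    rw [Ne, ENNReal.rpow_eq_zero_iff]
    simp [hM, ENNReal.ofReal_ne_top]

end LevelVolume

section Propagation

variable {n : ℕ}

lemma levelVol_mono {k : ℕ} {f : En n → ℝ} {R R' T T' : ℝ} (hR : R ≤ R') (hT : T' ≤ T) (x : En n) :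
    levelVol k f R T x ≤ levelVol k f R' T' x :=
  measure_mono fun _ hh => ⟨hh.1.trans_le hR, hT.trans_lt hh.2⟩

lemma volume_preimage_add_nsmul_le {m : ℕ} (hm : 1 ≤ m) (a : En n) (S : Set (En n)) :
    volume {w : En n | a + (m : ℝ) • w ∈ S} ≤ volume S := by
  have hm0 : (m : ℝ) ≠ 0 := by positivity
  have h1 : {w : En n | a + (m : ℝ) • w ∈ S} = (fun w => (m : ℝ) • w) ⁻¹' ((fun w => a + w) ⁻¹' S) := rfl
  rw [h1, Measure.addHaar_preimage_smul _ hm0, measure_preimage_add]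
  refine mul_le_of_le_one_left zero_le ?_
  rw [← ENNReal.ofReal_one]
  refine ENNReal.ofReal_le_ofReal ?_
  rw [abs_of_nonneg (by positivity)]
  exact inv_le_one_of_one_le₀ (one_le_pow₀ (by exact_mod_cast hm))

lemma volume_preimage_nsmul_le {m : ℕ} (hm : 1 ≤ m) (S : Set (En n)) :
    volume {w : En n | (m : ℝ) • w ∈ S} ≤ volume S := by
  simpa using volume_preimage_add_nsmul_le hm 0 S

lemma lintegral_ball_add_nsmul_le {m k : ℕ} (hm : 1 ≤ m) (hmk : m ≤ k) {ρ : ℝ} (hρ : 0 ≤ ρ) (y : En n)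
    (G : En n → ℝ≥0∞) :
    ∫⁻ z in Metric.ball (0 : En n) ρ, G (y + (m : ℝ) • z) ≤ ∫⁻ u in Metric.ball y (k * ρ), G u := by
  have hm0 : (0 : ℝ) < m := by exact_mod_cast hm
  rw [lintegral_ball_comp_add_smul hm0]
  refine (mul_le_of_le_one_left zero_le ?_).trans (lintegral_mono_set (Metric.ball_subset_ball ?_))
  · rw [← ENNReal.ofReal_one]
    exact ENNReal.ofReal_le_ofReal (inv_le_one_of_one_le₀ (one_le_pow₀ (by exact_mod_cast hm)))
  · gcongr

lemma volume_ball_le_sum_levelVol {k : ℕ} (hk : 0 < k) (f : En n → ℝ) {r R T : ℝ}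
    (hR : (k + 1) * r ≤ R) {x h : En n} (hh : ‖h‖ < r) (hT : T < |kDiff k f h x|) :
    volume (Metric.ball (0 : En n) r) ≤ ∑ m ∈ Finset.Icc 1 k,
      (levelVol k f R (T / (2 * k * 2 ^ k)) x
        + levelVol k f R (T / (2 * k * 2 ^ k)) (x + (m : ℝ) • h)) := by
  set S : En n → Set (En n) := fun y => {u | ‖u‖ < R ∧ T / (2 * k * 2 ^ k) < |kDiff k f u y|}
  have hsub : Metric.ball (0 : En n) r ⊆ ⋃ m ∈ Finset.Icc 1 k,
      ({w : En n | h + (m : ℝ) • w ∈ S x} ∪ {w : En n | (m : ℝ) • w ∈ S (x + (m : ℝ) • h)}) := by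
    intro w hw
    rw [mem_ball_zero_iff] at hw
    obtain ⟨m, hm, hlarge⟩ := exists_large_of_binomial_sum_eq hk (T := T)
      (fun m => kDiff k f (h + (m : ℝ) • w) x) (fun j => kDiff k f ((j : ℝ) • w) (x + (j : ℝ) • h))
      (kDiff_comm_step k f h w x) (by simpa [kDiff_zero_right hk] using hT)
    have hmk : (m : ℝ) ≤ k := by exact_mod_cast (Finset.mem_Icc.1 hm).2
    have hr : 0 ≤ r := (norm_nonneg w).trans hw.le
    have hmw : ‖(m : ℝ) • w‖ ≤ k * r := by
      rw [norm_smul, Real.norm_natCast]; gcongr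
    refine mem_biUnion hm (hlarge.imp (fun hl => ⟨?_, hl⟩) fun hl => ⟨?_, hl⟩)
    · linarith [norm_add_le h ((m : ℝ) • w)]
    · linarith [norm_nonneg h]
  refine (measure_mono hsub).trans ((measure_biUnion_finset_le _ _).trans ?_)
  refine Finset.sum_le_sum fun m hm => (measure_union_le _ _).trans ?_
  exact add_le_add (volume_preimage_add_nsmul_le (Finset.mem_Icc.1 hm).1 _ _)
    (volume_preimage_nsmul_le (Finset.mem_Icc.1 hm).1 _)

lemma levelVol_le_indicator_add {k : ℕ} (hk : 0 < k) (f : En n → ℝ) {r R T : ℝ} (hr : 0 < r)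
    (hR : (k + 1) * r ≤ R) {V : Set (En n)}
    (hV : ∀ y ∉ V, 4 * k * levelVol k f R (T / (2 * k * 2 ^ k)) y ≤ volume (Metric.ball (0 : En n) r))
    (x : En n) :
    levelVol k f r T x ≤ V.indicator (fun _ => volume (Metric.ball (0 : En n) r)) x
      + k * volume (Metric.ball x R ∩ V) := by
  by_cases hx : x ∈ V
  · rw [indicator_of_mem hx]
    refine le_trans (measure_mono fun h hh => ?_) le_self_add
    exact mem_ball_zero_iff.2 hh.1
  rw [indicator_of_notMem hx, zero_add]
  have hsub : {h : En n | ‖h‖ < r ∧ T < |kDiff k f h x|} ⊆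
      ⋃ m ∈ Finset.Icc 1 k, {h : En n | x + (m : ℝ) • h ∈ Metric.ball x R ∩ V} := by
    intro h hh
    by_contra hcon
    have hcon' : ∀ m ∈ Finset.Icc 1 k, x + (m : ℝ) • h ∉ V := by
      intro m hm hmV
      refine hcon (mem_biUnion hm ⟨?_, hmV⟩)
      have hmk : (m : ℝ) ≤ k := by exact_mod_cast (Finset.mem_Icc.1 hm).2
      rw [mem_ball_iff_norm, add_sub_cancel_left, norm_smul, Real.norm_natCast]
      have : (m : ℝ) * ‖h‖ ≤ k * r := by gcongr; exact hh.1.le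
      linarith
    have h1 := volume_ball_le_sum_levelVol hk f hR hh.1 hh.2
    set ω := volume (Metric.ball (0 : En n) r)
    have hω0 : ω ≠ 0 := (Metric.measure_ball_pos _ _ hr).ne'
    have hωt : ω ≠ ⊤ := measure_ball_lt_top.ne
    have h2 : 4 * k * ω ≤ 2 * k * ω := by
      refine (mul_le_mul_right h1 _).trans ?_
      rw [Finset.mul_sum]
      refine (Finset.sum_le_sum (g := fun _ => 2 * ω) fun m hm => ?_).trans (le_of_eq ?_)
      · rw [mul_add, two_mul ω]
        exact add_le_add (hV _ hx) (hV _ (hcon' m hm))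
      · rw [Finset.sum_const, Nat.card_Icc, nsmul_eq_mul, Nat.add_sub_cancel]; ring
    have hkω0 : (k : ℝ≥0∞) * ω ≠ 0 := mul_ne_zero (by exact_mod_cast hk.ne') hω0
    have hkωt : (k : ℝ≥0∞) * ω ≠ ⊤ := ENNReal.mul_ne_top (ENNReal.natCast_ne_top k) hωt
    rw [mul_assoc, mul_assoc, ENNReal.mul_le_mul_iff_left hkω0 hkωt] at h2
    norm_num at h2
  refine (measure_mono hsub).trans ((measure_biUnion_finset_le _ _).trans ?_)
  refine (Finset.sum_le_sum fun m hm =>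
    volume_preimage_add_nsmul_le (Finset.mem_Icc.1 hm).1 x (Metric.ball x R ∩ V)).trans (le_of_eq ?_)
  rw [Finset.sum_const, Nat.card_Icc, nsmul_eq_mul, Nat.add_sub_cancel]

lemma le_lintegral_levelVol_of_drop {k : ℕ} (hk : 0 < k) {f : En n → ℝ} (hfm : Measurable f)
    {ρ S S' : ℝ} (hρ : 0 < ρ) {κ : ℝ≥0∞} (hκ : 2 * κ ≤ volume (Metric.ball (0 : En n) 1)) {y : En n}
    (h1 : κ * ENNReal.ofReal (ρ ^ n) ≤ levelVol k f ρ S y)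
    (h2 : levelVol k f (ρ / 2) S' y ≤ κ * ENNReal.ofReal ((ρ / 2) ^ n)) :
    κ * ENNReal.ofReal (ρ ^ n) * (κ * ENNReal.ofReal ((ρ / 2) ^ n)) ≤
      2 * k * ∫⁻ u in Metric.ball y (k * ρ), levelVol k f ρ ((S - S') / (2 * k * 2 ^ k)) u := by
  set T := (S - S') / (2 * k * 2 ^ k)
  set W : Set (En n) := {w | ‖w‖ < ρ ∧ S < |kDiff k f w y|}
  set Z : Set (En n) := {z | ‖z‖ < ρ / 2 ∧ |kDiff k f z y| ≤ S'}
  set L : En n → Set (En n) := fun y => {u | ‖u‖ < ρ ∧ T < |kDiff k f u y|}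
  have hZ : κ * ENNReal.ofReal ((ρ / 2) ^ n) ≤ volume Z := by
    have hκt : κ ≠ ⊤ := fun h => by
      rw [h, ENNReal.mul_top (by simp)] at hκ
      exact measure_ball_lt_top.not_ge hκ
    have hb : Metric.ball (0 : En n) (ρ / 2) ⊆ Z ∪ {h | ‖h‖ < ρ / 2 ∧ S' < |kDiff k f h y|} := by
      intro z hz
      rw [mem_ball_zero_iff] at hz
      exact (le_or_gt (|kDiff k f z y|) S').imp (fun h => ⟨hz, h⟩) fun h => ⟨hz, h⟩
    have h3 := (measure_mono (μ := volume) hb).trans (measure_union_le _ _)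
    rw [volume_ball_eq _ (by positivity)] at h3
    have h4 : κ * ENNReal.ofReal ((ρ / 2) ^ n) + κ * ENNReal.ofReal ((ρ / 2) ^ n)
        ≤ volume Z + κ * ENNReal.ofReal ((ρ / 2) ^ n) := by
      refine le_trans ?_ (h3.trans (add_le_add_right h2 _))
      rw [← two_mul, ← mul_assoc, mul_comm]
      exact mul_le_mul_right hκ _
    exact (ENNReal.add_le_add_iff_right (ENNReal.mul_ne_top hκt ENNReal.ofReal_ne_top)).1 h4
  have hbase : ∀ m : ℕ, MeasurableSet {v : En n × En n | ‖v.2‖ < ρ ∧ v.1 ∈ L (y + (m : ℝ) • v.2)} := by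
    intro m
    have hk' : Measurable fun v : En n × En n => kDiff k f v.1 (y + (m : ℝ) • v.2) :=
      (measurable_kDiff hfm k).comp (g := fun v : En n × En n => kDiff k f v.2 v.1)
        (f := fun v : En n × En n => (y + (m : ℝ) • v.2, v.1)) (by fun_prop)
    have h1 : MeasurableSet {v : En n × En n | ‖v.1‖ < ρ} :=
      measurableSet_lt (by fun_prop) measurable_const
    have h2 : MeasurableSet {v : En n × En n | ‖v.2‖ < ρ} :=
      measurableSet_lt (by fun_prop) measurable_const
    exact h2.inter (h1.inter (measurableSet_lt measurable_const hk'.abs))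
  have hbound : ∀ m ∈ Finset.Icc 1 k,
      (volume : Measure (En n)).prod volume {v : En n × En n | ‖v.2‖ < ρ ∧ v.1 ∈ L (y + (m : ℝ) • v.2)}
        ≤ ∫⁻ u in Metric.ball y (k * ρ), levelVol k f ρ T u := by
    intro m hm
    rw [Measure.prod_apply_symm (hbase m)]
    refine le_trans (le_of_eq ?_) (lintegral_ball_add_nsmul_le (Finset.mem_Icc.1 hm).1
      (Finset.mem_Icc.1 hm).2 hρ.le y (levelVol k f ρ T))
    rw [← lintegral_indicator Metric.isOpen_ball.measurableSet]
    refine lintegral_congr fun z => ?_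
    by_cases hz : ‖z‖ < ρ
    · rw [indicator_of_mem (by simpa using hz)]
      congr 1; ext w; simp [hz]; rfl
    · rw [indicator_of_notMem (by simpa using hz)]
      simp [hz]
  have hswap : ∀ m ∈ Finset.Icc 1 k,
      (volume : Measure (En n)).prod volume {v : En n × En n | ‖v.1‖ < ρ ∧ v.2 ∈ L (y + (m : ℝ) • v.1)}
        ≤ ∫⁻ u in Metric.ball y (k * ρ), levelVol k f ρ T u := by
    intro m hm
    refine le_trans (le_of_eq ?_) (hbound m hm)
    have := (Measure.measurePreserving_swap (μ := (volume : Measure (En n)))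
      (ν := (volume : Measure (En n)))).measure_preimage (hbase m).nullMeasurableSet
    rw [← this]
    rfl
  have hsub : W ×ˢ Z ⊆ ⋃ m ∈ Finset.Icc 1 k,
      ({v : En n × En n | ‖v.2‖ < ρ ∧ v.1 ∈ L (y + (m : ℝ) • v.2)} ∪
        {v : En n × En n | ‖v.1‖ < ρ ∧ v.2 ∈ L (y + (m : ℝ) • v.1)}) := by
    rintro ⟨w, z⟩ ⟨hw, hz⟩
    have hw1 : ‖w‖ < ρ := hw.1
    have hz1 : ‖z‖ < ρ := hz.1.trans (by linarith)
    obtain ⟨m, hm, hlarge⟩ := exists_large_of_binomial_sum_eq hk (T := S - S')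
      (fun m => kDiff k f w (y + (m : ℝ) • z)) (fun j => kDiff k f z (y + (j : ℝ) • w))
      (kDiff_comm_base k f w z y) (by
        have := hw.2; have := hz.2
        simp only [Nat.cast_zero, zero_smul, add_zero] at *
        linarith)
    exact mem_biUnion hm (hlarge.imp (fun hl => ⟨hz1, hw1, hl⟩) fun hl => ⟨hw1, hz1, hl⟩)
  calc κ * ENNReal.ofReal (ρ ^ n) * (κ * ENNReal.ofReal ((ρ / 2) ^ n))
      ≤ volume W * volume Z := mul_le_mul' h1 hZ
    _ = (volume : Measure (En n)).prod volume (W ×ˢ Z) := (Measure.prod_prod _ _).symm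
    _ ≤ ∑ m ∈ Finset.Icc 1 k, ((∫⁻ u in Metric.ball y (k * ρ), levelVol k f ρ T u)
          + ∫⁻ u in Metric.ball y (k * ρ), levelVol k f ρ T u) := by
        refine (measure_mono hsub).trans ((measure_biUnion_finset_le _ _).trans ?_)
        exact Finset.sum_le_sum fun m hm => (measure_union_le _ _).trans
          (add_le_add (hbound m hm) (hswap m hm))
    _ = _ := by
        rw [Finset.sum_const, Nat.card_Icc, nsmul_eq_mul, Nat.add_sub_cancel]; ring

end Propagation

section Covering

variable {n : ℕ}

lemma lintegral_ball_eq_indicator (y : En n) (s : ℝ) (G : En n → ℝ≥0∞) :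
    ∫⁻ u in Metric.ball y s, G u = ∫⁻ u, {v : En n × En n | dist v.2 v.1 < s}.indicator
      (fun v => G v.2) (y, u) := by
  rw [← lintegral_indicator Metric.isOpen_ball.measurableSet]
  rfl

lemma measurable_indicator_dist {G : En n → ℝ≥0∞} (hG : Measurable G) (s : ℝ) :
    Measurable ({v : En n × En n | dist v.2 v.1 < s}.indicator fun v => G v.2) := by
  have h : MeasurableSet {v : En n × En n | dist v.2 v.1 < s} :=
    measurableSet_lt (by fun_prop) measurable_const
  exact (hG.comp measurable_snd).indicator h

lemma measurable_lintegral_ball {G : En n → ℝ≥0∞} (hG : Measurable G) (s : ℝ) :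
    Measurable fun y => ∫⁻ u in Metric.ball y s, G u := by
  simp only [lintegral_ball_eq_indicator]
  exact (measurable_indicator_dist hG s).lintegral_prod_right'

lemma lintegral_lintegral_ball {G : En n → ℝ≥0∞} (hG : Measurable G) (s : ℝ) :
    ∫⁻ y, ∫⁻ u in Metric.ball y s, G u = volume (Metric.ball (0 : En n) s) * ∫⁻ u, G u := by
  simp only [lintegral_ball_eq_indicator]
  rw [lintegral_lintegral_swap (f := fun y u => {v : En n × En n | dist v.2 v.1 < s}.indicator
      (fun v => G v.2) (y, u)) (measurable_indicator_dist hG s).aemeasurable,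
    ← lintegral_const_mul _ hG]
  refine lintegral_congr fun u => ?_
  have : ∀ y, {v : En n × En n | dist v.2 v.1 < s}.indicator (fun v => G v.2) (y, u)
      = (Metric.ball u s).indicator (fun _ => G u) y := by
    intro y
    have hd : dist u y = dist y u := dist_comm u y
    by_cases h : dist y u < s
    · rw [indicator_of_mem (by simpa [hd] using h), indicator_of_mem (by simpa using h)]
    · rw [indicator_of_notMem (by simpa [hd] using h), indicator_of_notMem (by simpa using h)]
  simp only [this]
  rw [lintegral_indicator Metric.isOpen_ball.measurableSet, setLIntegral_const, mul_comm,
    Measure.addHaar_ball_center]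

lemma lintegral_volume_ball_inter {S : Set (En n)} (hS : MeasurableSet S) (R : ℝ) :
    ∫⁻ x, volume (Metric.ball x R ∩ S) = volume (Metric.ball (0 : En n) R) * volume S := by
  have h := lintegral_lintegral_ball (G := S.indicator 1) (measurable_one.indicator hS) R
  rw [lintegral_indicator_one hS] at h
  rw [← h]
  refine lintegral_congr fun x => ?_
  rw [lintegral_indicator_one hS, Measure.restrict_apply hS, inter_comm]

lemma lintegral_rpow_volume_inter_le {G : En n → ℝ≥0∞} (hG : Measurable G) {θ : ℝ} (hθ : 0 < θ)
    (hθ1 : θ ≤ 1) {ρ s R : ℝ} (hρ : 0 < ρ) (hρR : ρ ≤ R) {a : ℝ≥0∞} (ha : a ≠ 0) (ha' : a ≠ ⊤) :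
    ∫⁻ x, volume (Metric.ball x R ∩ {y | a ≤ ∫⁻ u in Metric.ball y s, G u}) ^ θ
      ≤ volume (Metric.ball (0 : En n) ρ) ^ (θ - 1) * (volume (Metric.ball (0 : En n) (2 * R)) *
        (a⁻¹ * (volume (Metric.ball (0 : En n) (s + ρ)) * ∫⁻ u, G u))) := by
  set U : Set (En n) := {y | a ≤ ∫⁻ u in Metric.ball y s, G u}
  set U' : Set (En n) := {y | a ≤ ∫⁻ u in Metric.ball y (s + ρ), G u}
  have hU' : MeasurableSet U' := measurableSet_le measurable_const (measurable_lintegral_ball hG _)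
  have hpt : ∀ x, volume (Metric.ball x R ∩ U) ^ θ
      ≤ volume (Metric.ball (0 : En n) ρ) ^ (θ - 1) * volume (Metric.ball x (2 * R) ∩ U') := by
    intro x
    rcases eq_empty_or_nonempty (Metric.ball x R ∩ U) with he | ⟨y, hyx, hyU⟩
    · rw [he, measure_empty, ENNReal.zero_rpow_of_pos hθ]; exact zero_le
    have hsub : ∀ y ∈ U, Metric.ball y ρ ⊆ U' := by
      intro y hy z hz
      refine le_trans hy.out (lintegral_mono_set (Metric.ball_subset_ball' ?_))
      rw [dist_comm]
      linarith [Metric.mem_ball.1 hz]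
    have h1 : volume (Metric.ball (0 : En n) ρ) ≤ volume (Metric.ball x (2 * R) ∩ U') := by
      rw [← Measure.addHaar_ball_center volume y]
      refine measure_mono (subset_inter (Metric.ball_subset_ball' ?_) (hsub y hyU))
      linarith [Metric.mem_ball.1 hyx]
    have h2 : volume (Metric.ball x R ∩ U) ≤ volume (Metric.ball x (2 * R) ∩ U') := by
      refine measure_mono (inter_subset_inter (Metric.ball_subset_ball (by linarith)) ?_)
      exact fun y hy => hsub y hy (Metric.mem_ball_self hρ)
    set N := volume (Metric.ball x (2 * R) ∩ U')
    have hN0 : N ≠ 0 := ((Metric.measure_ball_pos volume (0 : En n) hρ).trans_le h1).ne'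
    have hNt : N ≠ ⊤ := ((measure_mono inter_subset_left).trans_lt measure_ball_lt_top).ne
    calc volume (Metric.ball x R ∩ U) ^ θ ≤ N ^ θ := ENNReal.rpow_le_rpow h2 hθ.le
      _ = N ^ (θ - 1) * N := by
        conv_rhs => rw [← ENNReal.rpow_one N, ← ENNReal.rpow_mul, one_mul]
        rw [← ENNReal.rpow_add _ _ hN0 hNt, sub_add_cancel]
      _ ≤ _ := mul_le_mul_left (by
        rw [← neg_sub, ENNReal.rpow_neg, ENNReal.rpow_neg]
        exact ENNReal.inv_le_inv.2 (ENNReal.rpow_le_rpow h1 (by linarith))) _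
  have hpow : volume (Metric.ball (0 : En n) ρ) ^ (θ - 1) ≠ ⊤ := by
    rw [Ne, ENNReal.rpow_eq_top_iff]
    simp [(Metric.measure_ball_pos volume (0 : En n) hρ).ne', measure_ball_lt_top.ne]
  refine (lintegral_mono hpt).trans ?_
  rw [lintegral_const_mul' _ _ hpow, lintegral_volume_ball_inter hU']
  refine mul_le_mul_right (mul_le_mul_right ?_ _) _
  have h3 := mul_meas_ge_le_lintegral (μ := volume) (measurable_lintegral_ball hG (s + ρ)) a
  rw [lintegral_lintegral_ball hG] at h3
  calc volume U' = a⁻¹ * (a * volume U') := by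
        rw [← mul_assoc, ENNReal.inv_mul_cancel ha ha', one_mul]
    _ ≤ _ := mul_le_mul_right h3 _

lemma rpow_tsum_le {θ : ℝ} (hθ : 0 < θ) (hθ1 : θ ≤ 1) (a : ℕ → ℝ≥0∞) :
    (∑' i, a i) ^ θ ≤ ∑' i, a i ^ θ := by
  have h1 : ∀ s : Finset ℕ, (∑ i ∈ s, a i) ^ θ ≤ ∑' i, a i ^ θ := by
    intro s
    refine le_trans ?_ (ENNReal.sum_le_tsum s)
    induction s using Finset.induction_on with
    | empty => simp [hθ]
    | insert i s hi ih =>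
      rw [Finset.sum_insert hi, Finset.sum_insert hi]
      exact (ENNReal.rpow_add_le_add_rpow _ _ hθ.le hθ1).trans (add_le_add_right ih _)
  have h2 : Tendsto (fun s : Finset ℕ => (∑ i ∈ s, a i) ^ θ) atTop (𝓝 ((∑' i, a i) ^ θ)) :=
    (ENNReal.continuous_rpow_const.tendsto _).comp ENNReal.summable.hasSum
  exact le_of_tendsto' h2 h1

end Covering

section SingleScale

variable {n : ℕ}

lemma ofReal_two_rpow_pow (τ : ℝ) (m : ℕ) : ENNReal.ofReal (((2 : ℝ) ^ τ) ^ m) = 2 ^ (τ * m) := by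
  rw [← Real.rpow_mul_natCast two_pos.le, ofReal_two_rpow]

lemma volume_ball_two_rpow (x : En n) (τ : ℝ) :
    volume (Metric.ball x ((2 : ℝ) ^ τ)) = 2 ^ (τ * n) * volume (Metric.ball (0 : En n) 1) := by
  rw [volume_ball_eq _ (by positivity), ofReal_two_rpow_pow]

lemma levelVol_mul_le {k : ℕ} {f : En n → ℝ} (hfm : Measurable f) (ρ S : ℝ) (y : En n) :
    ENNReal.ofReal S * levelVol k f ρ S y ≤ ∫⁻ h in Metric.ball (0 : En n) ρ, ‖kDiff k f h y‖ₑ := by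
  have hm : Measurable fun h : En n => kDiff k f h y :=
    (measurable_kDiff hfm k).comp (g := fun z : En n × En n => kDiff k f z.2 z.1) (f := fun h => (y, h))
      (by fun_prop)
  refine le_trans ?_ (mul_meas_ge_le_lintegral hm.enorm (ENNReal.ofReal S))
  refine mul_le_mul_right ?_ _
  rw [Measure.restrict_apply (measurableSet_le measurable_const hm.enorm)]
  refine measure_mono fun h hh => ⟨?_, mem_ball_zero_iff.2 hh.1⟩
  show ENNReal.ofReal S ≤ ‖kDiff k f h y‖ₑ
  rw [← ofReal_norm]
  exact ENNReal.ofReal_le_ofReal hh.2.le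

lemma tendsto_two_rpow_neg_nat_mul {δ : ℝ} (hδ : 0 < δ) :
    Tendsto (fun i : ℕ => (2 : ℝ≥0∞) ^ (-(i : ℝ) * δ)) atTop (𝓝 0) := by
  have h : ∀ i : ℕ, (2 : ℝ≥0∞) ^ (-(i : ℝ) * δ) = (2 ^ (-δ)) ^ i := fun i => by
    rw [← ENNReal.rpow_natCast, ← ENNReal.rpow_mul]; congr 1; ring
  simp only [h]
  exact ENNReal.tendsto_pow_atTop_nhds_zero_of_lt_one
    (ENNReal.rpow_lt_one_of_one_lt_of_neg (by norm_num) (by linarith))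

/-- If `f` has many large differences at `y` at scale `2^σ`, then the decay of the differences of `f`
at small scales forces large differences at many points near `y`, at some smaller scale. -/
lemma exists_scale_of_le_levelVol {k : ℕ} (hk : 0 < k) {f : En n → ℝ} (hfm : Measurable f) {y : En n}
    (hdecay : ∃ M < (⊤ : ℝ≥0∞), ∀ᶠ r in 𝓝[>] (0 : ℝ),
      ∫⁻ h in Metric.ball (0 : En n) r, ‖kDiff k f h y‖ₑ ≤ M * ENNReal.ofReal (r ^ (k + n)))
    {κ : ℝ≥0∞} (hκ0 : κ ≠ 0) (hκ : 2 * κ ≤ volume (Metric.ball (0 : En n) 1))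
    {ε : ℝ} (hεk : ε < k) {σ S : ℝ} (hS : 0 < S)
    (hy : κ * 2 ^ (σ * n) ≤ levelVol k f ((2 : ℝ) ^ σ) S y) :
    ∃ i : ℕ, κ * 2 ^ ((σ - i) * n) * (κ * 2 ^ ((σ - i - 1) * n)) ≤
      2 * k * ∫⁻ u in Metric.ball y (k * 2 ^ (σ - i)),
        levelVol k f ((2 : ℝ) ^ (σ - i))
          ((1 - (2 : ℝ) ^ (-ε)) / (2 * k * 2 ^ k) * (2 : ℝ) ^ (-(i : ℝ) * ε) * S) u := by
  set P : ℕ → Prop := fun i =>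
    κ * 2 ^ ((σ - i) * n) ≤ levelVol k f ((2 : ℝ) ^ (σ - i)) ((2 : ℝ) ^ (-(i : ℝ) * ε) * S) y with hP
  have hP0 : P 0 := by simpa [hP] using hy
  have hex : ∃ i, ¬ P i := by
    by_contra! hall
    obtain ⟨M, hM, hev⟩ := hdecay
    have hscale : Tendsto (fun i : ℕ => (2 : ℝ) ^ (σ - i)) atTop (𝓝[>] 0) := by
      refine tendsto_nhdsWithin_iff.2 ⟨?_, Eventually.of_forall fun i => by
        show (0 : ℝ) < 2 ^ (σ - i); positivity⟩
      have : ∀ i : ℕ, (2 : ℝ) ^ (σ - i) = 2 ^ σ * (2⁻¹) ^ i := fun i => by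
        rw [Real.rpow_sub two_pos, Real.rpow_natCast, inv_pow]; rfl
      simp only [this]
      simpa using (tendsto_pow_atTop_nhds_zero_of_lt_one (by norm_num : (0 : ℝ) ≤ 2⁻¹)
        (by norm_num)).const_mul ((2 : ℝ) ^ σ)
    have hle : ∀ᶠ i : ℕ in atTop, κ * ENNReal.ofReal S
        ≤ M * 2 ^ (σ * k) * 2 ^ (-(i : ℝ) * (k - ε)) := by
      filter_upwards [hscale.eventually hev] with i hi
      have h1 := (mul_le_mul_right (hall i) _).trans
        ((levelVol_mul_le (k := k) hfm ((2 : ℝ) ^ (σ - i)) ((2 : ℝ) ^ (-(i : ℝ) * ε) * S) y).trans hi)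
      rw [ENNReal.ofReal_mul (by positivity), ofReal_two_rpow, ofReal_two_rpow_pow] at h1
      have h2 := mul_le_mul_right h1 (2 ^ (-((σ - i) * n) + i * ε))
      calc κ * ENNReal.ofReal S
          = (2 : ℝ≥0∞) ^ (-((σ - i) * n) + i * ε + -(i : ℝ) * ε + (σ - i) * n) * (κ * ENNReal.ofReal S) := by
            rw [show -((σ - i) * n) + i * ε + -(i : ℝ) * ε + (σ - i) * n = 0 by ring]; simp
        _ = 2 ^ (-((σ - i) * n) + i * ε) * (2 ^ (-(i : ℝ) * ε) * ENNReal.ofReal S *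
            (κ * 2 ^ ((σ - i) * n))) := by
            rw [two_rpow_add, two_rpow_add]; ring
        _ ≤ _ := h2
        _ = M * (2 ^ (-((σ - i) * n) + i * ε) * 2 ^ ((σ - i) * ((k + n : ℕ) : ℝ))) := by ring
        _ = _ := by
            rw [mul_assoc, ← two_rpow_add, ← two_rpow_add]
            congr 2; push_cast; ring
    have hlim : Tendsto (fun i : ℕ => M * 2 ^ (σ * k) * (2 : ℝ≥0∞) ^ (-(i : ℝ) * (k - ε))) atTop (𝓝 0) := by
      have := ENNReal.Tendsto.const_mul (a := M * 2 ^ (σ * k))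
        (tendsto_two_rpow_neg_nat_mul (sub_pos.2 hεk))
        (Or.inr (ENNReal.mul_ne_top hM.ne (two_rpow_ne_top _)))
      simpa using this
    have h3 := ge_of_tendsto hlim hle
    exact mul_ne_zero hκ0 (by simpa using hS) (le_antisymm h3 zero_le)
  obtain ⟨i, hi, hi'⟩ : ∃ i, P i ∧ ¬ P (i + 1) := by
    by_contra! hstep
    obtain ⟨i, hi⟩ := hex
    exact hi (Nat.rec hP0 hstep i)
  refine ⟨i, ?_⟩
  have hhalf : (2 : ℝ) ^ (σ - ((i + 1 : ℕ) : ℝ)) = 2 ^ (σ - i) / 2 := by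
    rw [show σ - ((i + 1 : ℕ) : ℝ) = (σ - i) - 1 by push_cast; ring, Real.rpow_sub two_pos, Real.rpow_one]
  have e1 : ENNReal.ofReal (((2 : ℝ) ^ (σ - i) / 2) ^ n) = 2 ^ ((σ - i - 1) * n) := by
    rw [← hhalf, ofReal_two_rpow_pow]; congr 1; push_cast; ring
  have h1 : κ * ENNReal.ofReal (((2 : ℝ) ^ (σ - i)) ^ n)
      ≤ levelVol k f ((2 : ℝ) ^ (σ - i)) ((2 : ℝ) ^ (-(i : ℝ) * ε) * S) y := by
    rw [ofReal_two_rpow_pow]; exact hi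
  have h2 : levelVol k f ((2 : ℝ) ^ (σ - i) / 2) ((2 : ℝ) ^ (-((i + 1 : ℕ) : ℝ) * ε) * S) y
      ≤ κ * ENNReal.ofReal (((2 : ℝ) ^ (σ - i) / 2) ^ n) := by
    rw [← hhalf, ofReal_two_rpow_pow]; exact (not_le.1 hi').le
  have h3 := le_lintegral_levelVol_of_drop hk hfm (by positivity) hκ h1 h2
  rw [ofReal_two_rpow_pow, e1] at h3
  convert h3 using 6
  rw [show -((i + 1 : ℕ) : ℝ) * ε = -(i : ℝ) * ε + -ε by push_cast; ring, Real.rpow_add two_pos]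
  ring

lemma lintegral_levelVol_rpow_le {k : ℕ} (hk : 0 < k) {θ ε : ℝ} (hθ : 0 < θ) (hθ1 : θ ≤ 1)
    (hε : 0 < ε) (hεk : ε < k) :
    ∃ C : ℝ≥0∞, C < ⊤ ∧ ∃ c : ℝ, 0 < c ∧ ∀ f : En n → ℝ, Measurable f →
      (∀ᵐ x, ∃ M < (⊤ : ℝ≥0∞), ∀ᶠ r in 𝓝[>] (0 : ℝ),
        ∫⁻ h in Metric.ball (0 : En n) r, ‖kDiff k f h x‖ₑ ≤ M * ENNReal.ofReal (r ^ (k + n))) →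
      ∀ τ T : ℝ, 0 < T →
      ∫⁻ x, levelVol k f ((2 : ℝ) ^ τ) T x ^ θ
        ≤ C * ∑' i : ℕ, (2 : ℝ≥0∞) ^ (i * n + (τ + k - i) * (n * (θ - 1))) *
          ∫⁻ x, levelVol k f ((2 : ℝ) ^ (τ + k - i)) (c * (2 : ℝ) ^ (-(i : ℝ) * ε) * T) x := by
  set ω := volume (Metric.ball (0 : En n) 1) with hω
  have hω0 : ω ≠ 0 := (Metric.measure_ball_pos _ _ one_pos).ne'
  have hωt : ω ≠ ⊤ := measure_ball_lt_top.ne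
  have hkR : (0 : ℝ) < k := by exact_mod_cast hk
  have hk0 : (k : ℝ≥0∞) ≠ 0 := by exact_mod_cast hk.ne'
  have hkt : (k : ℝ≥0∞) ≠ ⊤ := ENNReal.natCast_ne_top k
  have hk2 : (k : ℝ) + 1 ≤ 2 ^ (k : ℝ) := by
    rw [Real.rpow_natCast]; exact_mod_cast Nat.lt_two_pow_self
  have hD0 : (4 * k * 2 ^ ((k : ℝ) * n) : ℝ≥0∞) ≠ 0 :=
    mul_ne_zero (mul_ne_zero (by simp) hk0) (two_rpow_ne_zero _)
  have hDt : (4 * k * 2 ^ ((k : ℝ) * n) : ℝ≥0∞) ≠ ⊤ :=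
    ENNReal.mul_ne_top (ENNReal.mul_ne_top (by simp) hkt) (two_rpow_ne_top _)
  set κ : ℝ≥0∞ := ω / (4 * k * 2 ^ ((k : ℝ) * n)) with hκ
  have hκ0 : κ ≠ 0 := ENNReal.div_ne_zero.2 ⟨hω0, hDt⟩
  have hκt : κ ≠ ⊤ := ENNReal.div_ne_top hωt hD0
  have hκω : 4 * k * 2 ^ ((k : ℝ) * n) * κ = ω := ENNReal.mul_div_cancel hD0 hDt
  have hκ2 : 2 * κ ≤ ω := by
    rw [← hκω]
    refine mul_le_mul_left ?_ κ
    calc (2 : ℝ≥0∞) ≤ 4 * 1 * 1 := by norm_num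
      _ ≤ _ := by
        gcongr
        · exact_mod_cast hk
        · calc (1 : ℝ≥0∞) = 2 ^ (0 : ℝ) := by simp
            _ ≤ _ := ENNReal.rpow_le_rpow_of_exponent_le (by norm_num) (by positivity)
  have hη : 0 < 1 - (2 : ℝ) ^ (-ε) := by
    have := Real.rpow_lt_one_of_one_lt_of_neg one_lt_two (neg_neg_of_pos hε)
    linarith
  have hη1 : 1 - (2 : ℝ) ^ (-ε) ≤ 1 := by linarith [Real.rpow_pos_of_pos two_pos (-ε)]
  set D : ℝ := 2 * k * 2 ^ k with hD
  have hDpos : 0 < D := by positivity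
  have hD1 : 1 ≤ D := by
    have : (1 : ℝ) ≤ k := by exact_mod_cast hk
    have h2 : (1 : ℝ) ≤ 2 ^ k := one_le_pow₀ (by norm_num)
    rw [hD]; nlinarith
  set c : ℝ := (1 - (2 : ℝ) ^ (-ε)) / D / D with hc
  set Ca : ℝ≥0∞ := ω ^ θ * κ⁻¹ with hCa
  set Cb : ℝ≥0∞ := ω ^ (θ - 1) * ω * (2 * k * κ⁻¹ * κ⁻¹) * ω * 2 ^ ((n : ℝ) * (k + 2)) with hCb
  have hωθ : ∀ s : ℝ, ω ^ s ≠ ⊤ := fun s => by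
    rw [Ne, ENNReal.rpow_eq_top_iff]; simp [hω0, hωt]
  have hκi : κ⁻¹ ≠ ⊤ := ENNReal.inv_ne_top.2 hκ0
  refine ⟨Ca + (k : ℝ≥0∞) ^ θ * Cb, ?_, c, by positivity, fun f hfm hdecay τ T hT => ?_⟩
  · refine lt_top_iff_ne_top.2 (ENNReal.add_ne_top.2 ⟨ENNReal.mul_ne_top (hωθ _) hκi,
      ENNReal.mul_ne_top (ENNReal.rpow_ne_top_of_nonneg hθ.le hkt) ?_⟩)
    exact ENNReal.mul_ne_top (ENNReal.mul_ne_top (ENNReal.mul_ne_top (ENNReal.mul_ne_top (hωθ _) hωt)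
      (ENNReal.mul_ne_top (ENNReal.mul_ne_top (ENNReal.mul_ne_top (by simp) hkt) hκi) hκi)) hωt)
      (two_rpow_ne_top _)
  set σ : ℝ := τ + k with hσ
  set G : ℕ → En n → ℝ≥0∞ := fun i =>
    levelVol k f ((2 : ℝ) ^ (σ - i)) (c * (2 : ℝ) ^ (-(i : ℝ) * ε) * T) with hG
  have hGm : ∀ i, Measurable (G i) := fun i => measurable_levelVol hfm _ _
  set V : Set (En n) := {y | κ * 2 ^ (σ * n) ≤ levelVol k f ((2 : ℝ) ^ σ) (T / D) y} with hV
  have hVm : MeasurableSet V := measurableSet_le measurable_const (measurable_levelVol hfm _ _)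
  set a : ℕ → ℝ≥0∞ := fun i => κ * 2 ^ ((σ - i) * n) * (κ * 2 ^ ((σ - i - 1) * n)) / (2 * k) with ha
  have h2k0 : (2 * k : ℝ≥0∞) ≠ 0 := mul_ne_zero (by simp) hk0
  have h2kt : (2 * k : ℝ≥0∞) ≠ ⊤ := ENNReal.mul_ne_top (by simp) hkt
  have ha0 : ∀ i, a i ≠ 0 := fun i => ENNReal.div_ne_zero.2
    ⟨mul_ne_zero (mul_ne_zero hκ0 (two_rpow_ne_zero _)) (mul_ne_zero hκ0 (two_rpow_ne_zero _)), h2kt⟩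
  have hat : ∀ i, a i ≠ ⊤ := fun i => ENNReal.div_ne_top
    (ENNReal.mul_ne_top (ENNReal.mul_ne_top hκt (two_rpow_ne_top _))
      (ENNReal.mul_ne_top hκt (two_rpow_ne_top _))) h2k0
  set U : ℕ → Set (En n) := fun i => {y | a i ≤ ∫⁻ u in Metric.ball y (k * 2 ^ (σ - i)), G i u} with hU
  have hUm : ∀ i, MeasurableSet (U i) := fun i =>
    measurableSet_le measurable_const (measurable_lintegral_ball (hGm i) _)
  have hVU : ∀ᵐ y, y ∈ V → y ∈ ⋃ i, U i := by
    filter_upwards [hdecay] with y hy hyV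
    obtain ⟨i, hi⟩ := exists_scale_of_le_levelVol hk hfm hy hκ0 hκ2 hεk (by positivity : 0 < T / D) hyV
    refine mem_iUnion.2 ⟨i, ENNReal.div_le_of_le_mul' ?_⟩
    have ht : c * (2 : ℝ) ^ (-(i : ℝ) * ε) * T
        = (1 - (2 : ℝ) ^ (-ε)) / D * (2 : ℝ) ^ (-(i : ℝ) * ε) * (T / D) := by rw [hc]; ring
    simp only [hG]
    rw [ht]
    exact hi
  have hball : ∀ x : En n, volume (Metric.ball x ((2 : ℝ) ^ σ) ∩ V)
      ≤ ∑' i, volume (Metric.ball x ((2 : ℝ) ^ σ) ∩ U i) := by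
    intro x
    refine le_trans (measure_mono_ae (t := ⋃ i, Metric.ball x ((2 : ℝ) ^ σ) ∩ U i) ?_)
      (measure_iUnion_le _)
    filter_upwards [hVU] with y hy hyV
    rw [← inter_iUnion]
    exact ⟨hyV.1, hy hyV.2⟩
  have hpt : ∀ x, levelVol k f ((2 : ℝ) ^ τ) T x ^ θ
      ≤ V.indicator (fun _ => (2 ^ (τ * n) * ω) ^ θ) x
        + (k : ℝ≥0∞) ^ θ * ∑' i, volume (Metric.ball x ((2 : ℝ) ^ σ) ∩ U i) ^ θ := by
    intro x
    have h1 := levelVol_le_indicator_add hk f (r := 2 ^ τ) (R := 2 ^ σ) (T := T) (by positivity)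
      (by rw [hσ, Real.rpow_add two_pos, mul_comm]; gcongr) (V := V) (fun y hy => ?_) x
    · refine (ENNReal.rpow_le_rpow h1 hθ.le).trans ?_
      refine (ENNReal.rpow_add_le_add_rpow _ _ hθ.le hθ1).trans (add_le_add (le_of_eq ?_) ?_)
      · rw [volume_ball_two_rpow]
        by_cases hx : x ∈ V
        · rw [indicator_of_mem hx, indicator_of_mem hx]
        · rw [indicator_of_notMem hx, indicator_of_notMem hx, ENNReal.zero_rpow_of_pos hθ]
      · rw [ENNReal.mul_rpow_of_nonneg _ _ hθ.le]
        refine mul_le_mul_right ?_ _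
        exact (ENNReal.rpow_le_rpow (hball x) hθ.le).trans (rpow_tsum_le hθ hθ1 _)
    · have hy' := (not_le.1
        (show ¬ κ * 2 ^ (σ * n) ≤ levelVol k f ((2 : ℝ) ^ σ) (T / D) y from hy)).le
      rw [volume_ball_two_rpow, ← hω, ← hκω]
      refine (mul_le_mul_right hy' _).trans (le_of_eq ?_)
      rw [hσ, add_mul, two_rpow_add]; ring
  have hVvol : volume V ≤ κ⁻¹ * 2 ^ (-(σ * n)) * ∫⁻ x, G 0 x := by
    have h1 := mul_meas_ge_le_lintegral (μ := volume)
      (measurable_levelVol (k := k) hfm ((2 : ℝ) ^ σ) (T / D)) (κ * 2 ^ (σ * n))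
    have h2 : ∫⁻ x, levelVol k f ((2 : ℝ) ^ σ) (T / D) x ≤ ∫⁻ x, G 0 x := by
      refine lintegral_mono fun x => levelVol_mono (by simp) ?_ x
      have : c * T ≤ T / D := by
        rw [hc, div_mul_eq_mul_div]
        gcongr
        refine mul_le_of_le_one_left hT.le ?_
        rw [div_le_one hDpos]; linarith
      simpa using this
    calc volume V = (κ * κ⁻¹) * (2 : ℝ≥0∞) ^ (-(σ * n) + σ * n) * volume V := by
          rw [ENNReal.mul_inv_cancel hκ0 hκt]; simp
      _ = κ⁻¹ * 2 ^ (-(σ * n)) * (κ * 2 ^ (σ * n) * volume V) := by rw [two_rpow_add]; ring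
      _ ≤ _ := mul_le_mul_right (h1.trans h2) _
  set E : ℕ → ℝ≥0∞ := fun i => 2 ^ (i * n + (σ - i) * (n * (θ - 1))) * ∫⁻ x, G i x with hE
  have hfirst : (2 ^ (τ * n) * ω) ^ θ * volume V ≤ Ca * E 0 := by
    refine (mul_le_mul_right hVvol _).trans ?_
    rw [ENNReal.mul_rpow_of_nonneg _ _ hθ.le, ← ENNReal.rpow_mul]
    calc _ = Ca * ((2 : ℝ≥0∞) ^ (τ * n * θ + -(σ * n)) * ∫⁻ x, G 0 x) := by
          rw [hCa, two_rpow_add]; ring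
      _ ≤ Ca * E 0 := by
          refine mul_le_mul_right (mul_le_mul_left ?_ _) _
          refine ENNReal.rpow_le_rpow_of_exponent_le (by norm_num) ?_
          have : τ * n * θ ≤ σ * n * θ := by gcongr; rw [hσ]; linarith
          push_cast
          linarith
  have hterm : ∀ i, ∫⁻ x, volume (Metric.ball x ((2 : ℝ) ^ σ) ∩ U i) ^ θ ≤ Cb * E i := by
    intro i
    refine (lintegral_rpow_volume_inter_le (hGm i) hθ hθ1 (ρ := 2 ^ (σ - i)) (by positivity)
      (Real.rpow_le_rpow_of_exponent_le one_le_two (by simp)) (ha0 i) (hat i)).trans ?_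
    have e2 : 2 * (2 : ℝ) ^ σ = 2 ^ (σ + 1) := by
      rw [Real.rpow_add two_pos σ 1, Real.rpow_one, mul_comm]
    have e3 : volume (Metric.ball (0 : En n) (k * 2 ^ (σ - i) + 2 ^ (σ - i)))
        ≤ 2 ^ ((k + (σ - i)) * n) * ω := by
      rw [hω, ← volume_ball_two_rpow]
      refine measure_mono (Metric.ball_subset_ball ?_)
      rw [Real.rpow_add two_pos, ← add_one_mul]
      gcongr
    have e4 : (a i)⁻¹ = 2 * k * κ⁻¹ * κ⁻¹ * (2 ^ (-((σ - i) * n)) * 2 ^ (-((σ - i - 1) * n))) := by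
      simp only [ha]
      rw [ENNReal.inv_div (Or.inl h2kt) (Or.inl h2k0), div_eq_mul_inv,
        ENNReal.mul_inv (Or.inl (mul_ne_zero hκ0 (two_rpow_ne_zero _)))
          (Or.inl (ENNReal.mul_ne_top hκt (two_rpow_ne_top _))),
        ENNReal.mul_inv (Or.inl hκ0) (Or.inl hκt), ENNReal.mul_inv (Or.inl hκ0) (Or.inl hκt),
        ENNReal.rpow_neg, ENNReal.rpow_neg]
      ring
    rw [volume_ball_two_rpow, e2, volume_ball_two_rpow, ENNReal.mul_rpow_of_ne_top (two_rpow_ne_top _) hωt,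
      ← ENNReal.rpow_mul, e4]
    calc _ ≤ 2 ^ ((σ - i) * n * (θ - 1)) * ω ^ (θ - 1) * (2 ^ ((σ + 1) * n) * ω *
          (2 * k * κ⁻¹ * κ⁻¹ * (2 ^ (-((σ - i) * n)) * 2 ^ (-((σ - i - 1) * n))) *
            (2 ^ ((k + (σ - i)) * n) * ω * ∫⁻ x, G i x))) := by
          gcongr
      _ = ω ^ (θ - 1) * ω * (2 * k * κ⁻¹ * κ⁻¹) * ω * (2 ^ ((σ - i) * n * (θ - 1)) * 2 ^ ((σ + 1) * n) *
          2 ^ (-((σ - i) * n)) * 2 ^ (-((σ - i - 1) * n)) * 2 ^ ((k + (σ - i)) * n)) *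
            ∫⁻ x, G i x := by ring
      _ = Cb * E i := by
          simp only [← two_rpow_add, hCb, hE]
          rw [mul_assoc (ω ^ (θ - 1) * ω * (2 * k * κ⁻¹ * κ⁻¹) * ω), mul_assoc (ω ^ (θ - 1) * ω * (2 * k * κ⁻¹ * κ⁻¹) * ω),
            ← mul_assoc (2 ^ ((n : ℝ) * (k + 2)) : ℝ≥0∞), ← two_rpow_add]
          congr 3
          ring_nf
  have hmeas : ∀ i, Measurable fun x : En n => volume (Metric.ball x ((2 : ℝ) ^ σ) ∩ U i) ^ θ := by
    intro i
    have h1 : (fun x : En n => volume (Metric.ball x ((2 : ℝ) ^ σ) ∩ U i))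
        = fun x => ∫⁻ u in Metric.ball x ((2 : ℝ) ^ σ), (U i).indicator 1 u := by
      funext x
      rw [lintegral_indicator_one (hUm i), Measure.restrict_apply (hUm i), inter_comm]
    refine Measurable.pow_const ?_ θ
    rw [h1]
    exact measurable_lintegral_ball (measurable_one.indicator (hUm i)) _
  calc ∫⁻ x, levelVol k f ((2 : ℝ) ^ τ) T x ^ θ
      ≤ ∫⁻ x, (V.indicator (fun _ => (2 ^ (τ * n) * ω) ^ θ) x
        + (k : ℝ≥0∞) ^ θ * ∑' i, volume (Metric.ball x ((2 : ℝ) ^ σ) ∩ U i) ^ θ) := lintegral_mono hpt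
    _ = (2 ^ (τ * n) * ω) ^ θ * volume V
        + (k : ℝ≥0∞) ^ θ * ∑' i, ∫⁻ x, volume (Metric.ball x ((2 : ℝ) ^ σ) ∩ U i) ^ θ := by
        rw [lintegral_add_left (measurable_const.indicator hVm), lintegral_indicator hVm,
          setLIntegral_const, lintegral_const_mul' _ _ (ENNReal.rpow_ne_top_of_nonneg hθ.le hkt),
          lintegral_tsum fun i => (hmeas i).aemeasurable]
    _ ≤ Ca * ∑' i, E i + (k : ℝ≥0∞) ^ θ * (Cb * ∑' i, E i) := by
        refine add_le_add (hfirst.trans (mul_le_mul_right (ENNReal.le_tsum 0) _)) (mul_le_mul_right ?_ _)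
        rw [← ENNReal.tsum_mul_left]
        exact ENNReal.tsum_le_tsum hterm
    _ = _ := by ring

end SingleScale

section LevelSums
variable {n : ℕ}

lemma tsum_two_rpow_neg_ne_top {s : ℝ} (hs : 0 < s) : ∑' i : ℕ, (2 : ℝ≥0∞) ^ (-(i : ℝ) * s) ≠ ⊤ := by
  have h : ∀ i : ℕ, (2 : ℝ≥0∞) ^ (-(i : ℝ) * s) = (2 ^ (-s)) ^ i := fun i => by
    rw [← ENNReal.rpow_natCast, ← ENNReal.rpow_mul]; congr 1; ring
  simp_rw [h]
  rw [ENNReal.tsum_geometric]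
  refine ENNReal.inv_ne_top.2 (tsub_pos_of_lt ?_).ne'
  rw [← ofReal_two_rpow, ← ENNReal.ofReal_one]
  exact (ENNReal.ofReal_lt_ofReal_iff one_pos).2
    (Real.rpow_lt_one_of_one_lt_of_neg one_lt_two (neg_neg_of_pos hs))

lemma sum_lintegral_levelVol_rpow_le {k : ℕ} (hk : 0 < k) {p q γ θ : ℝ} (hp : 1 ≤ p) (hq : 0 < q)
    (hγ : γ ∈ Gam p q) (hθ : 0 < θ) (hθ1 : θ ≤ 1) (hθk : n * (1 - θ) < k * p) :
    ∃ C : ℝ≥0∞, C < ⊤ ∧ ∀ (f : En n → ℝ) (g : (Fin n → ℕ) → En n → ℝ) (lam : ℝ),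
      LocallyIntegrable f volume → HasWeakDerivs k f g → Measurable f → (∀ α, Measurable (g α)) →
      0 < lam →
      ∑' j : ℤ, (2 : ℝ≥0∞) ^ ((j : ℝ) * (γ / q * p - n * θ)) *
        ∫⁻ x, levelVol k f ((2 : ℝ) ^ (j : ℝ)) (lam * (2 : ℝ) ^ ((j : ℝ) * (k + γ / q))) x ^ θ
      ≤ C * ENNReal.ofReal lam ^ (-p) * ∫⁻ x, ENNReal.ofReal (gradLen k g x) ^ p := by
  have hp0 : 0 < p := one_pos.trans_le hp
  have hkR : (0 : ℝ) < k := by exact_mod_cast hk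
  set ε : ℝ := (k * p - n * (1 - θ)) / (2 * p) with hε
  have hε0 : 0 < ε := div_pos (by linarith) (by positivity)
  have hn0 : 0 ≤ (n : ℝ) * (1 - θ) := mul_nonneg (by positivity) (by linarith)
  have hεk : ε < k := by rw [hε, div_lt_iff₀ (by positivity)]; nlinarith
  have hεp : ε * p = (k * p - n * (1 - θ)) / 2 := by rw [hε]; field_simp
  set s : ℝ := k * p - n * (1 - θ) - ε * p with hs
  have hs0 : 0 < s := by rw [hs, hεp]; linarith
  set β : ℝ := γ / q with hβ
  obtain ⟨C₁, hC₁, c, hc, h₁⟩ := lintegral_levelVol_rpow_le (n := n) hk hθ hθ1 hε0 hεk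
  obtain ⟨C₂, hC₂, h₂⟩ := sum_lintegral_levelVol_le (n := n) hk hp hq hγ
  have hcp : ENNReal.ofReal c ^ (-p) ≠ ⊤ := by
    rw [Ne, ENNReal.rpow_eq_top_iff]; simp [hc]
  refine ⟨C₁ * (C₂ * ENNReal.ofReal c ^ (-p) * 2 ^ (k * (k * p + n * θ)) *
    ∑' i : ℕ, (2 : ℝ≥0∞) ^ (-(i : ℝ) * s)), ?_, ?_⟩
  · exact ENNReal.mul_lt_top hC₁ (ENNReal.mul_lt_top (ENNReal.mul_lt_top (ENNReal.mul_lt_top hC₂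
      hcp.lt_top) (two_rpow_ne_top _).lt_top) (tsum_two_rpow_neg_ne_top hs0).lt_top)
  intro f g lam hf hg hfm hgm hlam
  have hdec := ae_lintegral_kDiff_le hf hg hfm hgm
  set μ : ℕ → ℝ := fun i => c * lam * (2 : ℝ) ^ (-(i : ℝ) * ε + (i - k) * (k + β)) with hμ
  have hμ0 : ∀ i, 0 < μ i := fun i => by positivity
  set I := ∫⁻ x, ENNReal.ofReal (gradLen k g x) ^ p with hI
  have hreindex : ∀ i : ℕ, ∑' j : ℤ, (2 : ℝ≥0∞) ^ ((j : ℝ) * (β * p - n * θ)) *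
      (2 ^ (i * n + ((j : ℝ) + k - i) * (n * (θ - 1))) *
        ∫⁻ x, levelVol k f ((2 : ℝ) ^ ((j : ℝ) + k - i))
          (c * (2 : ℝ) ^ (-(i : ℝ) * ε) * (lam * (2 : ℝ) ^ ((j : ℝ) * (k + β)))) x)
      = 2 ^ (i * (β * p - n * θ + n) - k * (β * p - n * θ)) * ∑' j : ℤ, (2 : ℝ≥0∞) ^ ((j : ℝ) * (β * p - n)) *
        ∫⁻ x, levelVol k f ((2 : ℝ) ^ (j : ℝ)) (μ i * (2 : ℝ) ^ ((j : ℝ) * (k + β))) x := by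
    intro i
    rw [← ENNReal.tsum_mul_left]
    refine Eq.trans (tsum_congr fun j => ?_) ((Equiv.addRight ((k : ℤ) - i)).tsum_eq _)
    have e1 : (((Equiv.addRight ((k : ℤ) - i)) j : ℤ) : ℝ) = (j : ℝ) + k - i := by
      simp; ring
    have e2 : c * (2 : ℝ) ^ (-(i : ℝ) * ε) * (lam * (2 : ℝ) ^ ((j : ℝ) * (k + β)))
        = μ i * (2 : ℝ) ^ (((j : ℝ) + k - i) * (k + β)) := by
      rw [hμ]
      calc _ = c * lam * ((2 : ℝ) ^ (-(i : ℝ) * ε) * (2 : ℝ) ^ ((j : ℝ) * (k + β))) := by ring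
        _ = c * lam * ((2 : ℝ) ^ (-(i : ℝ) * ε + (i - k) * (k + β)) *
            (2 : ℝ) ^ (((j : ℝ) + k - i) * (k + β))) := by
          rw [← Real.rpow_add two_pos, ← Real.rpow_add two_pos]; congr 2; ring
        _ = _ := by ring
    have e3 : (2 : ℝ≥0∞) ^ ((j : ℝ) * (β * p - n * θ)) * 2 ^ (i * n + ((j : ℝ) + k - i) * (n * (θ - 1)))
        = 2 ^ (i * (β * p - n * θ + n) - k * (β * p - n * θ)) *
          2 ^ (((j : ℝ) + k - i) * (β * p - n)) := by
      rw [← two_rpow_add, ← two_rpow_add]; congr 1; ring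
    rw [e1, e2, ← mul_assoc, e3, mul_assoc]
  have hμp : ∀ i : ℕ, ENNReal.ofReal (μ i) ^ (-p) = ENNReal.ofReal c ^ (-p) * ENNReal.ofReal lam ^ (-p) *
      2 ^ ((-(i : ℝ) * ε + (i - k) * (k + β)) * (-p)) := fun i => by
    rw [hμ]
    simp only
    rw [ENNReal.ofReal_mul (by positivity), ENNReal.ofReal_mul hc.le, ofReal_two_rpow,
      ENNReal.mul_rpow_of_ne_top (by finiteness) (two_rpow_ne_top _),
      ENNReal.mul_rpow_of_ne_top (by finiteness) (by finiteness), ← ENNReal.rpow_mul]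
  calc _ ≤ ∑' j : ℤ, (2 : ℝ≥0∞) ^ ((j : ℝ) * (β * p - n * θ)) *
        (C₁ * ∑' i : ℕ, (2 : ℝ≥0∞) ^ (i * n + ((j : ℝ) + k - i) * (n * (θ - 1))) *
          ∫⁻ x, levelVol k f ((2 : ℝ) ^ ((j : ℝ) + k - i))
            (c * (2 : ℝ) ^ (-(i : ℝ) * ε) * (lam * (2 : ℝ) ^ ((j : ℝ) * (k + β)))) x) := by
        refine ENNReal.tsum_le_tsum fun j => mul_le_mul_right ?_ _
        exact h₁ f hfm hdec j _ (by positivity)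
    _ = C₁ * ∑' i : ℕ, ∑' j : ℤ, (2 : ℝ≥0∞) ^ ((j : ℝ) * (β * p - n * θ)) *
        (2 ^ (i * n + ((j : ℝ) + k - i) * (n * (θ - 1))) *
          ∫⁻ x, levelVol k f ((2 : ℝ) ^ ((j : ℝ) + k - i))
            (c * (2 : ℝ) ^ (-(i : ℝ) * ε) * (lam * (2 : ℝ) ^ ((j : ℝ) * (k + β)))) x) := by
        rw [ENNReal.tsum_comm, ← ENNReal.tsum_mul_left]
        refine tsum_congr fun j => ?_
        rw [mul_left_comm, ENNReal.tsum_mul_left]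
    _ ≤ C₁ * ∑' i : ℕ, 2 ^ (i * (β * p - n * θ + n) - k * (β * p - n * θ)) *
          (C₂ * ENNReal.ofReal (μ i) ^ (-p) * I) := by
        simp_rw [hreindex]
        refine mul_le_mul_right (ENNReal.tsum_le_tsum fun i => mul_le_mul_right ?_ _) _
        exact h₂ f g (μ i) hf hg hfm hgm (hμ0 i)
    _ = _ := by
        rw [show ∀ A B D E F G H : ℝ≥0∞, A * (B * D * E * F) * G * H = A * (F * (B * D * E * G * H)) from
          fun A B D E F G H => by ring, ← ENNReal.tsum_mul_right]
        congr 1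
        refine tsum_congr fun i => ?_
        rw [hμp]
        calc _ = (2 : ℝ≥0∞) ^ (i * (β * p - n * θ + n) - k * (β * p - n * θ)) *
              2 ^ ((-(i : ℝ) * ε + (i - k) * (k + β)) * (-p)) *
              (C₂ * ENNReal.ofReal c ^ (-p) * ENNReal.ofReal lam ^ (-p) * I) := by ring
          _ = (2 : ℝ≥0∞) ^ (-(i : ℝ) * s) * 2 ^ (k * (k * p + n * θ)) *
              (C₂ * ENNReal.ofReal c ^ (-p) * ENNReal.ofReal lam ^ (-p) * I) := by
            rw [← two_rpow_add, ← two_rpow_add]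
            congr 2
            rw [hs]; ring
          _ = _ := by ring

end LevelSums

section UpperBound
variable {n : ℕ}

lemma ne_zero_of_mem_Gam {p q γ : ℝ} (hq : 0 < q) (hγ : γ ∈ Gam p q) : γ ≠ 0 := by
  rintro rfl
  rw [Gam] at hγ
  split_ifs at hγ
  · rcases hγ with h | h
    · exact absurd (mem_Iio.1 h) (by linarith)
    · exact lt_irrefl _ (mem_Ioi.1 h)
  · exact hγ rfl

lemma rpow_le_two_rpow_of_mem_dyadic {r σ : ℝ} (h1 : (2 : ℝ) ^ (σ - 1) ≤ r) (h2 : r ≤ 2 ^ σ) (s : ℝ) :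
    r ^ s ≤ 2 ^ |s| * 2 ^ (σ * s) := by
  have hr : 0 < r := (Real.rpow_pos_of_pos two_pos _).trans_le h1
  rw [← Real.rpow_add two_pos]
  rcases le_total 0 s with hs | hs
  · calc r ^ s ≤ (2 ^ σ) ^ s := Real.rpow_le_rpow hr.le h2 hs
      _ = 2 ^ (σ * s) := by rw [← Real.rpow_mul two_pos.le]
      _ ≤ _ := Real.rpow_le_rpow_of_exponent_le one_le_two (by linarith [abs_nonneg s])
  · calc r ^ s ≤ ((2 : ℝ) ^ (σ - 1)) ^ s :=
          Real.rpow_le_rpow_of_nonpos (by positivity) h1 hs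
      _ = _ := by rw [← Real.rpow_mul two_pos.le, abs_of_nonpos hs]; congr 1; ring

lemma two_rpow_le_rpow_of_mem_dyadic {r σ : ℝ} (h1 : (2 : ℝ) ^ (σ - 1) ≤ r) (h2 : r ≤ 2 ^ σ) (s : ℝ) :
    2 ^ (-|s|) * 2 ^ (σ * s) ≤ r ^ s := by
  have hr : 0 < r := (Real.rpow_pos_of_pos two_pos _).trans_le h1
  have h := rpow_le_two_rpow_of_mem_dyadic h1 h2 (-s)
  rw [abs_neg, Real.rpow_neg hr.le] at h
  have h3 := inv_anti₀ (by positivity) h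
  rwa [inv_inv, mul_inv, ← Real.rpow_neg two_pos.le, ← Real.rpow_neg two_pos.le,
    mul_neg, neg_neg] at h3

lemma innerInt_le_tsum_levelVol {f : En n → ℝ} (hf : Measurable f) (k : ℕ) (β γ : ℝ) {lam : ℝ}
    (hlam : 0 < lam) (x : En n) :
    innerInt k k lam β γ f x ≤ 2 ^ |γ - n| * ∑' j : ℤ, (2 : ℝ≥0∞) ^ ((j : ℝ) * (γ - n)) *
      levelVol k f ((2 : ℝ) ^ (j : ℝ))
        (2 ^ (-|(k : ℝ) + β|) * lam * (2 : ℝ) ^ ((j : ℝ) * (k + β))) x := by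
  set A : ℤ → Set (En n) := fun j => {h | ‖h‖ < (2 : ℝ) ^ (j : ℝ) ∧
    2 ^ (-|(k : ℝ) + β|) * lam * (2 : ℝ) ^ ((j : ℝ) * (k + β)) < |kDiff k f h x|} with hA
  have hAm : ∀ j, MeasurableSet (A j) := fun j =>
    measurable_prodMk_left (x := x) (measurableSet_level hf ((2 : ℝ) ^ (j : ℝ))
      (2 ^ (-|(k : ℝ) + β|) * lam * (2 : ℝ) ^ ((j : ℝ) * (k + β))))
  have hpt : ∀ h : En n, (if memE k k lam β f x h then ENNReal.ofReal (‖h‖ ^ (γ - (n : ℝ))) else 0)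
      ≤ ∑' j : ℤ, (A j).indicator
        (fun _ => (2 : ℝ≥0∞) ^ |γ - n| * 2 ^ ((j : ℝ) * (γ - n))) h := by
    intro h
    split_ifs with hE
    · obtain ⟨h0, hE⟩ := hE
      obtain ⟨m, hm1, hm2⟩ := exists_mem_Ico_zpow (norm_pos_iff.2 h0) (one_lt_two (α := ℝ))
      have h1 : (2 : ℝ) ^ (((m + 1 : ℤ) : ℝ) - 1) ≤ ‖h‖ := by
        rw [← Real.rpow_intCast] at hm1; simpa using hm1
      have h2 : ‖h‖ < 2 ^ ((m + 1 : ℤ) : ℝ) := by rwa [Real.rpow_intCast]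
      have hmem : h ∈ A (m + 1) := by
        refine ⟨h2, lt_of_le_of_lt ?_ hE⟩
        have := mul_le_mul_of_nonneg_left (two_rpow_le_rpow_of_mem_dyadic h1 h2.le (k + β)) hlam.le
        linarith
      refine le_trans ?_ (ENNReal.le_tsum (m + 1))
      rw [indicator_of_mem hmem, ← ofReal_two_rpow, ← ofReal_two_rpow, ← ENNReal.ofReal_mul (by positivity)]
      exact ENNReal.ofReal_le_ofReal (rpow_le_two_rpow_of_mem_dyadic h1 h2.le _)
    · exact zero_le
  refine (lintegral_mono hpt).trans (le_of_eq ?_)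
  rw [lintegral_tsum fun j => (measurable_const.indicator (hAm j)).aemeasurable, ← ENNReal.tsum_mul_left]
  refine tsum_congr fun j => ?_
  rw [lintegral_indicator_const (hAm j), mul_assoc, levelVol]

lemma rpow_tsum_two_rpow_mul_le {p q q₁ β : ℝ} (hp : 0 < p) (hq : 0 < q) (hqq : q < q₁) (hβ : β ≠ 0)
    {ω : ℝ≥0∞} (hω : ω ≠ ⊤) :
    ∃ C : ℝ≥0∞, C < ⊤ ∧ ∀ a : ℤ → ℝ≥0∞, (∀ j, a j ≤ ω) →
      (∑' j : ℤ, (2 : ℝ≥0∞) ^ ((j : ℝ) * (β * q)) * a j) ^ (p / q)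
        ≤ C * ∑' j : ℤ, (2 : ℝ≥0∞) ^ ((j : ℝ) * (β * p)) * a j ^ (p / q₁) := by
  have hq₁ : 0 < q₁ := hq.trans hqq
  have hθ : 0 < p / q₁ := by positivity
  have hpq : 0 < p / q := by positivity
  obtain ⟨C, hC0, hCt, hC⟩ := tsum_min_two_rpow_le hβ hq (sub_pos.2 hqq)
  set ω' : ℝ≥0∞ := max ω 1 with hω'
  have hω't : ω' ≠ ⊤ := by simp [hω', hω]
  have hω'0 : ω' ≠ 0 := (one_pos.trans_le (le_max_right ω 1)).ne'
  have hK0 : (ω' * C) ^ (p / q) ≠ 0 := by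
    rw [Ne, ENNReal.rpow_eq_zero_iff]
    simp [hω'0, hC0, hω't, hCt.ne, ENNReal.mul_eq_top, hpq.not_gt]
  refine ⟨(ω' * C) ^ (p / q), ENNReal.rpow_lt_top_of_nonneg hpq.le (ENNReal.mul_ne_top hω't hCt.ne),
    fun a ha => ?_⟩
  set S := ∑' j : ℤ, (2 : ℝ≥0∞) ^ ((j : ℝ) * (β * p)) * a j ^ (p / q₁) with hS
  rcases eq_or_ne S ⊤ with hSt | hSt
  · rw [hSt, ENNReal.mul_top hK0]; exact le_top
  rcases eq_or_ne S 0 with hS0 | hS0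
  · have h0 : ∀ j, a j = 0 := fun j => by
      have := (ENNReal.tsum_eq_zero.1 hS0) j
      rcases mul_eq_zero.1 this with h | h
      · exact absurd h (two_rpow_ne_zero _)
      · exact (ENNReal.rpow_eq_zero_iff_of_pos hθ).1 h
    simp [h0, hpq]
  set σ := S ^ (1 / p) with hσ
  have hσ0 : σ ≠ 0 := by
    rw [hσ, Ne, ENNReal.rpow_eq_zero_iff]; simp [hS0, hSt]
  have hσt : σ ≠ ⊤ := ENNReal.rpow_ne_top_of_nonneg (by positivity) hSt
  have hσp : σ ^ p = S := by
    rw [hσ, ← ENNReal.rpow_mul, one_div_mul_cancel hp.ne', ENNReal.rpow_one]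
  have hterm : ∀ j : ℤ, (2 : ℝ≥0∞) ^ ((j : ℝ) * (β * q)) * a j
      ≤ σ ^ q * ω' * min ((2 ^ ((j : ℝ) * β) / σ) ^ q) ((2 ^ ((j : ℝ) * β) / σ) ^ (-(q₁ - q))) := by
    intro j
    set r : ℝ≥0∞ := 2 ^ ((j : ℝ) * β) / σ with hr
    have hr0 : r ≠ 0 := ENNReal.div_ne_zero.2 ⟨two_rpow_ne_zero _, hσt⟩
    have hrt : r ≠ ⊤ := ENNReal.div_ne_top (two_rpow_ne_top _) hσ0
    have hrσ : (2 : ℝ≥0∞) ^ ((j : ℝ) * β) = σ * r := (ENNReal.mul_div_cancel hσ0 hσt).symm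
    have e1 : ∀ t : ℝ, (2 : ℝ≥0∞) ^ ((j : ℝ) * (β * t)) = σ ^ t * r ^ t := fun t => by
      rw [← mul_assoc, ENNReal.rpow_mul, hrσ, ENNReal.mul_rpow_of_ne_top hσt hrt]
    have h1 : a j ≤ r ^ (-q₁) := by
      have h2 : r ^ p * a j ^ (p / q₁) ≤ 1 := by
        have h3 : σ ^ p * r ^ p * a j ^ (p / q₁) ≤ S := by
          rw [← e1]; exact ENNReal.le_tsum j
        rw [hσp, mul_assoc] at h3
        nth_rewrite 2 [← mul_one S] at h3
        exact (ENNReal.mul_le_mul_iff_right hS0 hSt).1 h3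
      have h3 := ENNReal.rpow_le_rpow h2 (show 0 ≤ q₁ / p by positivity)
      rw [ENNReal.one_rpow, ENNReal.mul_rpow_of_nonneg _ _ (by positivity), ← ENNReal.rpow_mul,
        ← ENNReal.rpow_mul, show p * (q₁ / p) = q₁ by field_simp,
        show p / q₁ * (q₁ / p) = 1 by field_simp, ENNReal.rpow_one, mul_comm] at h3
      rw [ENNReal.rpow_neg, ← one_div]
      exact (ENNReal.le_div_iff_mul_le (Or.inl (by simp [ENNReal.rpow_eq_zero_iff, hr0, hrt]))
        (Or.inl (ENNReal.rpow_ne_top_of_nonneg hq₁.le hrt))).2 h3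
    rw [e1, mul_assoc, mul_assoc]
    refine mul_le_mul_right ?_ _
    rw [mul_min, le_min_iff]
    constructor
    · rw [mul_comm]
      exact mul_le_mul_left ((ha j).trans (le_max_left _ _)) _
    · calc r ^ q * a j ≤ r ^ q * r ^ (-q₁) := mul_le_mul_right h1 _
        _ = 1 * r ^ (-(q₁ - q)) := by
          rw [← ENNReal.rpow_add _ _ hr0 hrt, one_mul]; congr 1; ring
        _ ≤ _ := mul_le_mul_left (le_max_right _ _) _
  calc _ ≤ (σ ^ q * ω' * C) ^ (p / q) := by
        refine ENNReal.rpow_le_rpow ((ENNReal.tsum_le_tsum hterm).trans ?_) hpq.le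
        rw [ENNReal.tsum_mul_left]
        exact mul_le_mul_right (hC σ hσ0 hσt) _
    _ = _ := by
        rw [mul_assoc, ENNReal.mul_rpow_of_nonneg _ _ hpq.le, ← ENNReal.rpow_mul,
          show q * (p / q) = p by field_simp, hσp, mul_comm]

lemma bsvy_le {k : ℕ} (hn : 0 < n) (hk : 0 < k) {p q γ : ℝ} (hp : 1 ≤ p) (hq : 0 < q)
    (hpq : (n : ℝ) * (1 / p - 1 / q) < k) (hγ : γ ∈ Gam p q) :
    ∃ C : ℝ≥0∞, C < ⊤ ∧ ∀ (f : En n → ℝ) (g : (Fin n → ℕ) → En n → ℝ) (lam : ℝ),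
      LocallyIntegrable f volume → HasWeakDerivs k f g → Measurable f → (∀ α, Measurable (g α)) →
      0 < lam → bsvy k k p q (γ / q) γ f lam ≤ C * gradLp p k g := by
  have hp0 : 0 < p := one_pos.trans_le hp
  have hnR : (0 : ℝ) < n := by exact_mod_cast hn
  have hkR : (0 : ℝ) < k := by exact_mod_cast hk
  set β : ℝ := γ / q with hβ
  have hβ0 : β ≠ 0 := div_ne_zero (ne_zero_of_mem_Gam hq hγ) hq.ne'
  have hβq : β * q = γ := div_mul_cancel₀ _ hq.ne'
  obtain ⟨q₁, hqq, hpq₁, hq₁k⟩ : ∃ q₁ : ℝ, q < q₁ ∧ p ≤ q₁ ∧ (n : ℝ) * (1 - p / q₁) < k * p := by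
    rcases lt_or_ge q p with h | h
    · exact ⟨p, h, le_rfl, by rw [div_self hp0.ne']; simpa using mul_pos hkR hp0⟩
    · have hcont : Tendsto (fun t : ℝ => (n : ℝ) * (1 - p / t)) (𝓝[>] q) (𝓝 ((n : ℝ) * (1 - p / q))) := by
        refine tendsto_nhdsWithin_of_tendsto_nhds (ContinuousAt.tendsto ?_)
        exact continuousAt_const.mul (continuousAt_const.sub
          (continuousAt_const.div continuousAt_id hq.ne'))
      have hlt : (n : ℝ) * (1 - p / q) < k * p := by
        have := mul_lt_mul_of_pos_right hpq hp0
        calc (n : ℝ) * (1 - p / q) = n * (1 / p - 1 / q) * p := by field_simp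
          _ < _ := this
      obtain ⟨t, ht1, ht2⟩ := ((hcont.eventually_lt_const hlt).and self_mem_nhdsWithin).exists
      exact ⟨t, ht2, h.trans (le_of_lt ht2), ht1⟩
  have hq₁ : 0 < q₁ := hq.trans hqq
  set θ : ℝ := p / q₁ with hθ
  have hθ0 : 0 < θ := by positivity
  have hθ1 : θ ≤ 1 := (div_le_one hq₁).2 hpq₁
  set ω := volume (Metric.ball (0 : En n) 1) with hω
  obtain ⟨C₁, hC₁, h₁⟩ := sum_lintegral_levelVol_rpow_le (n := n) hk hp hq hγ hθ0 hθ1 hq₁k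
  obtain ⟨C₂, hC₂, h₂⟩ := rpow_tsum_two_rpow_mul_le (p := p) hp0 hq hqq hβ0
    (measure_ball_lt_top.ne : ω ≠ ⊤)
  set c : ℝ := 2 ^ (-|(k : ℝ) + β|) with hc
  have hc0 : 0 < c := by positivity
  set K : ℝ≥0∞ := (2 ^ |γ - n|) ^ (p / q) * C₂ * C₁ * ENNReal.ofReal c ^ (-p) with hK
  have hKt : K < ⊤ := by
    refine ENNReal.mul_lt_top (ENNReal.mul_lt_top (ENNReal.mul_lt_top ?_ hC₂) hC₁) ?_
    · exact ENNReal.rpow_lt_top_of_nonneg (by positivity) (two_rpow_ne_top _)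
    · rw [lt_top_iff_ne_top, Ne, ENNReal.rpow_eq_top_iff]; simp [hc0]
  refine ⟨K ^ (1 / p), ENNReal.rpow_lt_top_of_nonneg (by positivity) hKt.ne,
    fun f g lam hf hg hfm hgm hlam => ?_⟩
  set lv : ℤ → En n → ℝ≥0∞ := fun j => levelVol k f ((2 : ℝ) ^ (j : ℝ))
    (c * lam * (2 : ℝ) ^ ((j : ℝ) * (k + β))) with hlv
  have hlvm : ∀ j, Measurable (lv j) := fun j => measurable_levelVol hfm _ _
  have hpt : ∀ x, innerInt k k lam β γ f x ^ (p / q) ≤ (2 ^ |γ - n|) ^ (p / q) * C₂ *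
      ∑' j : ℤ, (2 : ℝ≥0∞) ^ ((j : ℝ) * (β * p - n * θ)) * lv j x ^ θ := by
    intro x
    refine (ENNReal.rpow_le_rpow (innerInt_le_tsum_levelVol hfm k β γ hlam x) (by positivity)).trans ?_
    rw [ENNReal.mul_rpow_of_nonneg _ _ (by positivity), mul_assoc]
    refine mul_le_mul_right ?_ _
    have ha : ∀ j : ℤ, (2 : ℝ≥0∞) ^ (-((j : ℝ) * n)) * lv j x ≤ ω := fun j => by
      have h1 : lv j x ≤ 2 ^ ((j : ℝ) * n) * ω := by
        rw [hω, ← volume_ball_two_rpow (0 : En n)]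
        exact measure_mono fun h hh => mem_ball_zero_iff.2 hh.1
      refine (mul_le_mul_right h1 _).trans (le_of_eq ?_)
      rw [← mul_assoc, ← two_rpow_add]; simp
    have h := h₂ (fun j => 2 ^ (-((j : ℝ) * n)) * lv j x) ha
    refine le_trans (le_of_eq ?_) (h.trans (le_of_eq ?_))
    · congr 1
      refine tsum_congr fun j => ?_
      rw [← mul_assoc, ← two_rpow_add, hβq]
      congr 2; ring
    · congr 1
      refine tsum_congr fun j => ?_
      rw [ENNReal.mul_rpow_of_nonneg _ _ hθ0.le, ← ENNReal.rpow_mul, ← mul_assoc, ← two_rpow_add]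
      congr 2; ring
  have hint_le : ∫⁻ x, innerInt k k lam β γ f x ^ (p / q)
      ≤ K * ENNReal.ofReal lam ^ (-p) * ∫⁻ x, ENNReal.ofReal (gradLen k g x) ^ p := by
    refine (lintegral_mono hpt).trans ?_
    rw [lintegral_const_mul' _ _ (ENNReal.mul_ne_top (ENNReal.rpow_ne_top_of_nonneg (by positivity)
        (two_rpow_ne_top _)) hC₂.ne),
      lintegral_tsum fun j => (((hlvm j).pow_const θ).const_mul _).aemeasurable]
    simp_rw [lintegral_const_mul _ ((hlvm _).pow_const θ)]
    refine (mul_le_mul_right (h₁ f g (c * lam) hf hg hfm hgm (by positivity)) _).trans (le_of_eq ?_)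
    rw [ENNReal.ofReal_mul hc0.le, ENNReal.mul_rpow_of_ne_top (by finiteness) (by finiteness)]
    ring
  have hl0 : ENNReal.ofReal lam ≠ 0 := by simpa using hlam
  have hp1 : 0 ≤ 1 / p := by positivity
  rw [bsvy, gradLp]
  refine (mul_le_mul_right (ENNReal.rpow_le_rpow hint_le hp1) _).trans (le_of_eq ?_)
  rw [ENNReal.mul_rpow_of_nonneg _ _ hp1, ENNReal.mul_rpow_of_nonneg _ _ hp1, ← ENNReal.rpow_mul,
    show -p * (1 / p) = -1 by field_simp, ENNReal.rpow_neg_one]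
  have e : ∀ x, ENNReal.ofReal (gradLen k g x) ^ p = ENNReal.ofReal (gradLen k g x ^ p) := fun x =>
    ENNReal.ofReal_rpow_of_nonneg (Real.sqrt_nonneg _) hp0.le
  simp_rw [e]
  rw [← mul_assoc, mul_left_comm, ENNReal.mul_inv_cancel hl0 ENNReal.ofReal_ne_top, mul_one]

end UpperBound

section DirPolyLowerBound
variable {n : ℕ}

lemma continuous_dirPoly (k : ℕ) (v : (Fin n → ℕ) → ℝ) : Continuous (dirPoly k v) :=
  continuous_finsetSum _ fun α _ => (continuous_dirCoeff α).mul continuous_const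

lemma eq_zero_of_dirPoly_eq_zero {k : ℕ} {v : (Fin n → ℕ) → ℝ} (h : ∀ z, dirPoly k v z = 0)
    {α : Fin n → ℕ} (hα : ∑ i, α i = k) : v α = 0 := by
  set e := (Finsupp.equivFunOnFinite (α := Fin n) (M := ℕ)).symm with he
  set P : MvPolynomial (Fin n) ℝ := ∑ α ∈ Finset.piAntidiag (Finset.univ : Finset (Fin n)) k,
    MvPolynomial.monomial (e α) ((Nat.multinomial Finset.univ α : ℝ) * v α) with hP
  have hP0 : P = 0 := by
    refine MvPolynomial.funext fun y => ?_
    rw [map_zero, hP, map_sum]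
    refine Eq.trans (Finset.sum_congr rfl fun α _ => ?_) (h (WithLp.toLp 2 y))
    rw [MvPolynomial.eval_monomial, Finsupp.prod_fintype _ _ (by simp), dirCoeff]
    simp [he]
    ring
  have hc := congrArg (MvPolynomial.coeff (e α)) hP0
  rw [hP, MvPolynomial.coeff_sum, Finset.sum_eq_single α] at hc
  · rw [MvPolynomial.coeff_monomial, if_pos rfl, MvPolynomial.coeff_zero] at hc
    rcases mul_eq_zero.1 hc with h0 | h0
    · exact absurd (Nat.cast_eq_zero.1 h0) (Nat.multinomial_pos _ _).ne'
    · exact h0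
  · intro α' _ hne
    rw [MvPolynomial.coeff_monomial, if_neg (e.injective.ne hne)]
  · intro hmem
    exact absurd (Finset.mem_piAntidiag.2 ⟨hα, by simp⟩) hmem

lemma exists_dirPoly_ne_zero {k : ℕ} (hk : 0 < k) {v : (Fin n → ℕ) → ℝ} {α : Fin n → ℕ}
    (hα : ∑ i, α i = k) (hv : v α ≠ 0) :
    ∃ z : En n, ‖z‖ ∈ Ioo (1 / 2 : ℝ) 1 ∧ dirPoly k v z ≠ 0 := by
  obtain ⟨y, hy⟩ : ∃ y, dirPoly k v y ≠ 0 := by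
    by_contra! h
    exact hv (eq_zero_of_dirPoly_eq_zero h hα)
  have hy0 : y ≠ 0 := by
    rintro rfl
    have := dirPoly_smul k v 0 (0 : En n)
    rw [zero_smul, zero_pow hk.ne', zero_mul] at this
    exact hy this
  have hn : 0 < ‖y‖ := norm_pos_iff.2 hy0
  refine ⟨((3 / 4) / ‖y‖) • y, ?_, ?_⟩
  · rw [norm_smul, Real.norm_of_nonneg (by positivity), div_mul_cancel₀ _ hn.ne']
    norm_num
  · rw [dirPoly_smul]
    exact mul_ne_zero (pow_ne_zero _ (by positivity)) hy

lemma exists_volume_dirPoly_gt {k : ℕ} (hk : 0 < k) :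
    ∃ c : ℝ, 0 < c ∧ ∃ κ : ℝ≥0∞, 0 < κ ∧ ∀ v : (Fin n → ℕ) → ℝ,
      0 < √(∑ α ∈ Finset.piAntidiag (Finset.univ : Finset (Fin n)) k, v α ^ 2) →
      κ ≤ volume {z : En n | ‖z‖ ∈ Ioo (1 / 2 : ℝ) 1 ∧
        c * √(∑ α ∈ Finset.piAntidiag (Finset.univ : Finset (Fin n)) k, v α ^ 2) < |dirPoly k v z|} := by
  set s := Finset.piAntidiag (Finset.univ : Finset (Fin n)) k with hs
  set ext : EuclideanSpace ℝ s → (Fin n → ℕ) → ℝ := fun w α => if h : α ∈ s then w ⟨α, h⟩ else 0 with hext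
  have hextc : ∀ α, Continuous fun w => ext w α := fun α => by
    by_cases h : α ∈ s
    · simp only [hext, dif_pos h]; fun_prop
    · simp only [hext, dif_neg h]; exact continuous_const
  have hcont : Continuous fun z : EuclideanSpace ℝ s × En n => |dirPoly k (ext z.1) z.2| := by
    refine Continuous.abs (continuous_finsetSum _ fun α _ => ?_)
    exact ((continuous_dirCoeff α).comp continuous_snd).mul ((hextc α).comp continuous_fst)
  have hcpt : ∃ c : ℝ, 0 < c ∧ ∃ κ : ℝ≥0∞, 0 < κ ∧ ∀ w ∈ Metric.sphere (0 : EuclideanSpace ℝ s) 1,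
      κ ≤ volume {z : En n | ‖z‖ ∈ Ioo (1 / 2 : ℝ) 1 ∧ c < |dirPoly k (ext w) z|} := by
    refine (isCompact_sphere (0 : EuclideanSpace ℝ s) 1).induction_on ?_ ?_ ?_ ?_
    · exact ⟨1, one_pos, 1, one_pos, fun w hw => absurd hw (notMem_empty w)⟩
    · rintro S S' hSS ⟨c, hc, κ, hκ, h⟩
      exact ⟨c, hc, κ, hκ, fun w hw => h w (hSS hw)⟩
    · rintro S S' ⟨c, hc, κ, hκ, h⟩ ⟨c', hc', κ', hκ', h'⟩
      refine ⟨min c c', lt_min hc hc', min κ κ', lt_min hκ hκ', fun w hw => ?_⟩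
      rcases hw with hw | hw
      · exact ((min_le_left _ _).trans (h w hw)).trans
          (measure_mono fun z hz => ⟨hz.1, (min_le_left _ _).trans_lt hz.2⟩)
      · exact ((min_le_right _ _).trans (h' w hw)).trans
          (measure_mono fun z hz => ⟨hz.1, (min_le_right _ _).trans_lt hz.2⟩)
    · intro w hw
      obtain ⟨⟨α, hα⟩, hwα⟩ : ∃ a, w a ≠ 0 := by
        by_contra! h
        have : w = 0 := by ext a; exact h a
        rw [mem_sphere_zero_iff_norm, this, norm_zero] at hw
        exact zero_ne_one hw
      obtain ⟨z, hz1, hz2⟩ := exists_dirPoly_ne_zero (v := ext w) hk (Finset.mem_piAntidiag.1 hα).1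
        (by simpa only [hext, dif_pos hα] using hwα)
      have hpos : 0 < |dirPoly k (ext w) z| := abs_pos.2 hz2
      have hev := (hcont.tendsto (w, z)).eventually_const_lt (half_lt_self hpos)
      rw [nhds_prod_eq, eventually_prod_iff] at hev
      obtain ⟨p₁, h₁, p₂, h₂, h⟩ := hev
      have hann : ∀ᶠ y : En n in 𝓝 z, ‖y‖ ∈ Ioo (1 / 2 : ℝ) 1 :=
        continuous_norm.continuousAt.eventually_mem (isOpen_Ioo.mem_nhds hz1)
      refine ⟨{w | p₁ w}, mem_nhdsWithin_of_mem_nhds h₁, _, half_pos hpos, _,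
        Measure.measure_pos_of_mem_nhds volume (h₂.and hann), fun w' hw' => measure_mono fun y hy => ?_⟩
      exact ⟨hy.2, h hw' hy.1⟩
  obtain ⟨c, hc, κ, hκ, h⟩ := hcpt
  refine ⟨c, hc, κ, hκ, fun v hv => ?_⟩
  set L := √(∑ α ∈ s, v α ^ 2) with hL
  set w : EuclideanSpace ℝ s := WithLp.toLp 2 fun a => v a / L with hw
  have hw1 : w ∈ Metric.sphere (0 : EuclideanSpace ℝ s) 1 := by
    rw [mem_sphere_zero_iff_norm, EuclideanSpace.norm_eq]
    have : ∑ a, ‖w a‖ ^ 2 = (∑ α ∈ s, v α ^ 2) / L ^ 2 := by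
      rw [← Finset.sum_coe_sort s, Finset.sum_div]
      refine Finset.sum_congr rfl fun a _ => ?_
      rw [Real.norm_eq_abs, sq_abs, hw, div_pow]
    rw [this, Real.sqrt_div' _ (sq_nonneg L), ← hL, Real.sqrt_sq hv.le, div_self hv.ne']
  have hpoly : ∀ z, dirPoly k v z = L * dirPoly k (ext w) z := fun z => by
    rw [dirPoly, dirPoly, Finset.mul_sum]
    refine Finset.sum_congr rfl fun α hα => ?_
    rw [show ext w α = v α / L by simp only [hext, dif_pos (show α ∈ s from hα), hw]]
    field_simp
  refine (h w hw1).trans (measure_mono fun z hz => ⟨hz.1, ?_⟩)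
  rw [hpoly, abs_mul, abs_of_pos hv, mul_comm]
  exact mul_lt_mul_of_pos_left hz.2 hv

end DirPolyLowerBound

section LowerBound
variable {n : ℕ}

lemma measurable_innerInt {f : En n → ℝ} (hf : Measurable f) (k ℓ : ℕ) (lam b γ : ℝ) :
    Measurable (innerInt k ℓ lam b γ f) := by
  have hS : MeasurableSet {z : En n × En n | memE k ℓ lam b f z.1 z.2} := by
    have h1 : MeasurableSet {z : En n × En n | z.2 ≠ 0} :=
      (measurableSet_eq_fun measurable_snd measurable_const).compl
    have h2 : MeasurableSet {z : En n × En n | lam * ‖z.2‖ ^ ((ℓ : ℝ) + b) < |kDiff k f z.2 z.1|} :=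
      measurableSet_lt (by fun_prop) (measurable_kDiff hf k).abs
    exact h1.inter h2
  have hF : Measurable fun z : En n × En n =>
      if memE k ℓ lam b f z.1 z.2 then ENNReal.ofReal (‖z.2‖ ^ (γ - (n : ℝ))) else 0 :=
    Measurable.ite hS (by fun_prop) measurable_const
  exact hF.lintegral_prod_right'

lemma le_volume_rescaled_kDiff_gt {k : ℕ} {f : En n → ℝ} (hf : Measurable f) {P : En n → ℝ}
    (hP : Measurable P) {x : En n} {r η : ℝ} (hη : 0 < η) (hr : 0 < r) {κ : ℝ≥0∞}
    (hκ : κ ≤ volume {z : En n | ‖z‖ ∈ Ioo (1 / 2 : ℝ) 1 ∧ 2 * η < |P z|})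
    (hsmall : ∫⁻ z in Metric.ball (0 : En n) 1, ‖kDiff k f (r • z) x / r ^ k - P z‖ₑ
      ≤ ENNReal.ofReal η * (κ / 2)) :
    κ / 2 ≤ volume {z : En n | ‖z‖ ∈ Ioo (1 / 2 : ℝ) 1 ∧ r ^ k * η < |kDiff k f (r • z) x|} := by
  set Z := {z : En n | ‖z‖ ∈ Ioo (1 / 2 : ℝ) 1 ∧ r ^ k * η < |kDiff k f (r • z) x|} with hZ
  set D : En n → ℝ≥0∞ := fun z => ‖kDiff k f (r • z) x / r ^ k - P z‖ₑ with hD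
  have hκt : κ ≠ ⊤ := ne_top_of_le_ne_top (measure_ball_lt_top (x := (0 : En n)) (r := 1)).ne
    (hκ.trans (measure_mono fun z hz => mem_ball_zero_iff.2 hz.1.2))
  have hkm : Measurable fun z : En n => kDiff k f (r • z) x :=
    (measurable_kDiff hf k).comp (g := fun z : En n × En n => kDiff k f z.2 z.1)
      (f := fun z => (x, r • z)) (by fun_prop)
  have hDm : Measurable D := ((hkm.div_const _).sub hP).enorm
  have hBm : MeasurableSet {z | ENNReal.ofReal η ≤ D z} := measurableSet_le measurable_const hDm
  set B := {z | ENNReal.ofReal η ≤ D z} ∩ Metric.ball (0 : En n) 1 with hB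
  have hη0 : ENNReal.ofReal η ≠ 0 := by simpa using hη
  have hBvol : volume B ≤ κ / 2 := by
    have h1 := (mul_meas_ge_le_lintegral (μ := volume.restrict (Metric.ball (0 : En n) 1)) hDm
      (ENNReal.ofReal η)).trans hsmall
    rw [Measure.restrict_apply hBm] at h1
    exact (ENNReal.mul_le_mul_iff_right hη0 ENNReal.ofReal_ne_top).1 h1
  have hsub : {z : En n | ‖z‖ ∈ Ioo (1 / 2 : ℝ) 1 ∧ 2 * η < |P z|} ⊆ Z ∪ B := by
    rintro z ⟨hz1, hz2⟩
    by_contra hcon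
    rw [mem_union, not_or] at hcon
    have h1 : |kDiff k f (r • z) x| ≤ r ^ k * η := not_lt.1 fun h => hcon.1 ⟨hz1, h⟩
    have h2 : |kDiff k f (r • z) x / r ^ k - P z| < η := by
      refine not_le.1 fun h => hcon.2 ⟨?_, mem_ball_zero_iff.2 hz1.2⟩
      show ENNReal.ofReal η ≤ D z
      rw [hD]
      simp only
      rw [← ofReal_norm, Real.norm_eq_abs]
      exact ENNReal.ofReal_le_ofReal h
    have h3 : |kDiff k f (r • z) x / r ^ k| ≤ η := by
      rw [abs_div, abs_of_pos (pow_pos hr k), div_le_iff₀ (pow_pos hr k)]; linarith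
    have h4 := abs_sub_abs_le_abs_sub (P z) (kDiff k f (r • z) x / r ^ k)
    rw [abs_sub_comm] at h4
    linarith
  have h := (hκ.trans (measure_mono hsub)).trans ((measure_union_le Z B).trans (add_le_add_right hBvol _))
  rw [← ENNReal.add_halves κ] at h
  refine (ENNReal.add_le_add_iff_right (ENNReal.div_ne_top hκt two_ne_zero)).1 (h.trans ?_)
  rw [ENNReal.add_halves]

lemma eventually_le_innerInt {k : ℕ} (hk : 0 < k) {q γ : ℝ} (hq : 0 < q) (hγ : γ ≠ 0) :
    ∃ C : ℝ≥0∞, 0 < C ∧ ∀ (f : En n → ℝ) (g : (Fin n → ℕ) → En n → ℝ) (x : En n), Measurable f →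
      Tendsto (fun δ : ℝ => ∫⁻ h in Metric.ball (0 : En n) 1,
        ‖kDiff k f (δ • h) x / δ ^ k - dirPoly k (fun α => g α x) h‖ₑ) (𝓝[>] 0) (𝓝 0) →
      ∀ᶠ δ in 𝓝[>] (0 : ℝ), C * ENNReal.ofReal (gradLen k g x) ^ q
        ≤ ENNReal.ofReal (δ ^ (-(γ / q))) ^ q * innerInt k k (δ ^ (-(γ / q))) (γ / q) γ f x := by
  obtain ⟨c, hc, κ, hκ, hvol⟩ := exists_volume_dirPoly_gt (n := n) hk
  set β := γ / q with hβ
  have hβ0 : β ≠ 0 := div_ne_zero hγ hq.ne'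
  have hβq : β * q = γ := div_mul_cancel₀ _ hq.ne'
  set A : ℝ := c / 2 * 2 ^ (-|(k : ℝ) + β|) with hA
  have hA0 : 0 < A := by positivity
  refine ⟨ENNReal.ofReal (A ^ q * 2 ^ (-|γ - n|)) * (κ / 2), ?_, fun f g x hfm hx => ?_⟩
  · exact ENNReal.mul_pos (by simp only [ne_eq, ENNReal.ofReal_eq_zero, not_le]; positivity)
      (ENNReal.div_pos hκ.ne' (by simp)).ne'
  set L := gradLen k g x with hL
  have hL0 : 0 ≤ L := Real.sqrt_nonneg _
  rcases hL0.eq_or_lt with h0 | hLpos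
  · simp [← h0, hq]
  set η : ℝ := c * L / 2 with hη
  have hη0 : 0 < η := by positivity
  set τ : ℝ := (A * L) ^ (1 / β) with hτ
  have hτ0 : 0 < τ := by positivity
  have hτβ : τ ^ β = A * L := by
    rw [hτ, ← Real.rpow_mul (by positivity), one_div_mul_cancel hβ0, Real.rpow_one]
  have hκ' : κ ≤ volume {z : En n | ‖z‖ ∈ Ioo (1 / 2 : ℝ) 1 ∧
      2 * η < |dirPoly k (fun α => g α x) z|} := by
    have := hvol (fun α => g α x) (by rwa [← gradLen_eq])
    rw [← gradLen_eq, ← hL] at this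
    rwa [show 2 * η = c * L by rw [hη]; ring]
  have hscale : Tendsto (fun δ : ℝ => δ * τ) (𝓝[>] 0) (𝓝[>] 0) := by
    refine tendsto_nhdsWithin_iff.2 ⟨?_, ?_⟩
    · refine tendsto_nhdsWithin_of_tendsto_nhds ?_
      simpa using (tendsto_id (x := 𝓝 (0 : ℝ))).mul_const τ
    · filter_upwards [self_mem_nhdsWithin] with δ hδ
      exact mul_pos hδ hτ0
  have hpos : 0 < ENNReal.ofReal η * (κ / 2) :=
    ENNReal.mul_pos (by simpa using hη0) (ENNReal.div_pos hκ.ne' (by simp)).ne'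
  filter_upwards [hscale.eventually (ENNReal.tendsto_nhds_zero.1 hx _ hpos), self_mem_nhdsWithin]
    with δ hδ hδ0
  have hδ0 : 0 < δ := hδ0
  set r := δ * τ with hr
  have hr0 : 0 < r := mul_pos hδ0 hτ0
  have hZ := le_volume_rescaled_kDiff_gt hfm (continuous_dirPoly k _).measurable hη0 hr0 hκ' hδ
  set Z := {z : En n | ‖z‖ ∈ Ioo (1 / 2 : ℝ) 1 ∧ r ^ k * η < |kDiff k f (r • z) x|} with hZdef
  have hkm : Measurable fun z : En n => kDiff k f (r • z) x :=
    (measurable_kDiff hfm k).comp (g := fun z : En n × En n => kDiff k f z.2 z.1)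
      (f := fun z => (x, r • z)) (by fun_prop)
  have hZm : MeasurableSet Z := by
    have h1 : MeasurableSet {z : En n | ‖z‖ ∈ Ioo (1 / 2 : ℝ) 1} := measurable_norm measurableSet_Ioo
    have h2 : MeasurableSet {z : En n | r ^ k * η < |kDiff k f (r • z) x|} :=
      measurableSet_lt measurable_const hkm.abs
    exact h1.inter h2
  have hdy : ∀ z : En n, ‖z‖ ∈ Ioo (1 / 2 : ℝ) 1 → (2 : ℝ) ^ ((0 : ℝ) - 1) ≤ ‖z‖ ∧ ‖z‖ ≤ 2 ^ (0 : ℝ) :=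
    fun z hz => ⟨by rw [zero_sub, Real.rpow_neg_one]; linarith [hz.1], by simpa using hz.2.le⟩
  set G : En n → ℝ≥0∞ := fun h =>
    if memE k k (δ ^ (-β)) β f x h then ENNReal.ofReal (‖h‖ ^ (γ - (n : ℝ))) else 0 with hG
  have hpt : ∀ z, Z.indicator (fun _ => ENNReal.ofReal (r ^ (γ - n) * 2 ^ (-|γ - n|))) z ≤ G (r • z) := by
    intro z
    by_cases hz : z ∈ Z
    swap
    · rw [indicator_of_notMem hz]; exact zero_le
    obtain ⟨h1, h2⟩ := hdy z hz.1
    have hz0 : z ≠ 0 := fun h => by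
      have := hz.1.1; rw [h, norm_zero] at this; linarith
    have hnorm : ‖r • z‖ = r * ‖z‖ := by rw [norm_smul, Real.norm_of_nonneg hr0.le]
    have hmem : memE k k (δ ^ (-β)) β f x (r • z) := by
      refine ⟨smul_ne_zero hr0.ne' hz0, lt_of_le_of_lt ?_ hz.2⟩
      rw [hnorm, Real.mul_rpow hr0.le (norm_nonneg _)]
      have h3 := rpow_le_two_rpow_of_mem_dyadic h1 h2 (k + β)
      rw [zero_mul, Real.rpow_zero, mul_one] at h3
      have h4 : δ ^ (-β) * r ^ ((k : ℝ) + β) = r ^ k * (A * L) := by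
        rw [Real.rpow_add hr0, Real.rpow_natCast, ← hτβ, hr, Real.mul_rpow hδ0.le hτ0.le,
          Real.rpow_neg hδ0.le]
        field_simp
      have h5 : A * 2 ^ |(k : ℝ) + β| = c / 2 := by
        rw [hA, mul_assoc, ← Real.rpow_add two_pos]; simp
      calc δ ^ (-β) * (r ^ ((k : ℝ) + β) * ‖z‖ ^ ((k : ℝ) + β))
          = r ^ k * (A * L) * ‖z‖ ^ ((k : ℝ) + β) := by rw [← mul_assoc, h4]
        _ ≤ r ^ k * (A * L) * 2 ^ |(k : ℝ) + β| := by gcongr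
        _ = r ^ k * (A * 2 ^ |(k : ℝ) + β|) * L := by ring
        _ = r ^ k * η := by rw [h5, hη]; ring
    rw [indicator_of_mem hz, hG]
    simp only
    rw [if_pos hmem, hnorm, Real.mul_rpow hr0.le (norm_nonneg _)]
    have h3 := two_rpow_le_rpow_of_mem_dyadic h1 h2 (γ - n)
    rw [zero_mul, Real.rpow_zero, mul_one] at h3
    exact ENNReal.ofReal_le_ofReal (by gcongr)
  have hint_le := lintegral_mono (μ := volume) hpt
  rw [lintegral_indicator_const hZm, lintegral_comp_smul_of_pos hr0] at hint_le
  have hrn : 0 < r ^ n := pow_pos hr0 n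
  have hI : ENNReal.ofReal (r ^ γ * 2 ^ (-|γ - n|)) * (κ / 2) ≤ innerInt k k (δ ^ (-β)) β γ f x := by
    calc _ = ENNReal.ofReal (r ^ n) * (ENNReal.ofReal (r ^ (γ - n) * 2 ^ (-|γ - n|)) * (κ / 2)) := by
          rw [← mul_assoc, ← ENNReal.ofReal_mul hrn.le, ← mul_assoc, ← Real.rpow_natCast,
            ← Real.rpow_add hr0]
          congr 4; ring
      _ ≤ ENNReal.ofReal (r ^ n) * (ENNReal.ofReal ((r ^ n)⁻¹) * ∫⁻ h, G h) :=
          mul_le_mul_right ((mul_le_mul_right hZ _).trans hint_le) _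
      _ = innerInt k k (δ ^ (-β)) β γ f x := by
          rw [← mul_assoc, ← ENNReal.ofReal_mul hrn.le, mul_inv_cancel₀ hrn.ne', ENNReal.ofReal_one,
            one_mul, innerInt]
  refine le_trans (le_of_eq ?_) (mul_le_mul_right hI _)
  rw [ENNReal.ofReal_rpow_of_nonneg hL0 hq.le, ENNReal.ofReal_rpow_of_nonneg (by positivity) hq.le,
    ← mul_assoc, ← ENNReal.ofReal_mul (by positivity), mul_right_comm, ← ENNReal.ofReal_mul (by positivity)]
  congr 2
  have h6 : r ^ γ = δ ^ γ * (A ^ q * L ^ q) := by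
    rw [hr, Real.mul_rpow hδ0.le hτ0.le, ← Real.mul_rpow hA0.le hL0, ← hτβ, ← Real.rpow_mul hτ0.le, hβq]
  have h7 : (δ ^ (-β)) ^ q * δ ^ γ = 1 := by
    rw [← Real.rpow_mul hδ0.le, ← Real.rpow_add hδ0, ← hβq]
    simp
  rw [h6]
  calc A ^ q * 2 ^ (-|γ - n|) * L ^ q = ((δ ^ (-β)) ^ q * δ ^ γ) * (A ^ q * 2 ^ (-|γ - n|) * L ^ q) := by
        rw [h7, one_mul]
    _ = _ := by ring

lemma le_iSup_bsvy {k : ℕ} (hk : 0 < k) {p q γ : ℝ} (hp : 0 < p) (hq : 0 < q) (hγ : γ ≠ 0) :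
    ∃ C : ℝ≥0∞, 0 < C ∧ ∀ (f : En n → ℝ) (g : (Fin n → ℕ) → En n → ℝ),
      LocallyIntegrable f volume → HasWeakDerivs k f g → Measurable f → (∀ α, Measurable (g α)) →
      C * gradLp p k g ≤ ⨆ lam ∈ Ioi (0 : ℝ), bsvy k k p q (γ / q) γ f lam := by
  obtain ⟨C, hC, hev⟩ := eventually_le_innerInt (n := n) hk hq hγ
  set β := γ / q with hβ
  have hpq : 0 ≤ p / q := by positivity
  have hp1 : 0 ≤ 1 / p := by positivity
  have hC1 : 0 < min C 1 := lt_min hC one_pos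
  refine ⟨(min C 1) ^ (1 / q), ENNReal.rpow_pos hC1 (by simp), fun f g hf hg hfm hgm => ?_⟩
  set S := ⨆ lam ∈ Ioi (0 : ℝ), bsvy k k p q β γ f lam with hS
  set δ : ℕ → ℝ := fun i => 2⁻¹ ^ i with hδ
  have hδ0 : ∀ i, 0 < δ i := fun i => by positivity
  have hδlim : Tendsto δ atTop (𝓝[>] 0) :=
    tendsto_nhdsWithin_iff.2 ⟨tendsto_pow_atTop_nhds_zero_of_lt_one (by norm_num) (by norm_num),
      Eventually.of_forall hδ0⟩
  set lam : ℕ → ℝ := fun i => δ i ^ (-β) with hlam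
  set G : ℕ → En n → ℝ≥0∞ := fun i x =>
    ENNReal.ofReal (lam i) ^ p * innerInt k k (lam i) β γ f x ^ (p / q) with hG
  have hGm : ∀ i, Measurable (G i) := fun i =>
    ((measurable_innerInt hfm k k (lam i) β γ).pow_const _).const_mul _
  have hGint : ∀ i, ∫⁻ x, G i x ≤ S ^ p := fun i => by
    have h1 : bsvy k k p q β γ f (lam i) ≤ S :=
      le_iSup₂ (f := fun l (_ : l ∈ Ioi (0 : ℝ)) => bsvy k k p q β γ f l) (lam i)
        (Real.rpow_pos_of_pos (hδ0 i) _)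
    have h2 := ENNReal.rpow_le_rpow h1 hp.le
    rw [bsvy, ENNReal.mul_rpow_of_nonneg _ _ hp.le, ← ENNReal.rpow_mul, one_div_mul_cancel hp.ne',
      ENNReal.rpow_one] at h2
    rwa [hG, lintegral_const_mul' _ _ (ENNReal.rpow_ne_top_of_nonneg hp.le ENNReal.ofReal_ne_top)]
  have hpt : ∀ᵐ x, (min C 1) ^ (p / q) * ENNReal.ofReal (gradLen k g x ^ p)
      ≤ liminf (fun i => G i x) atTop := by
    filter_upwards [ae_tendsto_rescaled_kDiff hf hg hfm hgm] with x hx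
    refine le_liminf_of_le (by isBoundedDefault) ?_
    filter_upwards [hδlim.eventually (hev f g x hfm hx)] with i hi
    have h1 := ENNReal.rpow_le_rpow ((mul_le_mul_left (min_le_left C 1) _).trans hi) hpq
    rw [ENNReal.mul_rpow_of_nonneg _ _ hpq, ENNReal.mul_rpow_of_nonneg _ _ hpq, ← ENNReal.rpow_mul,
      ← ENNReal.rpow_mul, mul_div_cancel₀ p hq.ne',
      ENNReal.ofReal_rpow_of_nonneg (x := gradLen k g x) (Real.sqrt_nonneg _) hp.le] at h1
    exact h1
  have hmain : (min C 1) ^ (p / q) * ∫⁻ x, ENNReal.ofReal (gradLen k g x ^ p) ≤ S ^ p := by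
    rw [← lintegral_const_mul' _ _ (ENNReal.rpow_ne_top_of_nonneg hpq (by simp))]
    refine (lintegral_mono_ae hpt).trans ((lintegral_liminf_le hGm).trans ?_)
    exact (liminf_le_liminf (Eventually.of_forall hGint)).trans (by simp)
  have h := ENNReal.rpow_le_rpow hmain hp1
  rw [ENNReal.mul_rpow_of_nonneg _ _ hp1, ← ENNReal.rpow_mul, ← ENNReal.rpow_mul, mul_one_div_cancel hp.ne',
    ENNReal.rpow_one, show p / q * (1 / p) = 1 / q by field_simp] at h
  exact h

end LowerBound

section Representatives
variable {n : ℕ}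

lemma innerInt_congr {f f' : En n → ℝ} (h : f =ᵐ[volume] f') (k ℓ : ℕ) (lam b γ : ℝ) :
    innerInt k ℓ lam b γ f =ᵐ[volume] innerInt k ℓ lam b γ f' := by
  filter_upwards [h] with x hx
  have hstep : ∀ j : ℕ, ∀ᵐ y, f (x + (j : ℝ) • y) = f' (x + (j : ℝ) • y) := by
    intro j
    rcases j.eq_zero_or_pos with rfl | hj
    · simp [hx]
    · have hj' : (0 : ℝ) < j := by exact_mod_cast hj
      exact ae_comp_smul (p := fun y => f (x + y) = f' (x + y))
        ((measurePreserving_add_left volume x).quasiMeasurePreserving.ae h) hj'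
  refine lintegral_congr_ae ?_
  filter_upwards [ae_all_iff.2 hstep] with y hy
  have hk : kDiff k f y x = kDiff k f' y x := Finset.sum_congr rfl fun j _ => by rw [hy j]
  exact if_congr (by rw [memE, memE, hk]) rfl rfl

lemma bsvy_congr {f f' : En n → ℝ} (h : f =ᵐ[volume] f') (k ℓ : ℕ) (p q b γ lam : ℝ) :
    bsvy k ℓ p q b γ f lam = bsvy k ℓ p q b γ f' lam := by
  rw [bsvy, bsvy]
  congr 2
  refine lintegral_congr_ae ?_
  filter_upwards [innerInt_congr h k ℓ lam b γ] with x hx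
  rw [hx]

lemma gradLp_congr {k : ℕ} {g g' : (Fin n → ℕ) → En n → ℝ}
    (h : ∀ α, ∑ i, α i = k → g α =ᵐ[volume] g' α) (p : ℝ) : gradLp p k g = gradLp p k g' := by
  rw [gradLp, gradLp]
  congr 1
  refine lintegral_congr_ae ?_
  have hall : ∀ᵐ x, ∀ α ∈ Finset.piAntidiag (Finset.univ : Finset (Fin n)) k, g α x = g' α x :=
    (Finset.eventually_all _).2 fun α hα => h α (Finset.mem_piAntidiag.1 hα).1
  filter_upwards [hall] with x hx
  rw [gradLen_eq, gradLen_eq, Finset.sum_congr rfl fun α hα => by rw [hx α hα]]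

lemma HasWeakDerivs.congr {k : ℕ} {f f' : En n → ℝ} {g g' : (Fin n → ℕ) → En n → ℝ}
    (hg : HasWeakDerivs k f g) (hf : f =ᵐ[volume] f')
    (h : ∀ α, ∑ i, α i = k → g α =ᵐ[volume] g' α) : HasWeakDerivs k f' g' := by
  refine ⟨fun α hα => (hg.1 α hα).congr (h α hα), fun α hα φ hφ hφc => ?_⟩
  have h1 : ∫ x, f' x * mpd α φ x = ∫ x, f x * mpd α φ x :=
    integral_congr_ae (by filter_upwards [hf] with x hx; rw [hx])
  have h2 : ∫ x, g' α x * φ x = ∫ x, g α x * φ x :=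
    integral_congr_ae (by filter_upwards [h α hα] with x hx; rw [hx])
  rw [h1, h2, hg.2 α hα φ hφ hφc]

lemma exists_measurable_representative {k : ℕ} {f : En n → ℝ} {g : (Fin n → ℕ) → En n → ℝ}
    (hf : LocallyIntegrable f volume) (hg : HasWeakDerivs k f g) :
    ∃ (f' : En n → ℝ) (g' : (Fin n → ℕ) → En n → ℝ), f =ᵐ[volume] f' ∧
      (∀ α, ∑ i, α i = k → g α =ᵐ[volume] g' α) ∧ LocallyIntegrable f' volume ∧
      HasWeakDerivs k f' g' ∧ Measurable f' ∧ ∀ α, Measurable (g' α) := by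
  have hfm := hf.aestronglyMeasurable
  have hex : ∀ α : Fin n → ℕ, ∃ u : En n → ℝ, (∑ i, α i = k → g α =ᵐ[volume] u) ∧ Measurable u := by
    intro α
    by_cases hα : ∑ i, α i = k
    · have hm := (hg.1 α hα).aestronglyMeasurable
      exact ⟨hm.mk, fun _ => hm.ae_eq_mk, hm.stronglyMeasurable_mk.measurable⟩
    · exact ⟨0, fun h => absurd h hα, measurable_const⟩
  choose g' hgg' hg'm using hex
  exact ⟨hfm.mk, g', hfm.ae_eq_mk, hgg', hf.congr hfm.ae_eq_mk, hg.congr hfm.ae_eq_mk hgg',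
    hfm.stronglyMeasurable_mk.measurable, hg'm⟩

end Representatives

open MeasureTheory Set
open scoped ENNReal

/-- BSVY formula in `L^p`, higher order. -/
theorem statement0 (n k : ℕ) (hn : 0 < n) (hk : 0 < k) (p q γ : ℝ)
    (hp : 1 ≤ p) (hq : 0 < q) (hpq : (n : ℝ) * (1 / p - 1 / q) < (k : ℝ))
    (hγ : γ ∈ Gam p q) :
    ∃ c C : ℝ, 0 < c ∧ c ≤ C ∧
      ∀ (f : En n → ℝ) (g : (Fin n → ℕ) → En n → ℝ),
        LocallyIntegrable f volume → HasWeakDerivs k f g → gradLp p k g < ⊤ →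
        ENNReal.ofReal c * gradLp p k g
            ≤ (⨆ lam ∈ Ioi (0 : ℝ), bsvy k k p q (γ / q) γ f lam) ∧
        (⨆ lam ∈ Ioi (0 : ℝ), bsvy k k p q (γ / q) γ f lam)
            ≤ ENNReal.ofReal C * gradLp p k g := by
  obtain ⟨C, hC, hupper⟩ := bsvy_le hn hk hp hq hpq hγ
  obtain ⟨c, hc, hlower⟩ := le_iSup_bsvy (n := n) hk (one_pos.trans_le hp) hq (ne_zero_of_mem_Gam hq hγ)
  have hc1 : min c 1 ≠ ⊤ := by simp
  refine ⟨(min c 1).toReal, max C.toReal (min c 1).toReal,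
    ENNReal.toReal_pos (lt_min hc one_pos).ne' hc1, le_max_right _ _, fun f g hf hg _ => ?_⟩
  obtain ⟨f', g', hff', hgg', hf', hg', hfm, hgm⟩ := exists_measurable_representative hf hg
  simp_rw [gradLp_congr hgg' p, bsvy_congr hff']
  constructor
  · refine (mul_le_mul_left ?_ _).trans (hlower f' g' hf' hg' hfm hgm)
    rw [ENNReal.ofReal_toReal hc1]
    exact min_le_left _ _
  · refine iSup₂_le fun lam hlam => (hupper f' g' lam hf' hg' hfm hgm hlam).trans (mul_le_mul_left ?_ _)
    exact (ENNReal.ofReal_toReal hC.ne).symm.trans_le (ENNReal.ofReal_le_ofReal (le_max_left _ _))
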